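/- arXiv:1612.03771 — 4 statements merged into one kernel-verified Lean document; each statement's English description precedes it below -/
import Mathlib

section
/- For any positive integer n and any even positive integer t, the following hook length formula holds: Σ_{λ ∈ SC, |λ| = 2tn, #H_t(λ) = 2n} ∏_{h ∈ H_t(λ)} 1/h = 1/(n! · 2^n · t^n), where the sum ranges over self-conjugate partitions of 2tn having exactly 2n hook lengths divisible by t. -/
/-!
Statement 4 (Theorem `hooklength`): for any positive integer `n` and any even
positive integer `t = 2t'`,
Σ_{λ ∈ SC, |λ| = 2tn, #H_t(λ) = 2n} ∏_{h ∈ H_t(λ)} 1/h = 1/(n! · 2^n · t^n),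
the sum (of rationals) ranging over self-conjugate partitions of `2tn` with
exactly `2n` hook lengths divisible by `t`.
-/

noncomputable section

/-- The hook length of the box `c = (i, j)` (0-indexed) of a Young diagram. -/
def hookLen (μ : YoungDiagram) (c : ℕ × ℕ) : ℕ :=
  μ.rowLen c.1 + μ.colLen c.2 - c.1 - c.2 - 1

namespace HK
open Finset

/-- Product of `f (x - y)` over the pairs `y < x`, `x ∈ X`, `y ∉ X`. -/
def gp {A : Type*} [CommMonoid A] (f : ℕ → A) (X : Finset ℕ) : A :=
  ∏ x ∈ X, ∏ y ∈ range x \ X, f (x - y)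

/-- Number of pairs `y < x`, `x ∈ X`, `y ∉ X`. -/
def hN (X : Finset ℕ) : ℕ := ∑ x ∈ X, (range x \ X).card

/-- Weight. -/
def wt (X : Finset ℕ) : ℚ := gp (fun h => 1 / (h : ℚ)) X

lemma gp_const {A : Type*} [CommMonoid A] (a : A) (X : Finset ℕ) :
    gp (fun _ => a) X = a ^ hN X := by
  simp [gp, hN, prod_pow_eq_pow_sum]

lemma hN_add (X : Finset ℕ) : hN X + X.card.choose 2 = ∑ x ∈ X, x := by
  have h1 : ∑ x ∈ X, x = hN X + ∑ x ∈ X, (range x ∩ X).card := by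
    rw [hN, ← sum_add_distrib]
    refine sum_congr rfl fun x _ => ?_
    rw [card_sdiff_add_card_inter, card_range]
  rw [h1]
  congr 1
  clear h1
  induction X using Finset.induction_on_max with
  | empty => simp
  | insert a s ha ih =>
    have has : a ∉ s := fun h => lt_irrefl _ (ha a h)
    rw [sum_insert has, card_insert_of_notMem has, Nat.choose_succ_succ' , ih, Nat.choose_one_right]
    congr 1
    · congr 1
      ext y
      simp only [mem_inter, mem_range, mem_insert]
      constructor
      · intro h; exact ⟨ha y h, Or.inr h⟩
      · rintro ⟨h1, h2 | h2⟩
        · omega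
        · exact h2
    · refine sum_congr rfl fun x hx => ?_
      congr 1
      ext y
      simp only [mem_inter, mem_range, mem_insert]
      have := ha x hx
      constructor
      · rintro ⟨h1, h2⟩; exact ⟨h1, Or.inr h2⟩
      · rintro ⟨h1, h2 | h2⟩
        · omega
        · exact ⟨h1, h2⟩

lemma fac_prod (x : ℕ) : ∏ y ∈ range x, (1 / ((x - y : ℕ) : ℚ)) = 1 / (x.factorial : ℚ) := by
  rw [← Finset.prod_range_reflect, ← Finset.prod_range_add_one_eq_factorial]
  push_cast
  rw [one_div, ← Finset.prod_inv_distrib]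
  refine prod_congr rfl fun y hy => ?_
  have := mem_range.1 hy
  rw [one_div]
  congr 1
  have : x - (x - 1 - y) = y + 1 := by omega
  rw [this]; push_cast; rfl

lemma wt_insert (x : ℕ) (Z : Finset ℕ) (hx : x ∉ Z) :
    wt (insert x Z) = wt Z * ((∏ z ∈ Z, |(x : ℚ) - z|) / (x.factorial : ℚ)) := by
  have e1 : ∏ y ∈ range x \ insert x Z, (1 / ((x - y : ℕ) : ℚ))
      = (∏ z ∈ Z.filter (· < x), |(x : ℚ) - z|) / (x.factorial : ℚ) := by
    have e2 : range x \ insert x Z = range x \ Z.filter (· < x) := by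
      ext y; simp only [mem_sdiff, mem_range, mem_insert, mem_filter]
      constructor
      · rintro ⟨h, h'⟩; exact ⟨h, fun h2 => h' (Or.inr h2.1)⟩
      · rintro ⟨h, h'⟩
        refine ⟨h, ?_⟩
        rintro (h2 | h2)
        · omega
        · exact h' ⟨h2, h⟩
    have hsub : Z.filter (· < x) ⊆ range x := by
      intro y; simp
    rw [e2, eq_div_iff (by positivity), ← mul_right_inj' (a := (1 / (x.factorial : ℚ))) (by positivity)]
    rw [mul_comm, mul_assoc, mul_one_div_cancel (by positivity), mul_one, ← fac_prod, ← prod_sdiff hsub,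
      mul_assoc, ← prod_mul_distrib]
    rw [prod_eq_one (s := Z.filter (· < x)), mul_one]
    intro z hz
    have hz := (mem_filter.1 hz).2
    have : (z : ℚ) < x := by exact_mod_cast hz
    rw [abs_of_pos (by linarith), Nat.cast_sub hz.le, one_div, inv_mul_cancel₀ (by linarith)]
  have e3 : ∀ z ∈ Z, ∏ y ∈ range z \ insert x Z, (1 / ((z - y : ℕ) : ℚ)) =
      (∏ y ∈ range z \ Z, (1 / ((z - y : ℕ) : ℚ))) * (if z < x then 1 else |(x : ℚ) - z|) := by
    intro z hz
    have hne : z ≠ x := fun h => hx (h ▸ hz)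
    split_ifs with h
    · rw [mul_one]
      congr 1
      ext y; simp only [mem_sdiff, mem_range, mem_insert]
      constructor
      · rintro ⟨h1, h2⟩; exact ⟨h1, fun h3 => h2 (Or.inr h3)⟩
      · rintro ⟨h1, h2⟩
        refine ⟨h1, ?_⟩
        rintro (h3 | h3)
        · omega
        · exact h2 h3
    · have hxz : x < z := by omega
      have hmem : x ∈ range z \ Z := by simp [hxz, hx]
      have : range z \ insert x Z = (range z \ Z).erase x := by
        ext y; simp only [mem_sdiff, mem_range, mem_insert, mem_erase]; tauto
      have hq : (x : ℚ) < z := by exact_mod_cast hxz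
      rw [this, ← mul_prod_erase _ _ hmem, abs_of_neg (by linarith), Nat.cast_sub hxz.le]
      have : (z : ℚ) - x ≠ 0 := by linarith
      field_simp
      ring
  rw [wt, gp, prod_insert hx, e1, prod_congr rfl e3, prod_mul_distrib]
  rw [← prod_filter_mul_prod_filter_not Z (· < x) (fun z => |(x : ℚ) - z|), prod_ite]
  simp only [prod_const_one, one_mul, wt, gp]
  ring

lemma wt_pos (X : Finset ℕ) : 0 < wt X := by
  unfold wt gp
  refine prod_pos fun x _ => prod_pos fun y hy => ?_
  have : y < x := by simpa using (mem_sdiff.1 hy).1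
  have : 0 < x - y := by omega
  positivity

lemma lag (X : Finset ℕ) (P : Polynomial ℚ) (hP : P.degree < X.card) :
    P.coeff (X.card - 1) = ∑ x ∈ X, P.eval (x : ℚ) / ∏ y ∈ X.erase x, ((x : ℚ) - y) :=
  Lagrange.coeff_eq_sum (v := fun x : ℕ => (x : ℚ)) (by intro a _ b _ h; simpa using h) hP

end HK

namespace HK
open Finset

lemma abs_ratio (x z s : ℤ) (hs : |s| ≤ 1) (h1 : x ≠ z) :
    |(x : ℚ) + s - z| / |(x : ℚ) - z| = ((x : ℚ) + s - z) / ((x : ℚ) - z) := by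
  rw [← abs_div, abs_of_nonneg]
  rcases lt_or_gt_of_ne h1 with h | h
  · apply div_nonneg_of_nonpos
    · have : x + s - z ≤ 0 := by have := abs_le.1 hs; omega
      exact_mod_cast this
    · have : x - z ≤ 0 := by omega
      exact_mod_cast this
  · apply div_nonneg
    · have : 0 ≤ x + s - z := by have := abs_le.1 hs; omega
      exact_mod_cast this
    · have : 0 ≤ x - z := by omega
      exact_mod_cast this

lemma wt_move (X : Finset ℕ) (x x' : ℕ) (s : ℤ) (hs : |s| ≤ 1) (hx : x ∈ X) (hx' : x' ∉ X)
    (h : (x' : ℤ) = x + s) :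
    wt (insert x' (X.erase x)) = wt X * (∏ z ∈ X.erase x, ((x : ℚ) + s - z) / ((x : ℚ) - z)) *
      ((x.factorial : ℚ) / (x'.factorial : ℚ)) := by
  conv_rhs => rw [← insert_erase hx]
  rw [wt_insert _ _ (by simp [hx']), wt_insert _ _ (by simp)]
  rw [erase_insert (by simp)]
  have e : ∏ z ∈ X.erase x, ((x : ℚ) + s - z) / ((x : ℚ) - z) =
      (∏ z ∈ X.erase x, |(x' : ℚ) - z|) / ∏ z ∈ X.erase x, |(x : ℚ) - z| := by
    rw [← prod_div_distrib]
    refine prod_congr rfl fun z hz => ?_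
    have hz := (mem_erase.1 hz).1
    have := abs_ratio x z s hs (by exact_mod_cast hz.symm)
    have h2 : (x' : ℚ) = x + s := by exact_mod_cast h
    rw [h2]
    push_cast at this
    exact this.symm
  rw [e]
  have h0 : ∏ z ∈ X.erase x, |(x : ℚ) - z| ≠ 0 := by
    refine prod_ne_zero_iff.2 fun z hz => ?_
    have hz := (mem_erase.1 hz).1
    rw [abs_ne_zero, sub_ne_zero]
    exact_mod_cast hz.symm
  have h1 : (x.factorial : ℚ) ≠ 0 := by positivity
  have h2 : (x'.factorial : ℚ) ≠ 0 := by positivity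
  field_simp

open Polynomial in
lemma up_id (X : Finset ℕ) (h0 : 0 ∈ X) :
    ∑ x ∈ X.filter (fun x => x + 1 ∉ X), wt (insert (x + 1) (X.erase x)) = wt X := by
  have hlag := lag X (∏ z ∈ X.erase 0, (Polynomial.X - C ((z : ℚ) - 1))) ?_
  · have hc : (∏ z ∈ X.erase 0, (Polynomial.X - C ((z : ℚ) - 1))).coeff (X.card - 1) = 1 := by
      have hm : (∏ z ∈ X.erase 0, (Polynomial.X - C ((z : ℚ) - 1))).Monic :=
        monic_prod_of_monic _ _ fun z _ => monic_X_sub_C _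
      have hd : (∏ z ∈ X.erase 0, (Polynomial.X - C ((z : ℚ) - 1))).natDegree = X.card - 1 := by
        rw [natDegree_finsetProd_X_sub_C_eq_card, card_erase_of_mem h0]
      rw [← hd]; exact hm
    rw [hc] at hlag
    rw [sum_filter]
    calc _ = ∑ x ∈ X, wt X * ((∏ z ∈ X.erase 0, (Polynomial.X - C ((z : ℚ) - 1))).eval (x : ℚ) /
        ∏ y ∈ X.erase x, ((x : ℚ) - y)) := ?_
      _ = wt X := by rw [← mul_sum, ← hlag, mul_one]
    refine sum_congr rfl fun x hx => ?_
    have hev : (∏ z ∈ X.erase 0, (Polynomial.X - C ((z : ℚ) - 1))).eval (x : ℚ) =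
        (∏ z ∈ X.erase x, ((x : ℚ) + 1 - z)) / (x + 1) := by
      rw [eq_div_iff (by positivity), eval_prod]
      have e1 := mul_prod_erase X (fun z : ℕ => (x : ℚ) + 1 - z) h0
      have e2 := mul_prod_erase X (fun z : ℕ => (x : ℚ) + 1 - z) hx
      rw [← e1] at e2
      simp only [add_sub_cancel_left, one_mul, Nat.cast_zero, sub_zero] at e2
      rw [e2, mul_comm]
      congr 1
      refine prod_congr rfl fun z _ => ?_
      simp; ring
    rw [hev]
    split_ifs with h
    · rw [prod_eq_zero (i := x + 1) (by simp [h]) (by push_cast; ring)]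
      simp
    · rw [wt_move X x (x + 1) 1 (by norm_num) hx h (by push_cast; ring), prod_div_distrib,
        Nat.factorial_succ]
      have h1 : (x.factorial : ℚ) ≠ 0 := by positivity
      push_cast
      field_simp
  · rw [degree_prod]
    simp only [degree_X_sub_C, sum_const, card_erase_of_mem h0]
    have : 0 < X.card := card_pos.2 ⟨0, h0⟩
    rw [nsmul_eq_mul, mul_one]
    exact_mod_cast (by omega : X.card - 1 < X.card)

open Polynomial in
/-- auxiliary polynomial `z (P(z) - P(z-1)) - N P(z)` -/
def Upoly (S : Finset ℕ) : ℚ[X] :=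
  X * (∏ z ∈ S, (X - C (z : ℚ)) - ∏ z ∈ S, (X - C ((z : ℚ) + 1))) -
    C (S.card : ℚ) * ∏ z ∈ S, (X - C (z : ℚ))

open Polynomial in
lemma Upoly_prop (S : Finset ℕ) : (Upoly S).degree < S.card ∧
    (X * Upoly S).coeff S.card = ∑ z ∈ S, (z : ℚ) - (S.card.choose 2 : ℚ) := by
  induction S using Finset.induction_on with
  | empty => simp [Upoly]
  | insert a S ha ih =>
    obtain ⟨ih1, ih2⟩ := ih
    have key : Upoly (insert a S) = (X - C ((a : ℚ) + 1)) * Upoly S +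
        C ((a : ℚ) - S.card) * ∏ z ∈ S, (X - C (z : ℚ)) := by
      unfold Upoly
      rw [prod_insert ha, prod_insert ha, card_insert_of_notMem ha]
      simp only [map_add, map_sub, Nat.cast_add, Nat.cast_one, map_one]
      ring
    have hdP : (∏ z ∈ S, (X - C (z : ℚ))).natDegree = S.card := by
      rw [natDegree_finsetProd_X_sub_C_eq_card]
    have hmP : (∏ z ∈ S, (X - C (z : ℚ))).Monic :=
        monic_prod_of_monic _ _ fun z _ => monic_X_sub_C _
    constructor
    · rw [key, card_insert_of_notMem ha, degree_lt_iff_coeff_zero]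
      intro m hm
      rw [degree_lt_iff_coeff_zero] at ih1
      obtain ⟨m, rfl⟩ : ∃ k, m = k + 1 := ⟨m - 1, by omega⟩
      rw [coeff_add, sub_mul, coeff_sub, coeff_X_mul, coeff_C_mul, coeff_C_mul,
        ih1 m (by omega), ih1 (m+1) (by omega), coeff_eq_zero_of_natDegree_lt (by omega)]
      simp
    · rw [card_insert_of_notMem ha, coeff_X_mul, key, coeff_add, sub_mul, coeff_sub, ih2,
        coeff_C_mul, coeff_C_mul, coeff_eq_zero_of_degree_lt ih1, ← hdP, hmP.coeff_natDegree, hdP,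
        sum_insert ha, Nat.choose_succ_succ', Nat.choose_one_right]
      push_cast
      ring

lemma down_id (X : Finset ℕ) :
    ∑ x ∈ X.filter (fun x => x ≠ 0 ∧ x - 1 ∉ X), wt (insert (x - 1) (X.erase x))
      = hN X * wt X := by
  rcases X.eq_empty_or_nonempty with rfl | hne
  · simp [hN]
  have hlag := lag X (Upoly X) (Upoly_prop X).1
  have hh := (Upoly_prop X).2
  obtain ⟨k, hk⟩ : ∃ k, X.card = k + 1 := ⟨X.card - 1, by have := card_pos.2 hne; omega⟩
  have hc : (Upoly X).coeff (X.card - 1) = hN X := by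
    have h3 := hN_add X
    have h4 : (hN X : ℚ) + (X.card.choose 2 : ℚ) = ∑ x ∈ X, (x : ℚ) := by
      rw [← Nat.cast_add, h3, Nat.cast_sum]
    rw [← h4, hk, Polynomial.coeff_X_mul] at hh
    rw [hk, Nat.add_sub_cancel, hh]; ring
  rw [hc] at hlag
  rw [hlag, sum_mul, sum_filter]
  refine sum_congr rfl fun x hx => ?_
  have hev : (Upoly X).eval (x : ℚ) = x * ∏ z ∈ X.erase x, ((x : ℚ) - 1 - z) := by
    unfold Upoly
    have hz : ∏ z ∈ X, ((x : ℚ) - z) = 0 := prod_eq_zero hx (by simp)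
    simp only [Polynomial.eval_sub, Polynomial.eval_mul, Polynomial.eval_X, Polynomial.eval_prod,
      Polynomial.eval_C, hz]
    rw [← mul_prod_erase X _ hx]
    simp only [sub_sub, add_comm]
    ring
  rw [hev]
  split_ifs with h
  · rw [wt_move X x (x - 1) (-1) (by norm_num) hx h.2 (by have := h.1; omega), prod_div_distrib]
    obtain ⟨y, rfl⟩ : ∃ y, x = y + 1 := ⟨x - 1, by omega⟩
    have h1 : (y.factorial : ℚ) ≠ 0 := by positivity
    rw [Nat.add_sub_cancel, Nat.factorial_succ]
    push_cast
    field_simp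
    simp only [← sub_eq_add_neg]
  · rcases Nat.eq_zero_or_pos x with rfl | hp
    · simp
    · have h : x - 1 ∈ X := by
        by_contra h'; exact h ⟨by omega, h'⟩
      rw [prod_eq_zero (i := x - 1) (by simp [h]; omega) (by rw [Nat.cast_sub hp]; push_cast; ring)]
      simp

end HK

namespace HK
open Finset

lemma mem_lt (X : Finset ℕ) (x : ℕ) (hx : x ∈ X) : x < X.card + hN X := by
  have h1 : (range x \ X).card ≤ hN X :=
    single_le_sum (f := fun x => (range x \ X).card) (fun _ _ => Nat.zero_le _) hx
  have h2 : (range x ∩ X).card < X.card := by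
    apply card_lt_card
    refine ⟨inter_subset_right, fun h => ?_⟩
    have := h hx
    simp at this
  have h3 := card_sdiff_add_card_inter (range x) X
  rw [card_range] at h3
  omega

lemma zero_mem (X : Finset ℕ) (h : hN X < X.card) : 0 ∈ X := by
  by_contra h0
  have : ∑ x ∈ X, 1 ≤ hN X := by
    refine sum_le_sum fun x hx => ?_
    refine card_pos.2 ⟨0, ?_⟩
    have : x ≠ 0 := fun h => h0 (h ▸ hx)
    simp [h0]; omega
  simp at this
  omega

/-- index set -/
def SS (N a : ℕ) : Finset (Finset ℕ) := (powersetCard N (range (2 * N))).filter (fun X => hN X = a)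

lemma mem_SS {N a : ℕ} (ha : a ≤ N) (X : Finset ℕ) : X ∈ SS N a ↔ X.card = N ∧ hN X = a := by
  unfold SS
  simp only [mem_filter, mem_powersetCard]
  constructor
  · rintro ⟨⟨_, h⟩, h2⟩; exact ⟨h, h2⟩
  · rintro ⟨h, h2⟩
    refine ⟨⟨fun x hx => ?_, h⟩, h2⟩
    have := mem_lt X x hx
    rw [mem_range]; omega

lemma card_move (X : Finset ℕ) (x x' : ℕ) (hx : x ∈ X) (hx' : x' ∉ X) :
    (insert x' (X.erase x)).card = X.card := by
  rw [card_insert_of_notMem (by simp [hx']), card_erase_of_mem hx]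
  have := card_pos.2 ⟨x, hx⟩
  omega

lemma hN_move (X : Finset ℕ) (x x' : ℕ) (hx : x ∈ X) (hx' : x' ∉ X) :
    hN (insert x' (X.erase x)) + x = hN X + x' := by
  have h1 := hN_add X
  have h2 := hN_add (insert x' (X.erase x))
  rw [card_move X x x' hx hx', sum_insert (by simp [hx'])] at h2
  have h3 := add_sum_erase X (fun x => x) hx
  omega

lemma move_back (X : Finset ℕ) (x x' : ℕ) (hx : x ∈ X) (hx' : x' ∉ X) :
    insert x ((insert x' (X.erase x)).erase x') = X := by
  rw [erase_insert (by simp [hx']), insert_erase hx]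

lemma sum_SS (N a : ℕ) (ha : a ≤ N) : ∑ X ∈ SS N a, wt X ^ 2 = 1 / (a.factorial : ℚ) := by
  induction a with
  | zero =>
    have : SS N 0 = {range N} := by
      ext X
      rw [mem_SS ha, mem_singleton]
      constructor
      · rintro ⟨h1, h2⟩
        apply eq_of_subset_of_card_le
        · intro x hx
          have := mem_lt X x hx
          rw [mem_range]; omega
        · simp [h1]
      · rintro rfl
        have := hN_add (range N)
        rw [card_range, sum_range_id, Nat.choose_two_right] at this
        exact ⟨by simp, by omega⟩
    rw [this, sum_singleton]
    have : wt (range N) = 1 := by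
      unfold wt gp
      refine prod_eq_one fun x hx => ?_
      have : range x \ range N = ∅ := by
        ext y; simp at hx ⊢; omega
      rw [this]; simp
    simp [this]
  | succ a ih =>
    have ih := ih (by omega)
    have e1 : ((a : ℚ) + 1) * ∑ X ∈ SS N (a + 1), wt X ^ 2 = ∑ X ∈ SS N a, wt X ^ 2 := by
      calc _ = ∑ X ∈ SS N (a + 1), ∑ x ∈ X.filter (fun x => x ≠ 0 ∧ x - 1 ∉ X),
            wt X * wt (insert (x - 1) (X.erase x)) := by
            rw [mul_sum]
            refine sum_congr rfl fun X hX => ?_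
            rw [← mul_sum, down_id, ((mem_SS ha X).1 hX).2]
            push_cast; ring
        _ = ∑ Y ∈ SS N a, ∑ y ∈ Y.filter (fun y => y + 1 ∉ Y),
            wt Y * wt (insert (y + 1) (Y.erase y)) := ?_
        _ = _ := by
            refine sum_congr rfl fun X hX => ?_
            have := (mem_SS (by omega) X).1 hX
            rw [← mul_sum, up_id X (zero_mem X (by omega))]
            ring
      rw [sum_sigma', sum_sigma']
      refine sum_bij' (fun p _ => ⟨insert (p.2 - 1) (p.1.erase p.2), p.2 - 1⟩)
        (fun p _ => ⟨insert (p.2 + 1) (p.1.erase p.2), p.2 + 1⟩) ?_ ?_ ?_ ?_ ?_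
      · rintro ⟨X, x⟩ h
        simp only [mem_sigma, mem_filter, mem_SS ha, mem_SS (by omega : a ≤ N)] at h ⊢
        obtain ⟨⟨h1, h2⟩, h3, h4, h5⟩ := h
        have := hN_move X x (x - 1) h3 h5
        refine ⟨⟨by rw [card_move X x _ h3 h5, h1], by omega⟩, by simp, ?_⟩
        have : x - 1 + 1 = x := by omega
        rw [this]
        simp; omega
      · rintro ⟨X, x⟩ h
        simp only [mem_sigma, mem_filter, mem_SS ha, mem_SS (by omega : a ≤ N)] at h ⊢
        obtain ⟨⟨h1, h2⟩, h3, h5⟩ := h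
        have := hN_move X x (x + 1) h3 h5
        refine ⟨⟨by rw [card_move X x _ h3 h5, h1], by omega⟩, by simp, by omega, ?_⟩
        simp
      · rintro ⟨X, x⟩ h
        simp only [mem_sigma, mem_filter] at h
        obtain ⟨h1, h3, h4, h5⟩ := h
        have e : x - 1 + 1 = x := by omega
        simp only [e]
        rw [move_back X x (x - 1) h3 h5]
      · rintro ⟨X, x⟩ h
        simp only [mem_sigma, mem_filter] at h
        obtain ⟨h1, h3, h5⟩ := h
        simp only [Nat.add_sub_cancel]
        rw [move_back X x (x + 1) h3 h5]
      · rintro ⟨X, x⟩ h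
        simp only [mem_sigma, mem_filter] at h
        obtain ⟨h1, h3, h4, h5⟩ := h
        have e : x - 1 + 1 = x := by omega
        simp only [e]
        rw [move_back X x (x - 1) h3 h5, mul_comm]
    rw [ih] at e1
    rw [Nat.factorial_succ]
    have : (a.factorial : ℚ) ≠ 0 := by positivity
    have h2 : (a : ℚ) + 1 ≠ 0 := by positivity
    push_cast
    field_simp at e1 ⊢
    linarith

lemma sum_tuples (N n k : ℕ) (hn : n ≤ N) :
    ∑ Y ∈ (Fintype.piFinset (fun _ : Fin k => powersetCard N (range (2 * N)))).filter
      (fun Y => ∑ i, hN (Y i) = n), ∏ i, wt (Y i) ^ 2 = (k : ℚ) ^ n / (n.factorial : ℚ) := by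
  let A : PowerSeries ℚ := ∑ Y ∈ powersetCard N (range (2 * N)),
    PowerSeries.monomial (hN Y) (wt Y ^ 2)
  have hA : ∀ a ≤ N, PowerSeries.coeff a A = 1 / (a.factorial : ℚ) := by
    intro a ha
    rw [← sum_SS N a ha, SS, sum_filter]
    simp only [A, map_sum, PowerSeries.coeff_monomial, eq_comm]
  have hdvd : (PowerSeries.X : PowerSeries ℚ) ^ (n + 1) ∣ A ^ k - PowerSeries.exp ℚ ^ k := by
    refine dvd_trans ?_ (sub_dvd_pow_sub_pow _ _ k)
    rw [PowerSeries.X_pow_dvd_iff]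
    intro m hm
    rw [map_sub, hA m (by omega), PowerSeries.coeff_exp]
    simp
  rw [PowerSeries.X_pow_dvd_iff] at hdvd
  have h1 := hdvd n (by omega)
  rw [map_sub, sub_eq_zero, PowerSeries.exp_pow_eq_rescale_exp, PowerSeries.coeff_rescale,
    PowerSeries.coeff_exp] at h1
  have h2 : A ^ k = ∏ _i : Fin k, A := by simp
  rw [h2, Finset.prod_univ_sum, map_sum] at h1
  rw [sum_filter]
  have h3 : ∀ Y : Fin k → Finset ℕ, PowerSeries.coeff n
      (∏ i, PowerSeries.monomial (hN (Y i)) (wt (Y i) ^ 2)) =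
      if ∑ i, hN (Y i) = n then ∏ i, wt (Y i) ^ 2 else 0 := by
    intro Y
    have : ∏ i, PowerSeries.monomial (hN (Y i)) (wt (Y i) ^ 2) =
        PowerSeries.monomial (∑ i, hN (Y i)) (∏ i, wt (Y i) ^ 2) := by
      exact PowerSeries.prod_monomial _ _ _
    rw [this, PowerSeries.coeff_monomial]
    simp only [eq_comm]
  simp only [h3] at h1
  rw [h1]
  simp [div_eq_mul_inv]

end HK

namespace HK
open Finset

/-- residue slice -/
def sl (N t : ℕ) (B : Finset ℕ) (r : ℕ) : Finset ℕ :=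
  (range (2 * N)).filter (fun q => q * t + r ∈ B)

/-- complement-reflection relation -/
def Refl (K : ℕ) (X Y : Finset ℕ) : Prop :=
  X ⊆ range K ∧ Y ⊆ range K ∧ ∀ q < K, (q ∈ Y ↔ K - 1 - q ∉ X)

/-- product over pairs with difference divisible by `t` -/
def gpt {A : Type*} [CommMonoid A] (t : ℕ) (f : ℕ → A) (B : Finset ℕ) : A :=
  ∏ x ∈ B, ∏ y ∈ (range x \ B).filter (fun y => t ∣ x - y), f (x - y)

lemma gpt_eq {A : Type*} [CommMonoid A] (N t : ℕ) (ht : 0 < t) (f : ℕ → A) (B : Finset ℕ)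
    (hB : B ⊆ range (2 * N * t)) :
    gpt t f B = ∏ r ∈ range t, gp (fun h => f (t * h)) (sl N t B r) := by
  have hdm : ∀ x, x / t * t + x % t = x := fun x => Nat.div_add_mod' x t
  unfold gpt gp
  simp only [prod_sigma']
  refine prod_bij' (fun p _ => ⟨p.1 % t, ⟨p.1 / t, p.2 / t⟩⟩)
    (fun p _ => ⟨p.2.1 * t + p.1, p.2.2 * t + p.1⟩) ?_ ?_ ?_ ?_ ?_
  · rintro ⟨x, y⟩ h
    simp only [mem_sigma, mem_filter, mem_sdiff, mem_range, sl] at h ⊢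
    obtain ⟨h1, ⟨h2, h3⟩, h4⟩ := h
    have hL := mem_range.1 (hB h1)
    have hmod : y % t = x % t := ((Nat.modEq_iff_dvd' h2.le).2 h4)
    refine ⟨Nat.mod_lt _ ht, ⟨Nat.div_lt_of_lt_mul (by rwa [mul_comm]), by rwa [hdm]⟩, ?_, ?_⟩
    · by_contra hc
      push Not at hc
      have e1 := hdm x
      have e2 := hdm y
      have := Nat.mul_le_mul_right t hc
      omega
    · rw [← hmod, hdm]
      exact fun h => h3 h.2
  · rintro ⟨r, q, q'⟩ h
    simp only [mem_sigma, mem_filter, mem_sdiff, mem_range, sl] at h ⊢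
    obtain ⟨h1, ⟨h2, h3⟩, h4, h5⟩ := h
    have := Nat.mul_lt_mul_of_pos_right h4 ht
    refine ⟨h3, ⟨by omega, fun h => h5 ⟨by omega, h⟩⟩, ?_⟩
    rw [Nat.add_sub_add_right, ← Nat.sub_mul]
    exact Dvd.intro_left _ rfl
  · rintro ⟨x, y⟩ h
    simp only [mem_sigma, mem_filter, mem_sdiff, mem_range] at h ⊢
    obtain ⟨h1, ⟨h2, h3⟩, h4⟩ := h
    have hmod : y % t = x % t := ((Nat.modEq_iff_dvd' h2.le).2 h4)
    have e1 := hdm x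
    have e2 := hdm y
    rw [hmod] at e2
    rw [e1, e2]
  · rintro ⟨r, q, q'⟩ h
    simp only [mem_sigma, mem_filter, mem_sdiff, mem_range, sl] at h ⊢
    obtain ⟨h1, ⟨h2, h3⟩, h4, h5⟩ := h
    have a1 : (q * t + r) % t = r := by rw [Nat.mul_add_mod', Nat.mod_eq_of_lt h1]
    have a2 : ∀ q, (q * t + r) / t = q := fun q => by
      rw [mul_comm, Nat.mul_add_div ht, Nat.div_eq_of_lt h1, add_zero]
    rw [a1, a2, a2]
  · rintro ⟨x, y⟩ h
    simp only [mem_sigma, mem_filter, mem_sdiff, mem_range] at h ⊢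
    obtain ⟨h1, ⟨h2, h3⟩, h4⟩ := h
    have hmod : y % t = x % t := ((Nat.modEq_iff_dvd' h2.le).2 h4)
    have e1 := Nat.div_add_mod x t
    have e2 := Nat.div_add_mod y t
    congr 1
    rw [Nat.mul_sub]
    omega

lemma sum_eq (N t : ℕ) (ht : 0 < t) (B : Finset ℕ)
    (hB : B ⊆ range (2 * N * t)) :
    ∑ b ∈ B, b = ∑ r ∈ range t, ∑ q ∈ sl N t B r, (q * t + r) := by
  have hdm : ∀ x, x / t * t + x % t = x := fun x => Nat.div_add_mod' x t
  rw [sum_sigma']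
  refine sum_bij' (fun p _ => ⟨p % t, p / t⟩)
    (fun p _ => p.2 * t + p.1) ?_ ?_ ?_ ?_ ?_
  · intro x h
    have hL := mem_range.1 (hB h)
    simp only [mem_sigma, mem_filter, mem_range, sl]
    exact ⟨Nat.mod_lt _ ht, Nat.div_lt_of_lt_mul (by rwa [mul_comm]), by rwa [hdm]⟩
  · rintro ⟨r, q⟩ h
    simp only [mem_sigma, mem_filter, mem_range, sl] at h
    exact h.2.2
  · intro x h; exact hdm x
  · rintro ⟨r, q⟩ h
    simp only [mem_sigma, mem_filter, mem_range, sl] at h ⊢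
    obtain ⟨h1, h2, h3⟩ := h
    have a1 : (q * t + r) % t = r := by rw [Nat.mul_add_mod', Nat.mod_eq_of_lt h1]
    have a2 : ∀ q, (q * t + r) / t = q := fun q => by
      rw [mul_comm, Nat.mul_add_div ht, Nat.div_eq_of_lt h1, add_zero]
    rw [a1, a2]
  · intro x h; exact (hdm x).symm

lemma Refl.card {K : ℕ} {X Y : Finset ℕ} (h : Refl K X Y) : Y.card + X.card = K := by
  obtain ⟨hX, hY, h⟩ := h
  have : Y.card = (range K \ X).card := by
    refine card_nbij' (fun q => K - 1 - q) (fun q => K - 1 - q) ?_ ?_ ?_ ?_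
    · intro q hq
      have := mem_range.1 (hY hq)
      simp only [coe_sdiff, Set.mem_sdiff, mem_coe, mem_range]
      exact ⟨by omega, (h q this).1 hq⟩
    · intro q hq
      simp only [coe_sdiff, Set.mem_sdiff, mem_coe, mem_range] at hq ⊢
      rw [h _ (by omega)]
      have : K - 1 - (K - 1 - q) = q := by omega
      rw [this]; exact hq.2
    · intro q hq
      have := mem_range.1 (hY hq)
      simp only; omega
    · intro q hq
      simp only [coe_sdiff, Set.mem_sdiff, mem_coe, mem_range] at hq ⊢
      omega
  have h2 := card_sdiff_add_card_eq_card hX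
  rw [card_range] at h2
  omega

lemma Refl.gp {A : Type*} [CommMonoid A] (f : ℕ → A) {K : ℕ} {X Y : Finset ℕ}
    (h : Refl K X Y) : HK.gp f Y = HK.gp f X := by
  obtain ⟨hX, hY, h⟩ := h
  unfold HK.gp
  simp only [prod_sigma']
  refine prod_bij' (fun p _ => ⟨K - 1 - p.2, K - 1 - p.1⟩)
    (fun p _ => ⟨K - 1 - p.2, K - 1 - p.1⟩) ?_ ?_ ?_ ?_ ?_
  · rintro ⟨x, y⟩ hp
    simp only [mem_sigma, mem_sdiff, mem_range] at hp ⊢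
    obtain ⟨h1, h2, h3⟩ := hp
    have := mem_range.1 (hY h1)
    rw [h _ (by omega), not_not] at h3
    exact ⟨h3, by omega, (h _ this).1 h1⟩
  · rintro ⟨x, y⟩ hp
    simp only [mem_sigma, mem_sdiff, mem_range] at hp ⊢
    obtain ⟨h1, h2, h3⟩ := hp
    have := mem_range.1 (hX h1)
    rw [h _ (by omega), h _ (by omega)]
    have a1 : K - 1 - (K - 1 - y) = y := by omega
    have a2 : K - 1 - (K - 1 - x) = x := by omega
    rw [a1, a2]
    exact ⟨h3, by omega, fun hh => hh h1⟩
  · rintro ⟨x, y⟩ hp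
    simp only [mem_sigma, mem_sdiff, mem_range] at hp ⊢
    have := mem_range.1 (hY hp.1)
    have a1 : K - 1 - (K - 1 - y) = y := by omega
    have a2 : K - 1 - (K - 1 - x) = x := by omega
    rw [a1, a2]
  · rintro ⟨x, y⟩ hp
    simp only [mem_sigma, mem_sdiff, mem_range] at hp ⊢
    have := mem_range.1 (hX hp.1)
    have a1 : K - 1 - (K - 1 - y) = y := by omega
    have a2 : K - 1 - (K - 1 - x) = x := by omega
    rw [a1, a2]
  · rintro ⟨x, y⟩ hp
    simp only [mem_sigma, mem_sdiff, mem_range] at hp ⊢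
    have := mem_range.1 (hY hp.1)
    congr 1
    omega

lemma Refl.hN {K : ℕ} {X Y : Finset ℕ} (h : Refl K X Y) : HK.hN Y = HK.hN X := by
  have := h.gp (fun _ => (2 : ℕ))
  rw [gp_const, gp_const] at this
  exact Nat.pow_right_injective le_rfl this

lemma idx (N t q r : ℕ) (hq : q < 2 * N) (hr : r < t) :
    q * t + r < 2 * N * t ∧
    2 * N * t - 1 - (q * t + r) = (2 * N - 1 - q) * t + (t - 1 - r) := by
  obtain ⟨c, hc⟩ : ∃ c, 2 * N = q + 1 + c := ⟨2 * N - (q + 1), by omega⟩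
  have h1 : 2 * N - 1 - q = c := by omega
  rw [h1, hc]
  have : (q + 1 + c) * t = q * t + t + c * t := by ring
  rw [this]
  omega

lemma sl_refl (N t : ℕ) (B : Finset ℕ) (hB : Refl (2 * N * t) B B) (r : ℕ) (hr : r < t) :
    Refl (2 * N) (sl N t B r) (sl N t B (t - 1 - r)) := by
  refine ⟨filter_subset _ _, filter_subset _ _, fun q hq => ?_⟩
  simp only [sl, mem_filter, mem_range]
  obtain ⟨h1, h2⟩ := idx N t q (t - 1 - r) hq (by omega)
  rw [hB.2.2 _ h1, h2]
  have : t - 1 - (t - 1 - r) = r := by omega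
  rw [this]
  constructor
  · rintro ⟨_, h⟩ ⟨_, h'⟩; exact h h'
  · intro h; exact ⟨hq, fun h' => h ⟨by omega, h'⟩⟩

lemma prod_double {A : Type*} [CommMonoid A] (t' : ℕ) (g : ℕ → A) :
    ∏ r ∈ range (2 * t'), g r = ∏ i ∈ range t', (g i * g (2 * t' - 1 - i)) := by
  rw [two_mul, prod_range_add, prod_mul_distrib]
  congr 1
  rw [← prod_range_reflect]
  refine prod_congr rfl fun j hj => ?_
  have := mem_range.1 hj
  congr 1
  omega

lemma sum_double (t' : ℕ) (g : ℕ → ℤ) :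
    ∑ r ∈ range (2 * t'), g r = ∑ i ∈ range t', (g i + g (2 * t' - 1 - i)) := by
  rw [two_mul, sum_range_add, sum_add_distrib]
  congr 1
  rw [← sum_range_reflect]
  refine sum_congr rfl fun j hj => ?_
  have := mem_range.1 hj
  congr 1
  omega

lemma gpt_sym {A : Type*} [CommMonoid A] (N t' : ℕ) (ht : 0 < t') (f : ℕ → A) (B : Finset ℕ)
    (hB : Refl (2 * N * (2 * t')) B B) :
    gpt (2 * t') f B = ∏ i ∈ range t', (gp (fun h => f (2 * t' * h)) (sl N (2 * t') B i)) ^ 2 := by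
  rw [gpt_eq N (2 * t') (by omega) f B hB.1, prod_double]
  refine prod_congr rfl fun i hi => ?_
  have := mem_range.1 hi
  rw [(sl_refl N (2 * t') B hB i (by omega)).gp, sq]

lemma choose_int (m : ℕ) : 2 * ((m.choose 2 : ℕ) : ℤ) = m * (m - 1) := by
  rw [Nat.choose_two_right]
  have h : 2 ∣ m * (m - 1) := (Nat.even_mul_pred_self m).two_dvd
  have := Nat.mul_div_cancel' h
  rcases Nat.eq_zero_or_pos m with rfl | hm
  · simp
  · have h3 : ((2 * (m * (m - 1) / 2) : ℕ) : ℤ) = ((m * (m - 1) : ℕ) : ℤ) := by rw [this]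
    push_cast [Nat.cast_sub hm] at h3 ⊢
    exact h3

lemma size_eq (N t' : ℕ) (ht : 0 < t') (B : Finset ℕ) (hB : Refl (2 * N * (2 * t')) B B) :
    (hN B : ℤ) = ∑ i ∈ range t', (2 * (2 * t') * (hN (sl N (2 * t') B i) : ℤ) +
      (2 * t' * ((sl N (2 * t') B i).card - N : ℤ) ^ 2 -
        (2 * t' - 1 - 2 * i) * ((sl N (2 * t') B i).card - N : ℤ))) := by
  have h1 := hN_add B
  rw [sum_eq N (2 * t') (by omega) B hB.1] at h1
  have hc : B.card = 2 * N * t' := by have := hB.card; nlinarith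
  have h2 : (2 * (hN B : ℤ)) + 2 * N * t' * (2 * N * t' - 1) =
      2 * ∑ r ∈ range (2 * t'), ∑ q ∈ sl N (2 * t') B r, ((q : ℤ) * (2 * t') + r) := by
    have h3 := choose_int B.card
    rw [hc] at h3 h1
    have h4 : ((hN B + (2 * N * t').choose 2 : ℕ) : ℤ) =
      ((∑ r ∈ range (2 * t'), ∑ q ∈ sl N (2 * t') B r, (q * (2 * t') + r) : ℕ) : ℤ) := by rw [h1]
    push_cast at h4 h3
    rw [← h4]
    linarith
  have h5 : ∀ r, 2 * ∑ q ∈ sl N (2 * t') B r, ((q : ℤ) * (2 * t') + r) =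
      2 * t' * (2 * hN (sl N (2 * t') B r) +
        (sl N (2 * t') B r).card * ((sl N (2 * t') B r).card - 1)) +
        2 * r * (sl N (2 * t') B r).card := by
    intro r
    have h6 := hN_add (sl N (2 * t') B r)
    have h7 := choose_int (sl N (2 * t') B r).card
    have h8 : ((hN (sl N (2 * t') B r) + (sl N (2 * t') B r).card.choose 2 : ℕ) : ℤ) =
      ((∑ q ∈ sl N (2 * t') B r, q : ℕ) : ℤ) := by rw [h6]
    push_cast at h8
    rw [sum_add_distrib, ← sum_mul, ← h8, ← h7, sum_const, nsmul_eq_mul]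
    ring
  rw [mul_sum] at h2
  simp only [h5] at h2
  rw [sum_double] at h2
  have h9 : (2 * N * t' * (2 * N * t' - 1) : ℤ) =
      ∑ i ∈ range t', (2 * N * (2 * N * t' - 1) : ℤ) := by
    rw [sum_const, card_range, nsmul_eq_mul]; ring
  rw [h9] at h2
  have h10 := eq_sub_of_add_eq h2
  rw [← sum_sub_distrib] at h10
  have h11 : (2 * (hN B : ℤ)) = 2 * ∑ i ∈ range t', (2 * (2 * t') * (hN (sl N (2 * t') B i) : ℤ) +
      (2 * t' * ((sl N (2 * t') B i).card - N : ℤ) ^ 2 -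
        (2 * t' - 1 - 2 * i) * ((sl N (2 * t') B i).card - N : ℤ))) := by
    rw [h10, mul_sum]
    refine sum_congr rfl fun i hi => ?_
    have hi := mem_range.1 hi
    have hr := sl_refl N (2 * t') B hB i (by omega)
    rw [hr.hN]
    have hcc := hr.card
    have hcc' : ((sl N (2 * t') B (2 * t' - 1 - i)).card : ℤ) =
      2 * N - (sl N (2 * t') B i).card := by omega
    rw [hcc']
    have : ((2 * t' - 1 - i : ℕ) : ℤ) = 2 * t' - 1 - i := by omega
    rw [this]
    ring
  linarith

lemma term_nonneg (t i d : ℤ) (hi : 0 ≤ i) (hit : 2 * i < t) :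
    0 ≤ t * d ^ 2 - (t - 1 - 2 * i) * d ∧ (t * d ^ 2 - (t - 1 - 2 * i) * d = 0 → d = 0) := by
  rcases lt_trichotomy d 0 with h | h | h
  · have : 0 < t * d ^ 2 - (t - 1 - 2 * i) * d := by nlinarith
    exact ⟨this.le, fun h' => by omega⟩
  · subst h; simp
  · have : 0 < t * d ^ 2 - (t - 1 - 2 * i) * d := by
      have h1 : 0 ≤ t * (d * (d - 1)) :=
        mul_nonneg (by omega) (mul_nonneg (by omega) (by omega))
      have h2 : 0 ≤ i * d := mul_nonneg hi h.le
      nlinarith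
    exact ⟨this.le, fun h' => by omega⟩

lemma size_iff (N t' n : ℕ) (ht : 0 < t') (B : Finset ℕ) (hB : Refl (2 * N * (2 * t')) B B)
    (hn : ∑ i ∈ range t', hN (sl N (2 * t') B i) = n) :
    hN B = 2 * (2 * t') * n ↔ ∀ i < t', (sl N (2 * t') B i).card = N := by
  have h := size_eq N t' ht B hB
  rw [sum_add_distrib, ← mul_sum] at h
  have hn' : ∑ i ∈ range t', (hN (sl N (2 * t') B i) : ℤ) = n := by exact_mod_cast hn
  rw [hn'] at h
  have hnn : ∀ i ∈ range t', (0 : ℤ) ≤ 2 * t' * ((sl N (2 * t') B i).card - N : ℤ) ^ 2 -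
        (2 * t' - 1 - 2 * i) * ((sl N (2 * t') B i).card - N : ℤ) := by
    intro i hi
    have hi := mem_range.1 hi
    exact (term_nonneg (2 * t') i _ (by omega) (by omega)).1
  constructor
  · intro h1
    have h0 : ∑ i ∈ range t', (2 * t' * ((sl N (2 * t') B i).card - N : ℤ) ^ 2 -
        (2 * t' - 1 - 2 * i) * ((sl N (2 * t') B i).card - N : ℤ)) = 0 := by
      rw [h1] at h; push_cast at h; linarith
    rw [sum_eq_zero_iff_of_nonneg hnn] at h0
    intro i hi
    have := (term_nonneg (2 * t') i _ (by omega) (by omega)).2 (h0 i (mem_range.2 hi))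
    omega
  · intro h1
    rw [sum_eq_zero (s := range t')] at h
    · rw [add_zero] at h; exact_mod_cast h
    · intro i hi
      rw [h1 i (mem_range.1 hi)]; simp

end HK

namespace HK
open Finset

/-- number of pairs with difference divisible by `t` -/
def hNt (t : ℕ) (B : Finset ℕ) : ℕ :=
  ∑ x ∈ B, ((range x \ B).filter (fun y => t ∣ x - y)).card

lemma gpt_const {A : Type*} [CommMonoid A] (t : ℕ) (a : A) (X : Finset ℕ) :
    gpt t (fun _ => a) X = a ^ hNt t X := by
  simp [gpt, hNt, prod_pow_eq_pow_sum]

lemma hNt_sym (N t' : ℕ) (ht : 0 < t') (B : Finset ℕ)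
    (hB : Refl (2 * N * (2 * t')) B B) :
    hNt (2 * t') B = 2 * ∑ i ∈ range t', hN (sl N (2 * t') B i) := by
  have := gpt_sym N t' ht (fun _ => (2 : ℕ)) B hB
  simp only [gpt_const, gp_const, ← pow_mul, prod_pow_eq_pow_sum] at this
  have h2 := Nat.pow_right_injective le_rfl this
  rw [h2, ← sum_mul, mul_comm]

lemma gp_scale (t : ℕ) (X : Finset ℕ) :
    gp (fun h => 1 / ((t * h : ℕ) : ℚ)) X = (1 / (t : ℚ)) ^ hN X * wt X := by
  rw [← gp_const, wt, gp, gp, gp, ← prod_mul_distrib]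
  refine prod_congr rfl fun x _ => ?_
  rw [← prod_mul_distrib]
  refine prod_congr rfl fun y _ => ?_
  push_cast
  rw [one_div_mul_one_div]

open Classical in
/-- the index set of self-conjugate beta sets -/
def BB (N t' n : ℕ) : Finset (Finset ℕ) :=
  (powerset (range (2 * N * (2 * t')))).filter (fun B => Refl (2 * N * (2 * t')) B B ∧
    hN B = 2 * (2 * t') * n ∧ hNt (2 * t') B = 2 * n)

lemma mem_BB (N t' n : ℕ) (B : Finset ℕ) : B ∈ BB N t' n ↔ Refl (2 * N * (2 * t')) B B ∧
    hN B = 2 * (2 * t') * n ∧ hNt (2 * t') B = 2 * n := by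
  classical
  unfold BB
  rw [mem_filter, mem_powerset]
  exact ⟨fun h => h.2, fun h => ⟨h.1.1, h⟩⟩

lemma mem_BB' (N t' n : ℕ) (ht : 0 < t') (B : Finset ℕ) :
    B ∈ BB N t' n ↔ Refl (2 * N * (2 * t')) B B ∧
    (∀ i < t', (sl N (2 * t') B i).card = N) ∧ ∑ i ∈ range t', hN (sl N (2 * t') B i) = n := by
  rw [mem_BB]
  constructor
  · rintro ⟨h1, h2, h3⟩
    rw [hNt_sym N t' ht B h1] at h3
    have h4 : ∑ i ∈ range t', hN (sl N (2 * t') B i) = n := by omega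
    exact ⟨h1, (size_iff N t' n ht B h1 h4).1 h2, h4⟩
  · rintro ⟨h1, h2, h3⟩
    rw [hNt_sym N t' ht B h1, h3]
    exact ⟨h1, (size_iff N t' n ht B h1 h3).2 h2, rfl⟩

/-- glue slices -/
def glue (N t' : ℕ) (Y : ℕ → Finset ℕ) : Finset ℕ :=
  (range (2 * N * (2 * t'))).filter (fun x =>
    if x % (2 * t') < t' then x / (2 * t') ∈ Y (x % (2 * t'))
    else (2 * N - 1 - x / (2 * t')) ∉ Y (2 * t' - 1 - x % (2 * t')))

lemma mem_glue (N t' : ℕ) (Y : ℕ → Finset ℕ) (q r : ℕ) (hq : q < 2 * N) (hr : r < 2 * t') :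
    q * (2 * t') + r ∈ glue N t' Y ↔
      if r < t' then q ∈ Y r else (2 * N - 1 - q) ∉ Y (2 * t' - 1 - r) := by
  have a1 : (q * (2 * t') + r) % (2 * t') = r := by rw [Nat.mul_add_mod', Nat.mod_eq_of_lt hr]
  have a2 : (q * (2 * t') + r) / (2 * t') = q := by
    rw [mul_comm, Nat.mul_add_div (by omega), Nat.div_eq_of_lt hr, add_zero]
  unfold glue
  rw [mem_filter, a1, a2, mem_range]
  exact ⟨fun h => h.2, fun h => ⟨(idx N (2 * t') q r hq hr).1, h⟩⟩

lemma exists_qr (N t x : ℕ) (hx : x < 2 * N * t) : ∃ q r, q < 2 * N ∧ r < t ∧ x = q * t + r := by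
  have ht : 0 < t := by
    rcases Nat.eq_zero_or_pos t with rfl | h
    · simp at hx
    · exact h
  exact ⟨x / t, x % t, Nat.div_lt_of_lt_mul (by rwa [mul_comm]), Nat.mod_lt _ ht,
    (Nat.div_add_mod' x t).symm⟩

lemma glue_refl (N t' : ℕ) (Y : ℕ → Finset ℕ) :
    Refl (2 * N * (2 * t')) (glue N t' Y) (glue N t' Y) := by
  refine ⟨filter_subset _ _, filter_subset _ _, fun x hx => ?_⟩
  obtain ⟨q, r, hq, hr, rfl⟩ := exists_qr N (2 * t') x hx
  rw [(idx N (2 * t') q r hq hr).2, mem_glue _ _ _ _ _ hq hr,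
    mem_glue _ _ _ _ _ (by omega) (by omega)]
  have e1 : 2 * N - 1 - (2 * N - 1 - q) = q := by omega
  have e2 : 2 * t' - 1 - (2 * t' - 1 - r) = r := by omega
  rw [e1, e2]
  by_cases h : r < t'
  · rw [if_pos h, if_neg (by omega), not_not]
  · rw [if_neg h, if_pos (by omega)]

lemma sl_glue (N t' : ℕ) (Y : ℕ → Finset ℕ) (i : ℕ) (hi : i < t') (hY : Y i ⊆ range (2 * N)) :
    sl N (2 * t') (glue N t' Y) i = Y i := by
  ext q
  unfold sl
  rw [mem_filter, mem_range]
  constructor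
  · rintro ⟨h1, h2⟩
    rw [mem_glue _ _ _ _ _ h1 (by omega), if_pos hi] at h2
    exact h2
  · intro h
    have h1 := mem_range.1 (hY h)
    refine ⟨h1, ?_⟩
    rw [mem_glue _ _ _ _ _ h1 (by omega), if_pos hi]
    exact h

lemma glue_sl (N t' : ℕ) (B : Finset ℕ) (hB : Refl (2 * N * (2 * t')) B B)
    (Y : ℕ → Finset ℕ) (hY : ∀ i < t', Y i = sl N (2 * t') B i) :
    glue N t' Y = B := by
  ext x
  by_cases hx : x < 2 * N * (2 * t')
  · obtain ⟨q, r, hq, hr, rfl⟩ := exists_qr N (2 * t') x hx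
    rw [mem_glue _ _ _ _ _ hq hr]
    split_ifs with h
    · rw [hY r h, sl, mem_filter, mem_range]
      exact ⟨fun h => h.2, fun h => ⟨hq, h⟩⟩
    · rw [hY _ (by omega), hB.2.2 _ hx, (idx N (2 * t') q r hq hr).2, sl, mem_filter, mem_range]
      exact ⟨fun h h' => h ⟨by omega, h'⟩, fun h h' => h h'.2⟩
  · constructor
    · intro h; exact absurd (mem_range.1 ((glue_refl N t' Y).1 h)) hx
    · intro h; exact absurd (mem_range.1 (hB.1 h)) hx

lemma sum_BB (N t' n : ℕ) (ht : 0 < t') (hn : n ≤ N) :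
    ∑ B ∈ BB N t' n, gpt (2 * t') (fun h => 1 / (h : ℚ)) B =
      1 / ((n.factorial : ℚ) * 2 ^ n * (2 * t' : ℚ) ^ n) := by
  have key := sum_tuples N n t' hn
  have e : ∑ B ∈ BB N t' n, gpt (2 * t') (fun h => 1 / (h : ℚ)) B =
    ∑ Y ∈ (Fintype.piFinset (fun _ : Fin t' => powersetCard N (range (2 * N)))).filter
      (fun Y => ∑ i, hN (Y i) = n), (1 / (2 * t' : ℚ)) ^ (2 * n) * ∏ i, wt (Y i) ^ 2 := by
    refine sum_bij' (fun B _ => fun i => sl N (2 * t') B i)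
      (fun Y _ => glue N t' (fun i => if h : i < t' then Y ⟨i, h⟩ else ∅)) ?_ ?_ ?_ ?_ ?_
    · intro B hB
      rw [mem_BB' _ _ _ ht] at hB
      obtain ⟨h1, h2, h3⟩ := hB
      rw [mem_filter, Fintype.mem_piFinset]
      refine ⟨fun i => mem_powersetCard.2 ⟨filter_subset _ _, h2 i i.2⟩, ?_⟩
      rw [← h3, sum_range]
    · intro Y hY
      rw [mem_filter, Fintype.mem_piFinset] at hY
      rw [mem_BB' _ _ _ ht]
      have hs : ∀ i (h : i < t'), sl N (2 * t')
          (glue N t' (fun i => if h : i < t' then Y ⟨i, h⟩ else ∅)) i = Y ⟨i, h⟩ := by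
        intro i hi
        have := (mem_powersetCard.1 (hY.1 ⟨i, hi⟩)).1
        rw [sl_glue _ _ _ _ hi (by rw [dif_pos hi]; exact this), dif_pos hi]
      refine ⟨glue_refl _ _ _, ?_, ?_⟩
      · intro i hi
        rw [hs i hi]
        exact (mem_powersetCard.1 (hY.1 ⟨i, hi⟩)).2
      · rw [sum_range, ← hY.2]
        refine sum_congr rfl fun i _ => ?_
        rw [hs i i.2]
    · intro B hB
      rw [mem_BB' _ _ _ ht] at hB
      apply glue_sl _ _ _ hB.1
      intro i hi
      rw [dif_pos hi]
    · intro Y hY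
      rw [mem_filter, Fintype.mem_piFinset] at hY
      funext i
      have := (mem_powersetCard.1 (hY.1 i)).1
      rw [sl_glue _ _ _ _ i.2 (by rw [dif_pos i.2]; exact this), dif_pos i.2]
    · intro B hB
      rw [mem_BB' _ _ _ ht] at hB
      obtain ⟨h1, h2, h3⟩ := hB
      rw [gpt_sym N t' ht _ B h1]
      simp only [gp_scale, mul_pow]
      rw [prod_mul_distrib, prod_range, prod_range]
      congr 1
      simp only [← pow_mul]
      rw [prod_pow_eq_pow_sum, ← sum_mul, ← h3, sum_range, mul_comm _ 2]
      push_cast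
      rfl
  rw [e, ← mul_sum, key]
  have h1 : (t' : ℚ) ≠ 0 := by positivity
  have h2 : (n.factorial : ℚ) ≠ 0 := by positivity
  rw [one_div, inv_pow]
  field_simp
  ring_nf

end HK

namespace HK
open Finset

/-- beta numbers -/
def xs (μ : YoungDiagram) (M i : ℕ) : ℕ := μ.rowLen i + (M - 1 - i)

/-- beta set -/
def beta (μ : YoungDiagram) (M : ℕ) : Finset ℕ := (range M).image (xs μ M)

lemma xs_anti (μ : YoungDiagram) (M i j : ℕ) (hij : i < j) (hj : j < M) :
    xs μ M j < xs μ M i := by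
  have := μ.rowLen_anti i j hij.le
  unfold xs; omega

lemma xs_inj (μ : YoungDiagram) (M i j : ℕ) (hi : i < M) (hj : j < M)
    (h : xs μ M i = xs μ M j) : i = j := by
  rcases lt_trichotomy i j with h1 | h1 | h1
  · have := xs_anti μ M i j h1 hj; omega
  · exact h1
  · have := xs_anti μ M j i h1 hi; omega

lemma colLen_eq (μ : YoungDiagram) (hs : μ.transpose = μ) (j : ℕ) : μ.colLen j = μ.rowLen j := by
  rw [← YoungDiagram.rowLen_transpose, hs]

lemma xs_lt (μ : YoungDiagram) (M i : ℕ) (hM : μ.rowLen 0 ≤ M) (hi : i < M) :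
    xs μ M i < 2 * M := by
  have := μ.rowLen_anti 0 i (Nat.zero_le _)
  unfold xs; omega

lemma mem_iff_xs (μ : YoungDiagram) (hs : μ.transpose = μ) (M i j : ℕ) (hM : μ.rowLen 0 ≤ M)
    (hi : i < M) (hj : j < M) :
    ((i, j) ∈ μ ↔ 2 * M - 1 - xs μ M j < xs μ M i) ∧ xs μ M i ≠ 2 * M - 1 - xs μ M j ∧
    ((i, j) ∈ μ → hookLen μ (i, j) = xs μ M i - (2 * M - 1 - xs μ M j)) := by
  have h1 := YoungDiagram.mem_iff_lt_rowLen (μ := μ) (i := i) (j := j)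
  have h2 := YoungDiagram.mem_iff_lt_colLen (μ := μ) (i := i) (j := j)
  rw [colLen_eq μ hs] at h2
  have h3 := μ.rowLen_anti 0 i (Nat.zero_le _)
  have h4 := μ.rowLen_anti 0 j (Nat.zero_le _)
  unfold hookLen
  simp only [colLen_eq μ hs]
  unfold xs
  by_cases h : (i, j) ∈ μ
  · have h5 := h1.1 h
    have h6 := h2.1 h
    simp only [h, true_iff, true_implies]
    omega
  · have h5 := (not_congr h1).1 h
    have h6 := (not_congr h2).1 h
    exact ⟨iff_of_false h (by omega), by omega, fun h' => absurd h' h⟩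

lemma beta_card (μ : YoungDiagram) (M : ℕ) : (beta μ M).card = M := by
  rw [beta, card_image_of_injOn, card_range]
  intro i hi j hj h
  exact xs_inj μ M i j (by simpa using hi) (by simpa using hj) h

lemma mem_beta (μ : YoungDiagram) (M x : ℕ) : x ∈ beta μ M ↔ ∃ i < M, xs μ M i = x := by
  simp [beta]

lemma beta_refl (μ : YoungDiagram) (hs : μ.transpose = μ) (M : ℕ) (hM : μ.rowLen 0 ≤ M) :
    Refl (2 * M) (beta μ M) (beta μ M) := by
  have hsub : beta μ M ⊆ range (2 * M) := by
    intro x hx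
    obtain ⟨i, hi, rfl⟩ := (mem_beta _ _ _).1 hx
    exact mem_range.2 (xs_lt μ M i hM hi)
  refine ⟨hsub, hsub, ?_⟩
  have hdis : Disjoint (beta μ M) ((beta μ M).image (fun x => 2 * M - 1 - x)) := by
    rw [disjoint_left]
    intro x hx hx'
    obtain ⟨i, hi, rfl⟩ := (mem_beta _ _ _).1 hx
    obtain ⟨y, hy, h⟩ := mem_image.1 hx'
    obtain ⟨j, hj, rfl⟩ := (mem_beta _ _ _).1 hy
    exact (mem_iff_xs μ hs M i j hM hi hj).2.1 h.symm
  have hcard : ((beta μ M).image (fun x => 2 * M - 1 - x)).card = M := by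
    rw [card_image_of_injOn, beta_card]
    intro x hx y hy h
    have h1 := mem_range.1 (hsub hx)
    have h2 := mem_range.1 (hsub hy)
    simp only at h
    omega
  have hU : beta μ M ∪ (beta μ M).image (fun x => 2 * M - 1 - x) = range (2 * M) := by
    apply eq_of_subset_of_card_le
    · apply union_subset hsub
      intro x hx
      obtain ⟨y, hy, rfl⟩ := mem_image.1 hx
      have h1 := mem_range.1 (hsub hy)
      rw [mem_range]; omega
    · rw [card_union_of_disjoint hdis, hcard, beta_card, card_range]; omega
  intro q hq
  constructor
  · intro h h'
    refine (disjoint_left.1 hdis h) (mem_image.2 ⟨_, h', ?_⟩)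
    omega
  · intro h
    have : q ∈ beta μ M ∪ (beta μ M).image (fun x => 2 * M - 1 - x) := by
      rw [hU]; exact mem_range.2 hq
    rcases mem_union.1 this with h1 | h1
    · exact h1
    · exfalso
      obtain ⟨y, hy, rfl⟩ := mem_image.1 h1
      have h1 := mem_range.1 (hsub hy)
      apply h
      have : 2 * M - 1 - (2 * M - 1 - y) = y := by omega
      rwa [this]

lemma mem_bounds (μ : YoungDiagram) (hs : μ.transpose = μ) (M i j : ℕ) (hM : μ.rowLen 0 ≤ M)
    (h : (i, j) ∈ μ) : i < M ∧ j < M := by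
  have h1 := YoungDiagram.mem_iff_lt_rowLen.1 h
  have h2 := YoungDiagram.mem_iff_lt_colLen.1 h
  rw [colLen_eq μ hs] at h2
  have h3 := μ.rowLen_anti 0 i (Nat.zero_le _)
  have h4 := μ.rowLen_anti 0 j (Nat.zero_le _)
  omega

lemma gpt_beta {A : Type*} [CommMonoid A] (f : ℕ → A) (t : ℕ) (μ : YoungDiagram)
    (hs : μ.transpose = μ) (M : ℕ) (hM : μ.rowLen 0 ≤ M) :
    ∏ c ∈ μ.cells.filter (fun c => t ∣ hookLen μ c), f (hookLen μ c) = gpt t f (beta μ M) := by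
  unfold gpt
  rw [prod_sigma']
  have hR := beta_refl μ hs M hM
  refine prod_bij (fun c _ => ⟨xs μ M c.1, 2 * M - 1 - xs μ M c.2⟩) ?_ ?_ ?_ ?_
  · rintro ⟨i, j⟩ h
    rw [mem_filter, YoungDiagram.mem_cells] at h
    obtain ⟨hi, hj⟩ := mem_bounds μ hs M i j hM h.1
    obtain ⟨k1, k2, k3⟩ := mem_iff_xs μ hs M i j hM hi hj
    have k3 := k3 h.1
    simp only [mem_sigma, mem_filter, mem_sdiff, mem_range]
    refine ⟨(mem_beta _ _ _).2 ⟨i, hi, rfl⟩, ⟨k1.1 h.1, ?_⟩, ?_⟩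
    · have := (hR.2.2 _ (xs_lt μ M j hM hj)).1 ((mem_beta _ _ _).2 ⟨j, hj, rfl⟩)
      exact this
    · rw [← k3]; exact h.2
  · rintro ⟨i, j⟩ h ⟨i', j'⟩ h' heq
    rw [mem_filter, YoungDiagram.mem_cells] at h h'
    obtain ⟨hi, hj⟩ := mem_bounds μ hs M i j hM h.1
    obtain ⟨hi', hj'⟩ := mem_bounds μ hs M i' j' hM h'.1
    simp only [Sigma.mk.injEq, heq_eq_eq] at heq
    have e1 := xs_inj μ M i i' hi hi' heq.1
    have b1 := xs_lt μ M j hM hj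
    have b2 := xs_lt μ M j' hM hj'
    have e2 := xs_inj μ M j j' hj hj' (by omega)
    rw [e1, e2]
  · rintro ⟨x, y⟩ h
    simp only [mem_sigma, mem_filter, mem_sdiff, mem_range] at h
    obtain ⟨h1, ⟨h2, h3⟩, h4⟩ := h
    obtain ⟨i, hi, rfl⟩ := (mem_beta _ _ _).1 h1
    have b1 := xs_lt μ M i hM hi
    rw [hR.2.2 _ (by omega), not_not] at h3
    obtain ⟨j, hj, hjy⟩ := (mem_beta _ _ _).1 h3
    have hy : y = 2 * M - 1 - xs μ M j := by omega
    subst hy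
    obtain ⟨k1, k2, k3⟩ := mem_iff_xs μ hs M i j hM hi hj
    have hm := k1.2 h2
    refine ⟨(i, j), ?_, rfl⟩
    rw [mem_filter, YoungDiagram.mem_cells]
    exact ⟨hm, by rw [k3 hm]; exact h4⟩
  · rintro ⟨i, j⟩ h
    rw [mem_filter, YoungDiagram.mem_cells] at h
    obtain ⟨hi, hj⟩ := mem_bounds μ hs M i j hM h.1
    rw [(mem_iff_xs μ hs M i j hM hi hj).2.2 h.1]

lemma hNt_beta (t : ℕ) (μ : YoungDiagram)
    (hs : μ.transpose = μ) (M : ℕ) (hM : μ.rowLen 0 ≤ M) :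
    (μ.cells.filter (fun c => t ∣ hookLen μ c)).card = hNt t (beta μ M) := by
  have := gpt_beta (fun _ => (2 : ℕ)) t μ hs M hM
  rw [gpt_const, prod_const] at this
  exact Nat.pow_right_injective le_rfl this

lemma hN_beta (μ : YoungDiagram)
    (hs : μ.transpose = μ) (M : ℕ) (hM : μ.rowLen 0 ≤ M) :
    μ.card = hN (beta μ M) := by
  have := hNt_beta 1 μ hs M hM
  simpa [hNt, hN] using this

lemma rowLen_le_card (μ : YoungDiagram) : μ.rowLen 0 ≤ μ.card := by
  rw [YoungDiagram.rowLen_eq_card]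
  exact card_le_card (filter_subset _ _)

lemma beta_inj (μ ν : YoungDiagram) (hμs : μ.transpose = μ) (hνs : ν.transpose = ν) (M : ℕ)
    (hμ : μ.rowLen 0 ≤ M) (hν : ν.rowLen 0 ≤ M)
    (h : beta μ M = beta ν M) : μ = ν := by
  have hx : ∀ i < M, xs μ M i = xs ν M i := by
    have key : ∀ κ : YoungDiagram, beta κ M = beta μ M →
        (fun k : Fin M => xs κ M (M - 1 - k)) = (beta μ M).orderEmbOfFin (beta_card μ M) := by
      intro κ hκ
      apply orderEmbOfFin_unique
      · intro k
        rw [← hκ, mem_beta]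
        exact ⟨M - 1 - k, by omega, rfl⟩
      · intro a b hab
        have hab : (a : ℕ) < b := hab
        exact xs_anti κ M _ _ (by omega) (by omega)
    have h2 := (key μ rfl).trans (key ν h.symm).symm
    intro i hi
    have := congrFun h2 ⟨M - 1 - i, by omega⟩
    simp only at this
    have e : M - 1 - (M - 1 - i) = i := by omega
    rwa [e] at this
  ext ⟨i, j⟩
  rw [YoungDiagram.mem_cells, YoungDiagram.mem_cells]
  have hr : ∀ i < M, μ.rowLen i = ν.rowLen i := by
    intro i hi
    have := hx i hi
    unfold xs at this
    omega
  constructor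
  · intro hm
    have hb := mem_bounds μ hμs M i j hμ hm
    rw [YoungDiagram.mem_iff_lt_rowLen] at hm ⊢
    rwa [← hr i hb.1]
  · intro hm
    have hb := mem_bounds ν hνs M i j hν hm
    rw [YoungDiagram.mem_iff_lt_rowLen] at hm ⊢
    rwa [hr i hb.1]

lemma beta_surj (M : ℕ) (B : Finset ℕ) (hB : Refl (2 * M) B B) :
    ∃ μ : YoungDiagram, μ.transpose = μ ∧ μ.rowLen 0 ≤ M ∧ beta μ M = B := by
  have hc : B.card = M := by have := hB.card; omega
  obtain ⟨e, he, heB, hes⟩ : ∃ e : ℕ → ℕ, (∀ i j, i < j → j < M → e j < e i) ∧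
      (∀ i < M, e i ∈ B) ∧ (∀ b ∈ B, ∃ i < M, e i = b) := by
    refine ⟨fun i => if h : i < M then B.orderEmbOfFin hc ⟨M - 1 - i, by omega⟩ else 0,
      ?_, ?_, ?_⟩
    · intro i j hij hj
      simp only [hj, hij.trans hj, dif_pos]
      apply (B.orderEmbOfFin hc).strictMono
      change M - 1 - j < M - 1 - i
      omega
    · intro i hi
      simp only [hi, dif_pos]
      exact orderEmbOfFin_mem _ _ _
    · intro b hb
      have : b ∈ Set.range (B.orderEmbOfFin hc) := by
        rw [range_orderEmbOfFin]; exact hb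
      obtain ⟨k, rfl⟩ := this
      refine ⟨M - 1 - k, by omega, ?_⟩
      beta_reduce
      rw [dif_pos (by omega)]
      congr 1
      ext
      simp only
      omega
  have he' : ∀ i j, i ≤ j → j < M → e j ≤ e i := by
    intro i j hij hj
    rcases hij.eq_or_lt with rfl | h
    · exact le_rfl
    · exact (he i j h hj).le
  have hinj : ∀ i j, i < M → j < M → e i = e j → i = j := by
    intro i j hi hj h
    rcases lt_trichotomy i j with h1 | h1 | h1
    · have := he i j h1 hj; omega
    · exact h1
    · have := he j i h1 hi; omega
  have hlt : ∀ i < M, e i < 2 * M := fun i hi => mem_range.1 (hB.1 (heB i hi))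
  let μ : YoungDiagram :=
    { cells := (range M ×ˢ range M).filter (fun c => 2 * M ≤ e c.1 + e c.2)
      isLowerSet := by
        rintro ⟨i, j⟩ ⟨i', j'⟩ hle hm
        have h1 : i' ≤ i := hle.1
        have h2 : j' ≤ j := hle.2
        simp only [coe_filter, mem_product, mem_range, Set.mem_ofPred_eq] at hm ⊢
        have := he' i' i h1 hm.1.1
        have := he' j' j h2 hm.1.2
        omega }
  have hmem : ∀ i j, (i, j) ∈ μ ↔ (i < M ∧ j < M) ∧ 2 * M ≤ e i + e j := by
    intro i j
    rw [← YoungDiagram.mem_cells]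
    simp [μ]
  have hs : μ.transpose = μ := by
    ext ⟨i, j⟩
    rw [YoungDiagram.mem_cells, YoungDiagram.mem_cells, YoungDiagram.mem_transpose,
      Prod.swap_prod_mk, hmem, hmem, and_comm (a := i < M), add_comm]
  have hrow : ∀ i, μ.rowLen i ≤ M := by
    intro i
    by_contra hcon
    push Not at hcon
    have := (hmem i M).1 (YoungDiagram.mem_iff_lt_rowLen.2 hcon)
    omega
  refine ⟨μ, hs, hrow 0, ?_⟩
  have hx : ∀ i < M, xs μ M i = e i := by
    intro i hi
    have h1 : μ.rowLen i = (range (e i) \ B).card := by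
      rw [YoungDiagram.rowLen_eq_card]
      refine card_bij (fun c _ => 2 * M - 1 - e c.2) ?_ ?_ ?_
      · rintro ⟨i', j⟩ h
        rw [YoungDiagram.mem_row_iff] at h
        obtain ⟨h1, h2⟩ := h
        simp only at h2
        subst h2
        rw [hmem] at h1
        have := hlt j h1.1.2
        simp only [mem_sdiff, mem_range]
        exact ⟨by omega, (hB.2.2 _ this).1 (heB j h1.1.2)⟩
      · rintro ⟨i1, j1⟩ h1 ⟨i2, j2⟩ h2 heq
        rw [YoungDiagram.mem_row_iff, hmem] at h1 h2
        simp only at heq h1 h2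
        have b1 := hlt j1 h1.1.1.2
        have b2 := hlt j2 h2.1.1.2
        have := hinj j1 j2 h1.1.1.2 h2.1.1.2 (by omega)
        rw [this, h1.2, h2.2]
      · intro y hy
        simp only [mem_sdiff, mem_range] at hy
        have b := hlt i hi
        have h3 := hy.2
        rw [hB.2.2 _ (by omega), not_not] at h3
        obtain ⟨j, hj, hj2⟩ := hes _ h3
        refine ⟨(i, j), ?_, ?_⟩
        · rw [YoungDiagram.mem_row_iff, hmem]
          exact ⟨⟨⟨hi, hj⟩, by omega⟩, rfl⟩
        · simp only; omega
    have h2 : (range (e i) ∩ B).card = M - 1 - i := by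
      have : range (e i) ∩ B = (Ico (i + 1) M).image e := by
        ext b
        simp only [mem_inter, mem_range, mem_image, mem_Ico]
        constructor
        · rintro ⟨h1, h2⟩
          obtain ⟨j, hj, rfl⟩ := hes b h2
          refine ⟨j, ⟨?_, hj⟩, rfl⟩
          by_contra hcon
          have := he' j i (by omega) hi
          omega
        · rintro ⟨j, ⟨h1, h2⟩, rfl⟩
          exact ⟨he i j (by omega) h2, heB j h2⟩
      rw [this, card_image_of_injOn, Nat.card_Ico]
      · omega
      · intro a ha b hb h
        simp only [coe_Ico, Set.mem_Ico] at ha hb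
        exact hinj a b ha.2 hb.2 h
    have h3 := card_sdiff_add_card_inter (range (e i)) B
    rw [card_range] at h3
    unfold xs
    omega
  ext x
  rw [mem_beta]
  constructor
  · rintro ⟨i, hi, rfl⟩
    rw [hx i hi]; exact heB i hi
  · intro h
    obtain ⟨i, hi, rfl⟩ := hes x h
    exact ⟨i, hi, hx i hi⟩

end HK

theorem hooklength_SC_t_even (n t' : ℕ) (hn : 0 < n) (ht' : 0 < t') :
    ∑ᶠ μ : {μ : YoungDiagram // μ.transpose = μ ∧ μ.card = 2 * (2 * t') * n ∧
        (μ.cells.filter fun c => (2 * t') ∣ hookLen μ c).card = 2 * n},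
      ∏ c ∈ μ.1.cells.filter (fun c => (2 * t') ∣ hookLen μ.1 c),
        (1 / (hookLen μ.1 c : ℚ))
      = 1 / ((n.factorial : ℚ) * 2 ^ n * (2 * t' : ℚ) ^ n) := by
  have hL : 2 * (2 * n) * (2 * t') = 2 * (2 * (2 * t') * n) := by ring
  rw [← HK.sum_BB (2 * n) t' n ht' (by omega)]
  rw [← Finset.sum_coe_sort, ← finsum_eq_sum_of_fintype]
  have hle : ∀ μ : {μ : YoungDiagram // μ.transpose = μ ∧ μ.card = 2 * (2 * t') * n ∧
        (μ.cells.filter fun c => (2 * t') ∣ hookLen μ c).card = 2 * n},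
      μ.1.rowLen 0 ≤ 2 * (2 * t') * n := by
    intro μ
    exact (HK.rowLen_le_card _).trans μ.2.2.1.le
  refine finsum_eq_of_bijective
    (fun μ => ⟨HK.beta μ.1 (2 * (2 * t') * n), ?_⟩) ⟨?_, ?_⟩ ?_
  · rw [HK.mem_BB, hL]
    refine ⟨HK.beta_refl _ μ.2.1 _ (hle μ), ?_, ?_⟩
    · rw [← HK.hN_beta _ μ.2.1 _ (hle μ), μ.2.2.1]
    · rw [← HK.hNt_beta _ _ μ.2.1 _ (hle μ), μ.2.2.2]
  · intro μ ν h
    have h := congrArg Subtype.val h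
    exact Subtype.ext (HK.beta_inj _ _ μ.2.1 ν.2.1 _ (hle μ) (hle ν) h)
  · rintro ⟨B, hB⟩
    rw [HK.mem_BB, hL] at hB
    obtain ⟨μ, h1, h2, h3⟩ := HK.beta_surj _ B hB.1
    refine ⟨⟨μ, h1, ?_, ?_⟩, Subtype.ext h3⟩
    · rw [HK.hN_beta μ h1 _ h2, h3, hB.2.1]
    · rw [HK.hNt_beta _ μ h1 _ h2, h3, hB.2.2]
  · intro μ
    exact HK.gpt_beta (fun h => 1 / (h : ℚ)) (2 * t') μ.1 μ.2.1 _ (hle μ)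
end
end

section
/- Let t be a positive integer and let λ be a self-conjugate partition with Littlewood decomposition Ω(λ) = (λ̃, λ^0, λ^1, ..., λ^{t-1}). If t = 2t'+1 is odd, then δ_λ = δ_{λ̃} · δ_{λ^{t'}}. If t is even, then δ_λ = δ_{λ̃}. -/
/-!
Statement 5 (Lemma `littlewood3` (i)): let `t` be a positive integer and `λ` a
self-conjugate partition with Littlewood decomposition `Ω(λ) = (λ̃, λ⁰, …, λ^{t-1})`.
If `t = 2t'+1` is odd then `δ_λ = δ_{λ̃} · δ_{λ^{t'}}`; if `t` is even then
`δ_λ = δ_{λ̃}`.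

The Littlewood decomposition is expressed through the standard bi-infinite
binary word (beta-set) encoding of partitions: a partition `λ` is encoded by the
set `S(λ) = {λ_i - i : i ≥ 1} ⊆ ℤ` (the canonical representation), the `t`-quotient
component `λ^r` is encoded by `S_r = {m : t·m + r ∈ S(λ)}`, and the `t`-core `λ̃`
by sorting each section, so that (with `c_r` the charge of `S_r`) the Durfee
length of `λ^r` is `#(S_r ∩ [c_r, ∞))` and that of `λ̃` is `Σ_r max(c_r, 0)`.
-/

noncomputable section

/-- The beta-set (canonical bi-infinite word) of a Young diagram:
`{λ_{i+1} - (i+1) : i ≥ 0} ⊆ ℤ`. -/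
def betaSet (μ : YoungDiagram) : Set ℤ :=
  Set.range fun i : ℕ => (μ.rowLen i : ℤ) - i - 1

/-- The beta-set of the `r`-th component `λ^r` of the `t`-quotient of `μ`:
the `r`-th section of the word of `μ`. -/
def quotSet (μ : YoungDiagram) (t r : ℕ) : Set ℤ :=
  {m : ℤ | (t : ℤ) * m + r ∈ betaSet μ}

/-- The charge of a subset of `ℤ` (encoding a partition up to shift):
the number of nonnegative elements minus the number of negative non-elements. -/
def charge (T : Set ℤ) : ℤ :=
  (Nat.card {m : ℤ // m ∈ T ∧ 0 ≤ m} : ℤ) - (Nat.card {m : ℤ // m ∉ T ∧ m < 0} : ℤ)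

/-- The Durfee length of the partition encoded (up to shift) by `T ⊆ ℤ`:
the number of elements of `T` that are `≥ charge T`. -/
def durfeeOfSet (T : Set ℤ) : ℕ :=
  Nat.card {m : ℤ // m ∈ T ∧ charge T ≤ m}

/-- The Durfee length of the `r`-th component of the `t`-quotient of `μ`. -/
def quotDurfee (μ : YoungDiagram) (t r : ℕ) : ℕ :=
  durfeeOfSet (quotSet μ t r)

/-- The Durfee length of the `t`-core of `μ`: after sorting each section of the
word, the section `r` becomes `ℤ_{< c_r}` where `c_r` is its charge, and the
Durfee length of the core is `Σ_r max(c_r, 0)`. -/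
def coreDurfee (μ : YoungDiagram) (t : ℕ) : ℕ :=
  ∑ r ∈ Finset.range t, (charge (quotSet μ t r)).toNat

/-- The Durfee length of a Young diagram: the number of diagonal cells. -/
def durfee (μ : YoungDiagram) : ℕ :=
  (μ.cells.filter fun c => c.1 = c.2).card

theorem mem_rowLen_symm (μ : YoungDiagram) (hsc : μ.transpose = μ) (i j : ℕ) :
    j < μ.rowLen i ↔ i < μ.rowLen j := by
  rw [← YoungDiagram.mem_iff_lt_rowLen, ← YoungDiagram.mem_iff_lt_rowLen]
  conv_lhs => rw [← hsc]
  rw [YoungDiagram.mem_transpose]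
  rfl

theorem betaSet_symm (μ : YoungDiagram) (hsc : μ.transpose = μ) (x : ℤ) :
    x ∉ betaSet μ ↔ -1 - x ∈ betaSet μ := by
  have hs := mem_rowLen_symm μ hsc
  constructor
  · intro hx
    have hne : ∀ i : ℕ, (μ.rowLen i : ℤ) - i - 1 ≠ x := fun i h => hx ⟨i, h⟩
    have hex : ∃ i : ℕ, (μ.rowLen i : ℤ) - i - 1 < x := by
      refine ⟨μ.rowLen 0 + x.natAbs, ?_⟩
      have := μ.rowLen_anti 0 (μ.rowLen 0 + x.natAbs) (Nat.zero_le _)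
      omega
    classical
    have hi := Nat.find_spec hex
    have hmin := fun k => Nat.find_min hex (m := k)
    generalize Nat.find hex = i at hi hmin
    obtain ⟨j, hj⟩ : ∃ j : ℕ, (j : ℤ) = i + x := ⟨(i + x).toNat, by omega⟩
    refine ⟨j, ?_⟩
    have h1 := hs i j
    have h2 : i = 0 ∨ i ≤ μ.rowLen j := by
      rcases Nat.eq_zero_or_pos i with h | h
      · exact Or.inl h
      · right
        have a := hmin (i - 1) (by omega)
        have b := hne (i - 1)
        have c := hs (i - 1) j
        omega
    show (μ.rowLen j : ℤ) - j - 1 = -1 - x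
    omega
  · rintro ⟨j, hj⟩ ⟨i, hi⟩
    simp only at hi hj
    have := hs i j
    omega

/-- Number of nonnegative elements. -/
def posCount (T : Set ℤ) : ℕ := Nat.card {m : ℤ // m ∈ T ∧ 0 ≤ m}

theorem durfee_eq (μ : YoungDiagram) :
    durfee μ = posCount (betaSet μ) ∧ Finite {m : ℤ // m ∈ betaSet μ ∧ 0 ≤ m} := by
  let e : {c // c ∈ μ.cells.filter fun c => c.1 = c.2} → {m : ℤ // m ∈ betaSet μ ∧ 0 ≤ m} :=
    fun c => ⟨(μ.rowLen c.1.1 : ℤ) - c.1.1 - 1, ⟨c.1.1, rfl⟩, by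
      have h := c.2
      rw [Finset.mem_filter, YoungDiagram.mem_cells] at h
      have h2 : (c.1.1, c.1.2) ∈ μ := h.1
      rw [YoungDiagram.mem_iff_lt_rowLen] at h2
      omega⟩
  have he : Function.Bijective e := by
    constructor
    · rintro ⟨⟨a, b⟩, h⟩ ⟨⟨c, d⟩, h'⟩ hh
      have hab : a = b := (Finset.mem_filter.1 h).2
      have hcd : c = d := (Finset.mem_filter.1 h').2
      have hh' : (μ.rowLen a : ℤ) - a - 1 = (μ.rowLen c : ℤ) - c - 1 := congrArg Subtype.val hh
      have hac : a = c := by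
        rcases le_total a c with q | q
        · have := μ.rowLen_anti _ _ q
          omega
        · have := μ.rowLen_anti _ _ q
          omega
      subst hab hcd hac
      rfl
    · rintro ⟨m, ⟨i, hi⟩, hm⟩
      simp only at hi
      refine ⟨⟨(i, i), ?_⟩, Subtype.ext hi⟩
      rw [Finset.mem_filter, YoungDiagram.mem_cells, YoungDiagram.mem_iff_lt_rowLen]
      exact ⟨by omega, rfl⟩
  refine ⟨?_, Finite.of_surjective e he.2⟩
  rw [posCount, ← Nat.card_congr (Equiv.ofBijective e he), durfee, Nat.card_eq_fintype_card,
    Fintype.card_coe]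

theorem durfee_sum (μ : YoungDiagram) (t : ℕ) (ht : 0 < t) :
    durfee μ = ∑ r ∈ Finset.range t, posCount (quotSet μ t r) := by
  obtain ⟨h1, hfin⟩ := durfee_eq μ
  have ht' : (0 : ℤ) < t := by exact_mod_cast ht
  let e : (Σ r : Fin t, {m : ℤ // m ∈ quotSet μ t r ∧ 0 ≤ m}) →
      {m : ℤ // m ∈ betaSet μ ∧ 0 ≤ m} :=
    fun p => ⟨t * p.2.1 + (p.1 : ℕ), p.2.2.1, by
      have := p.2.2.2
      positivity⟩
  have he : Function.Bijective e := by
    constructor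
    · rintro ⟨r, m, hm⟩ ⟨r', m', hm'⟩ hh
      have hh' : (t : ℤ) * m + (r : ℕ) = t * m' + (r' : ℕ) := congrArg Subtype.val hh
      have hr : ((r : ℕ) : ℤ) < t := by exact_mod_cast r.2
      have hr' : ((r' : ℕ) : ℤ) < t := by exact_mod_cast r'.2
      have a : m = m' := by
        have := congrArg (· / (t : ℤ)) hh'
        rwa [Int.mul_add_ediv_left _ _ ht'.ne', Int.mul_add_ediv_left _ _ ht'.ne',
          Int.ediv_eq_zero_of_lt (by positivity) hr, Int.ediv_eq_zero_of_lt (by positivity) hr',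
          add_zero, add_zero] at this
      subst a
      have b : r = r' := by
        apply Fin.ext
        omega
      subst b
      rfl
    · rintro ⟨x, hx, hx0⟩
      have hm0 := Int.emod_nonneg x ht'.ne'
      have hm1 := Int.emod_lt_of_pos x ht'
      have hcast : (((x % t).toNat : ℕ) : ℤ) = x % t := Int.toNat_of_nonneg hm0
      have hxx : (t : ℤ) * (x / t) + ((x % t).toNat : ℕ) = x := by
        rw [hcast]; exact Int.mul_ediv_add_emod x t
      refine ⟨⟨⟨(x % t).toNat, by omega⟩, ⟨x / t, ?_, Int.ediv_nonneg hx0 ht'.le⟩⟩, ?_⟩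
      · show (t : ℤ) * (x / t) + ((x % t).toNat : ℕ) ∈ betaSet μ
        rw [hxx]; exact hx
      · exact Subtype.ext hxx
  have hf : ∀ r : Fin t, Finite {m : ℤ // m ∈ quotSet μ t r ∧ 0 ≤ m} := fun r =>
    Finite.of_injective (fun m => e ⟨r, m⟩) (fun a b h => by
      have := he.1 h
      simpa using this)
  rw [h1, posCount, ← Nat.card_congr (Equiv.ofBijective e he), Nat.card_sigma,
    Finset.sum_range]
  rfl

theorem charge_eq (μ : YoungDiagram) (hsc : μ.transpose = μ) (t r : ℕ) (hr : r < t) :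
    charge (quotSet μ t r) =
      (posCount (quotSet μ t r) : ℤ) - posCount (quotSet μ t (t - 1 - r)) := by
  have key : ∀ m : ℤ, m ∉ quotSet μ t r ↔ -1 - m ∈ quotSet μ t (t - 1 - r) := by
    intro m
    show (t : ℤ) * m + r ∉ betaSet μ ↔ (t : ℤ) * (-1 - m) + (t - 1 - r : ℕ) ∈ betaSet μ
    rw [betaSet_symm μ hsc]
    have : -1 - ((t : ℤ) * m + r) = (t : ℤ) * (-1 - m) + (t - 1 - r : ℕ) := by
      have : ((t - 1 - r : ℕ) : ℤ) = t - 1 - r := by omega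
      rw [this]; ring
    rw [this]
  unfold charge posCount
  congr 2
  refine Nat.card_congr (Equiv.subtypeEquiv (Equiv.subLeft (-1 : ℤ)) ?_)
  intro m
  rw [key m, Equiv.subLeft_apply]
  have : m < 0 ↔ 0 ≤ -1 - m := by omega
  rw [this]

theorem sum_symm_aux (f : ℕ → ℕ) (k s : ℕ)
    (h : ∀ i < k, f (s + i) = f (k - 1 - i)) :
    ∑ i ∈ Finset.range k, f (s + i) = ∑ i ∈ Finset.range k, f i := by
  rw [← Finset.sum_range_reflect f k]
  exact Finset.sum_congr rfl fun i hi => h i (Finset.mem_range.1 hi)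

theorem littlewood_delta_SC (t : ℕ) (ht : 0 < t) (μ : YoungDiagram)
    (hsc : μ.transpose = μ) :
    (Odd t → ((-1 : ℤ) ^ durfee μ =
      (-1) ^ coreDurfee μ t * (-1) ^ quotDurfee μ t (t / 2))) ∧
    (Even t → ((-1 : ℤ) ^ durfee μ = (-1) ^ coreDurfee μ t)) := by
  have hD := durfee_sum μ t ht
  let P : ℕ → ℕ := fun r => posCount (quotSet μ t r)
  let f : ℕ → ℕ := fun r => min (P r) (P (t - 1 - r))
  have hsum : durfee μ = coreDurfee μ t + ∑ r ∈ Finset.range t, f r := by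
    rw [hD, coreDurfee, ← Finset.sum_add_distrib]
    refine Finset.sum_congr rfl fun r hr => ?_
    rw [charge_eq μ hsc t r (Finset.mem_range.1 hr)]
    simp only [f, P]
    omega
  have hf : ∀ r < t, f (t - 1 - r) = f r := by
    intro r hr
    have : t - 1 - (t - 1 - r) = r := by omega
    simp only [f, this]
    exact min_comm _ _
  constructor
  · rintro ⟨k, hk⟩
    have hk2 : t / 2 = k := by omega
    have hmid : t - 1 - k = k := by omega
    have hq : quotDurfee μ t k = f k := by
      have hc := charge_eq μ hsc t k (by omega)
      rw [hmid, sub_self] at hc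
      simp only [f, P, hmid, min_self]
      unfold quotDurfee durfeeOfSet posCount
      rw [hc]
    have h2 : ∑ r ∈ Finset.range t, f r = 2 * ∑ r ∈ Finset.range k, f r + f k := by
      have ht2 : t = (k + 1) + k := by omega
      have a := sum_symm_aux f k (k + 1) (fun i hi => by
        rw [← hf (k - 1 - i) (by omega)]
        congr 1
        omega)
      have e : Finset.range t = Finset.range ((k + 1) + k) := by rw [← ht2]
      rw [e, Finset.sum_range_add, Finset.sum_range_succ, a]
      ring
    rw [hk2, hq, hsum, h2, pow_add, pow_add, pow_mul]
    simp
  · rintro ⟨k, hk⟩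
    have h2 : ∑ r ∈ Finset.range t, f r = 2 * ∑ r ∈ Finset.range k, f r := by
      have a := sum_symm_aux f k k (fun i hi => by
        rw [← hf (k - 1 - i) (by omega)]
        congr 1
        omega)
      have e : Finset.range t = Finset.range (k + k) := by rw [← hk]
      rw [e, Finset.sum_range_add, a]
      ring
    rw [hsum, h2, pow_add, pow_mul]
    simp
end
end

section
/- Let t = 2t' be an even positive integer. The signed generating function of self-conjugate t-cores satisfies: Σ_{λ ∈ SC_{(t)}} δ_λ x^{|λ|} = ∏_{k≥1} [(1-x^k)/(1-x^{2k})] · (1-x^{2kt})^{t'}. -/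
/-!
Statement 8 (Lemma `fungensign`, even case): for `t = 2t'` an even positive
integer, the signed generating function of self-conjugate `t`-cores satisfies
Σ_{λ ∈ SC_{(t)}} δ_λ x^{|λ|} = ∏_{k≥1} [(1-x^k)/(1-x^{2k})] · (1-x^{2kt})^{t'},
as a formal power series over ℤ. (The inverse `1/(1-x^{2k})` is taken via
`PowerSeries.invOfUnit`, legitimate since the constant coefficient is the
unit 1.)
-/

noncomputable section

open PowerSeries

/-- Product (pi) topology on formal power series. -/
instance {R : Type*} [TopologicalSpace R] : TopologicalSpace (PowerSeries R) :=
  inferInstanceAs (TopologicalSpace ((Unit →₀ ℕ) → R))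

section PartA

/-- Indices of diagonal cells. -/
def diagIdx (μ : YoungDiagram) : Finset ℕ :=
  (Finset.range (μ.rowLen 0)).filter fun i => i < μ.rowLen i

/-- The set of arm lengths of the diagonal cells. -/
def armSet (μ : YoungDiagram) : Finset ℕ :=
  (diagIdx μ).image fun i => μ.rowLen i - 1 - i

lemma mem_diagIdx (μ : YoungDiagram) (i : ℕ) : i ∈ diagIdx μ ↔ i < μ.rowLen i := by
  have := μ.rowLen_anti 0 i (Nat.zero_le _)
  simp only [diagIdx, Finset.mem_filter, Finset.mem_range]
  omega

lemma mem_armSet (μ : YoungDiagram) (a : ℕ) : a ∈ armSet μ ↔ ∃ i, μ.rowLen i = a + i + 1 := by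
  simp only [armSet, Finset.mem_image, mem_diagIdx]
  constructor
  · rintro ⟨i, hi, h⟩
    exact ⟨i, by omega⟩
  · rintro ⟨i, hi⟩
    exact ⟨i, by omega, by omega⟩

lemma arm_injOn (μ : YoungDiagram) :
    Set.InjOn (fun i => μ.rowLen i - 1 - i) {i | i < μ.rowLen i} := by
  intro i hi j hj h
  simp only [Set.mem_ofPred_eq] at hi hj h
  rcases le_total i j with hij | hij
  · have := μ.rowLen_anti i j hij
    omega
  · have := μ.rowLen_anti j i hij
    omega

lemma durfee_eq_s8 (μ : YoungDiagram) : durfee μ = (armSet μ).card := by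
  rw [armSet, Finset.card_image_of_injOn, durfee]
  · have : (μ.cells.filter fun c => c.1 = c.2) = (diagIdx μ).image fun i => (i, i) := by
      ext ⟨a, b⟩
      simp only [Finset.mem_filter, YoungDiagram.mem_cells, Finset.mem_image, mem_diagIdx,
        YoungDiagram.mem_iff_lt_rowLen, Prod.mk.injEq]
      constructor
      · rintro ⟨h, rfl⟩
        exact ⟨a, h, rfl, rfl⟩
      · rintro ⟨i, h, rfl, rfl⟩
        exact ⟨h, rfl⟩
    rw [this, Finset.card_image_of_injective]
    intro i j h
    simpa using h
  · intro i hi j hj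
    rw [Finset.mem_coe, mem_diagIdx] at hi hj
    exact arm_injOn μ hi hj

lemma sc_colLen {μ : YoungDiagram} (h : μ.transpose = μ) (i : ℕ) : μ.colLen i = μ.rowLen i := by
  rw [← YoungDiagram.rowLen_transpose, h]

lemma sc_symm {μ : YoungDiagram} (h : μ.transpose = μ) (i j : ℕ) :
    i < μ.rowLen j ↔ j < μ.rowLen i := by
  rw [← YoungDiagram.mem_iff_lt_rowLen, YoungDiagram.mem_iff_lt_colLen, sc_colLen h]

lemma card_eq_sum {μ : YoungDiagram} (h : μ.transpose = μ) :
    μ.card = ∑ a ∈ armSet μ, (2 * a + 1) := by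
  rw [armSet, Finset.sum_image]
  · rw [YoungDiagram.card, Finset.card_eq_sum_card_fiberwise (t := diagIdx μ)
      (f := fun c => min c.1 c.2)]
    · apply Finset.sum_congr rfl
      intro i hi
      rw [mem_diagIdx] at hi
      have : (μ.cells.filter fun c => min c.1 c.2 = i) =
          ({i} ×ˢ Finset.Ico i (μ.rowLen i)) ∪ (Finset.Ico (i+1) (μ.rowLen i) ×ˢ {i}) := by
        ext ⟨a, b⟩
        simp only [Finset.mem_filter, YoungDiagram.mem_cells, YoungDiagram.mem_iff_lt_rowLen,
          Finset.mem_union, Finset.mem_product, Finset.mem_singleton, Finset.mem_Ico]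
        constructor
        · rintro ⟨h1, h2⟩
          rcases le_total a b with hab | hab
          · rw [min_eq_left hab] at h2
            subst h2
            left; omega
          · rw [min_eq_right hab] at h2
            subst h2
            rw [sc_symm h] at h1
            rcases hab.eq_or_lt with h3 | h3
            · subst h3; left; omega
            · right; omega
        · rintro (⟨rfl, h2, h3⟩ | ⟨⟨h2, h3⟩, rfl⟩)
          · exact ⟨h3, min_eq_left h2⟩
          · rw [sc_symm h]
            exact ⟨h3, min_eq_right (by omega)⟩
      rw [this, Finset.card_union_of_disjoint]
      · simp
        omega
      · rw [Finset.disjoint_left]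
        rintro ⟨a, b⟩
        simp only [Finset.mem_product, Finset.mem_singleton, Finset.mem_Ico]
        omega
    · rintro ⟨a, b⟩ hc
      simp only [Finset.mem_coe, YoungDiagram.mem_cells, YoungDiagram.mem_iff_lt_rowLen] at hc
      simp only [Finset.mem_coe, mem_diagIdx]
      have h1 := μ.rowLen_anti (min a b) a (min_le_left _ _)
      have := min_le_right a b
      omega
  · intro i hi j hj
    rw [Finset.mem_coe, mem_diagIdx] at hi hj
    exact arm_injOn μ hi hj

lemma lower_card (S : Finset ℕ) (hS : ∀ i ∈ S, ∀ j ≤ i, j ∈ S) (i : ℕ) :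
    i ∈ S ↔ i < S.card := by
  constructor
  · intro hi
    have : Finset.range (i+1) ⊆ S := by
      intro j hj
      exact hS i hi j (by simpa [Nat.lt_succ_iff] using hj)
    have := Finset.card_le_card this
    simp at this
    omega
  · intro hi
    by_contra hn
    have : S ⊆ Finset.range i := by
      intro j hj
      rw [Finset.mem_range]
      by_contra hji
      exact hn (hS j hj i (by omega))
    have := Finset.card_le_card this
    simp at this
    omega

lemma count_iff (μ : YoungDiagram) (k i : ℕ) :
    k + i < μ.rowLen i ↔ i < ((armSet μ).filter fun a => k ≤ a).card := by
  have h1 : (armSet μ).filter (fun a => k ≤ a) =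
      ((diagIdx μ).filter fun i => k + i < μ.rowLen i).image (fun i => μ.rowLen i - 1 - i) := by
    ext a
    simp only [Finset.mem_filter, mem_armSet, Finset.mem_image, mem_diagIdx]
    constructor
    · rintro ⟨⟨i, hi⟩, h⟩
      exact ⟨i, by omega, by omega⟩
    · rintro ⟨i, h, h'⟩
      exact ⟨⟨i, by omega⟩, by omega⟩
  rw [h1, Finset.card_image_of_injOn, ← lower_card]
  · simp only [Finset.mem_filter, mem_diagIdx]
    omega
  · intro i hi j hj
    simp only [Finset.mem_filter, mem_diagIdx] at hi ⊢
    have := μ.rowLen_anti j i hj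
    omega
  · intro i hi j hj
    simp only [Finset.mem_coe, Finset.mem_filter, mem_diagIdx] at hi hj
    exact arm_injOn μ hi.1 hj.1

lemma armSet_inj {μ ν : YoungDiagram} (hμ : μ.transpose = μ) (hν : ν.transpose = ν)
    (h : armSet μ = armSet ν) : μ = ν := by
  have key : ∀ i j, i ≤ j → (j < μ.rowLen i ↔ j < ν.rowLen i) := by
    intro i j hij
    have h1 := count_iff μ (j - i) i
    have h2 := count_iff ν (j - i) i
    rw [Nat.sub_add_cancel hij] at h1 h2
    rw [h1, h2, h]
  ext ⟨i, j⟩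
  rw [YoungDiagram.mem_cells, YoungDiagram.mem_cells, YoungDiagram.mem_iff_lt_rowLen,
    YoungDiagram.mem_iff_lt_rowLen]
  rcases le_total i j with hij | hij
  · exact key i j hij
  · rw [sc_symm hμ, sc_symm hν]
    exact key j i hij

/-- The self-conjugate diagram with given diagonal arm lengths. -/
def ofArms (A : Finset ℕ) : YoungDiagram where
  cells := (Finset.range (A.sup id + A.card + 1) ×ˢ Finset.range (A.sup id + A.card + 1)).filter
    fun c => min c.1 c.2 < (A.filter fun a => max c.1 c.2 ≤ a + min c.1 c.2).card
  isLowerSet := by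
    rintro ⟨i, j⟩ ⟨i', j'⟩ hle hc
    simp only [Finset.coe_filter, Finset.mem_product, Finset.mem_range, Set.mem_ofPred_eq] at hc ⊢
    have hle1 : i' ≤ i := hle.1
    have hle2 : j' ≤ j := hle.2
    refine ⟨by omega, ?_⟩
    obtain ⟨-, hc⟩ := hc
    have hm : min i' j' ≤ min i j := min_le_min hle1 hle2
    have hM : max i' j' ≤ max i j := max_le_max hle1 hle2
    have hmM : min i j ≤ max i j := min_le_max
    generalize min i' j' = m' at *
    generalize min i j = m at *
    generalize max i' j' = M' at *
    generalize max i j = M at *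
    have hsub : (A.filter fun a => M ≤ a + m) ⊆
        (A.filter fun a => M' ≤ a + m') ∪ Finset.Ico (M - m) (M - m') := by
      intro a ha
      simp only [Finset.mem_filter, Finset.mem_union, Finset.mem_Ico] at ha ⊢
      by_cases h : M' ≤ a + m'
      · exact Or.inl ⟨ha.1, h⟩
      · right; omega
    have h1 := (Finset.card_le_card hsub).trans (Finset.card_union_le _ _)
    rw [Nat.card_Ico] at h1
    omega

lemma mem_ofArms (A : Finset ℕ) (i j : ℕ) : (i, j) ∈ ofArms A ↔
    min i j < (A.filter fun a => max i j ≤ a + min i j).card := by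
  rw [← YoungDiagram.mem_cells]
  simp only [ofArms, Finset.mem_filter, Finset.mem_product, Finset.mem_range,
    and_iff_right_iff_imp]
  intro h
  have h1 : (A.filter fun a => max i j ≤ a + min i j).card ≤ A.card := Finset.card_filter_le _ _
  have h2 : 0 < (A.filter fun a => max i j ≤ a + min i j).card := by omega
  obtain ⟨a, ha⟩ := Finset.card_pos.mp h2
  rw [Finset.mem_filter] at ha
  have h3 : a ≤ A.sup id := Finset.le_sup (f := id) ha.1
  have := le_max_left i j
  have := le_max_right i j
  omega

lemma ofArms_transpose (A : Finset ℕ) : (ofArms A).transpose = ofArms A := by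
  ext ⟨i, j⟩
  rw [YoungDiagram.mem_cells, YoungDiagram.mem_cells, YoungDiagram.mem_transpose, Prod.swap_prod_mk,
    mem_ofArms, mem_ofArms, min_comm, max_comm]

lemma armSet_ofArms (A : Finset ℕ) : armSet (ofArms A) = A := by
  have hrow : ∀ k i, k + i < (ofArms A).rowLen i ↔ i < (A.filter fun a => k ≤ a).card := by
    intro k i
    rw [← YoungDiagram.mem_iff_lt_rowLen, mem_ofArms, min_eq_left (by omega),
      max_eq_right (by omega)]
    simp only [add_le_add_iff_right]
  have hsplit : ∀ a, (A.filter fun b => a ≤ b).card =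
      (A.filter fun b => a + 1 ≤ b).card + if a ∈ A then 1 else 0 := by
    intro a
    split_ifs with h
    · have : (A.filter fun b => a ≤ b) = insert a (A.filter fun b => a + 1 ≤ b) := by
        ext b
        simp only [Finset.mem_filter, Finset.mem_insert]
        constructor
        · rintro ⟨h1, h2⟩
          rcases h2.eq_or_lt with h3 | h3
          · exact Or.inl h3.symm
          · exact Or.inr ⟨h1, h3⟩
        · rintro (rfl | ⟨h1, h2⟩)
          · exact ⟨h, le_rfl⟩
          · exact ⟨h1, by omega⟩
      rw [this, Finset.card_insert_of_notMem]
      simp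
    · congr 1
      ext b
      simp only [Finset.mem_filter]
      constructor
      · rintro ⟨h1, h2⟩
        rcases h2.eq_or_lt with h3 | h3
        · subst h3; exact absurd h1 h
        · exact ⟨h1, h3⟩
      · rintro ⟨h1, h2⟩
        exact ⟨h1, by omega⟩
  ext a
  rw [mem_armSet]
  constructor
  · rintro ⟨i, hi⟩
    have h1 := (hrow a i).1 (by omega)
    have h2 := (hrow (a+1) i).not.1 (by omega)
    have h3 := hsplit a
    by_contra hn
    rw [if_neg hn] at h3
    omega
  · intro ha
    have h3 := hsplit a
    rw [if_pos ha] at h3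
    refine ⟨(A.filter fun b => a + 1 ≤ b).card, ?_⟩
    have h1 := (hrow a (A.filter fun b => a + 1 ≤ b).card).2 (by omega)
    have h2 := (hrow (a+1) (A.filter fun b => a + 1 ≤ b).card).not.2 (by omega)
    omega

/-- The core condition on arm sets. -/
def IsCoreSet (t : ℕ) (A : Finset ℕ) : Prop :=
  (∀ a, a + t ∈ A → a ∈ A) ∧ ∀ a b, a + b + 1 = t → a ∈ A → b ∉ A

lemma bead_or_hole {μ : YoungDiagram} (h : μ.transpose = μ) (n : ℤ) :
    (∃ i, (μ.rowLen i : ℤ) = n + i + 1) ∨ ∃ j : ℕ, (j : ℤ) = n + μ.rowLen j := by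
  have hex : ∃ i : ℕ, (μ.rowLen i : ℤ) < n + i + 1 := by
    refine ⟨μ.rowLen 0 + n.natAbs, ?_⟩
    have := μ.rowLen_anti 0 (μ.rowLen 0 + n.natAbs) (Nat.zero_le _)
    have := neg_abs_le n
    push_cast
    omega
  classical
  set i := Nat.find hex with hi
  have h1 : (μ.rowLen i : ℤ) < n + i + 1 := Nat.find_spec hex
  have h2 : ∀ k < i, ¬ (μ.rowLen k : ℤ) < n + k + 1 := fun k hk => Nat.find_min hex hk
  by_cases hb : ∃ i, (μ.rowLen i : ℤ) = n + i + 1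
  · exact Or.inl hb
  right
  refine ⟨(n + i).toNat, ?_⟩
  have hj : ((n + i).toNat : ℤ) = n + i := by omega
  generalize (n + i).toNat = j at *
  have h3 : ¬ i < μ.rowLen j := by
    rw [sc_symm h]
    omega
  have h4 : i ≤ μ.rowLen j := by
    by_contra hlt
    have h5 := h2 (i-1) (by omega)
    have h6 : (μ.rowLen (i-1) : ℤ) ≠ n + (i-1 : ℕ) + 1 := fun h => hb ⟨_, h⟩
    have h7 : j < μ.rowLen (i-1) := by omega
    rw [sc_symm h] at h7
    omega
  omega

lemma not_bead_and_hole {μ : YoungDiagram} (h : μ.transpose = μ) (n : ℤ) (i j : ℕ)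
    (h1 : (μ.rowLen i : ℤ) = n + i + 1) (h2 : (j : ℤ) = n + μ.rowLen j) : False := by
  have := sc_symm h i j
  omega

lemma core_iff {μ : YoungDiagram} (h : μ.transpose = μ) (t : ℕ) (ht : 0 < t) :
    (∀ c ∈ μ.cells, ¬ t ∣ hookLen μ c) ↔ IsCoreSet t (armSet μ) := by
  constructor
  · intro hc
    have key : ∀ i j, μ.rowLen i + μ.rowLen j = t + i + j + 1 → False := by
      intro i j hij
      have h1 := sc_symm h i j
      have h2 : j < μ.rowLen i := by omega
      apply hc (i, j)
      · rw [YoungDiagram.mem_cells, YoungDiagram.mem_iff_lt_rowLen]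
        exact h2
      · rw [hookLen, sc_colLen h]
        simp only
        rw [show μ.rowLen i + μ.rowLen j - i - j - 1 = t by omega]
    constructor
    · intro a ha
      rw [mem_armSet] at ha ⊢
      obtain ⟨i, hi⟩ := ha
      rcases bead_or_hole h a with ⟨k, hk⟩ | ⟨j, hj⟩
      · exact ⟨k, by omega⟩
      · exact (key i j (by omega)).elim
    · intro a b hab ha hb
      rw [mem_armSet] at ha hb
      obtain ⟨i, hi⟩ := ha
      obtain ⟨j, hj⟩ := hb
      exact key i j (by omega)
  · rintro ⟨h1, h2⟩ ⟨i, j⟩ hc ⟨k, hk⟩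
    rw [YoungDiagram.mem_cells, YoungDiagram.mem_iff_lt_rowLen] at hc
    have hc' := (sc_symm h i j).2 hc
    rw [hookLen, sc_colLen h] at hk
    simp only at hk
    have step : ∀ z : ℤ, (∃ i, (μ.rowLen i : ℤ) = z + i + 1) →
        ∃ i, (μ.rowLen i : ℤ) = (z - t) + i + 1 := by
      rintro z ⟨i, hi⟩
      rcases bead_or_hole h (z - t) with hb | ⟨j, hj⟩
      · exact hb
      exfalso
      by_cases hz : 0 ≤ z
      · have hzA : z.toNat ∈ armSet μ := by
          rw [mem_armSet]
          exact ⟨i, by omega⟩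
        by_cases hzt : (t : ℤ) ≤ z
        · have := h1 (z - t).toNat (by
            rw [show (z-t).toNat + t = z.toNat by omega]; exact hzA)
          rw [mem_armSet] at this
          obtain ⟨k, hk⟩ := this
          exact not_bead_and_hole h (z - t) k j (by omega) hj
        · refine h2 z.toNat (t - 1 - z).toNat (by omega) hzA ?_
          rw [mem_armSet]
          exact ⟨j, by omega⟩
      · have := h1 (-z-1).toNat (by
          rw [mem_armSet]
          exact ⟨j, by omega⟩)
        rw [mem_armSet] at this
        obtain ⟨k, hk⟩ := this
        exact not_bead_and_hole h z i k hi (by omega)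
    have all : ∀ k : ℕ, ∃ i', (μ.rowLen i' : ℤ) = ((μ.rowLen i : ℤ) - i - 1 - t * k) + i' + 1 := by
      intro k
      induction k with
      | zero => exact ⟨i, by push_cast; ring⟩
      | succ k ih =>
        obtain ⟨i', hi'⟩ := step _ ih
        exact ⟨i', by rw [hi']; push_cast; ring⟩
    obtain ⟨i', hi'⟩ := all k
    refine not_bead_and_hole h _ i' j hi' ?_
    have : (t * k : ℤ) = μ.rowLen i + μ.rowLen j - i - j - 1 := by
      rw [← Nat.cast_mul, ← hk]
      omega
    rw [this]
    ring

end PartA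
section PartB

/-- The arm set coming from a pair of opposite runners. -/
def runSet (t' r : ℕ) (n : ℤ) : Finset ℕ :=
  (Finset.range n.toNat).image (fun j => r + 2 * t' * j) ∪
    (Finset.range (-n).toNat).image (fun j => (2 * t' - 1 - r) + 2 * t' * j)

/-- The arm set of a core with given charge vector. -/
def coreOf (t' : ℕ) (n : Fin t' → ℤ) : Finset ℕ :=
  Finset.univ.biUnion fun r : Fin t' => runSet t' r (n r)

lemma residue_unique {t a b i j : ℕ} (ha : a < t) (hb : b < t) (h : a + t * i = b + t * j) :
    a = b ∧ i = j := by
  have h1 := congrArg (· % t) h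
  simp only [Nat.add_mul_mod_self_left, Nat.mod_eq_of_lt ha, Nat.mod_eq_of_lt hb] at h1
  subst h1
  have h2 : t * i = t * j := by omega
  exact ⟨rfl, Nat.eq_of_mul_eq_mul_left (by omega) h2⟩

lemma mem_runSet (t' r a : ℕ) (n : ℤ) : a ∈ runSet t' r n ↔
    (∃ j < n.toNat, r + 2 * t' * j = a) ∨
      ∃ j < (-n).toNat, (2 * t' - 1 - r) + 2 * t' * j = a := by
  simp [runSet]

lemma mem_coreOf_one (t' : ℕ) (n : Fin t' → ℤ) (r : Fin t') (j : ℕ) :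
    (r : ℕ) + 2 * t' * j ∈ coreOf t' n ↔ j < (n r).toNat := by
  simp only [coreOf, Finset.mem_biUnion, Finset.mem_univ, true_and, mem_runSet]
  constructor
  · rintro ⟨s, ⟨i, hi, h⟩ | ⟨i, hi, h⟩⟩
    · obtain ⟨h1, rfl⟩ := residue_unique (by omega) (by omega) h
      have : s = r := Fin.ext h1
      subst this
      exact hi
    · obtain ⟨h1, rfl⟩ := residue_unique (by omega) (by omega) h
      omega
  · intro h
    exact ⟨r, Or.inl ⟨j, h, rfl⟩⟩

lemma mem_coreOf_two (t' : ℕ) (n : Fin t' → ℤ) (r : Fin t') (j : ℕ) :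
    (2 * t' - 1 - (r : ℕ)) + 2 * t' * j ∈ coreOf t' n ↔ j < (-(n r)).toNat := by
  simp only [coreOf, Finset.mem_biUnion, Finset.mem_univ, true_and, mem_runSet]
  constructor
  · rintro ⟨s, ⟨i, hi, h⟩ | ⟨i, hi, h⟩⟩
    · obtain ⟨h1, rfl⟩ := residue_unique (by omega) (by omega) h
      omega
    · obtain ⟨h1, rfl⟩ := residue_unique (by omega) (by omega) h
      have : s = r := Fin.ext (by omega)
      subst this
      exact hi
  · intro h
    exact ⟨r, Or.inr ⟨j, h, rfl⟩⟩

lemma runner_cases (t' : ℕ) (ht : 0 < t') (a : ℕ) :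
    ∃ (r : Fin t') (j : ℕ), a = (r : ℕ) + 2 * t' * j ∨ a = (2 * t' - 1 - (r : ℕ)) + 2 * t' * j := by
  have h1 := Nat.mod_lt a (show 0 < 2 * t' by omega)
  have h2 := Nat.mod_add_div a (2 * t')
  by_cases h : a % (2 * t') < t'
  · exact ⟨⟨a % (2 * t'), h⟩, a / (2 * t'), Or.inl h2.symm⟩
  · refine ⟨⟨2 * t' - 1 - a % (2 * t'), by omega⟩, a / (2 * t'), Or.inr ?_⟩
    simp only
    omega

lemma coreOf_inj (t' : ℕ) : Function.Injective (coreOf t') := by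
  intro n m h
  funext r
  have h1 : (n r).toNat = (m r).toNat := by
    have : ∀ j, j < (n r).toNat ↔ j < (m r).toNat := fun j => by
      rw [← mem_coreOf_one, ← mem_coreOf_one, h]
    have a := this (n r).toNat
    have b := this (m r).toNat
    omega
  have h2 : (-(n r)).toNat = (-(m r)).toNat := by
    have : ∀ j, j < (-(n r)).toNat ↔ j < (-(m r)).toNat := fun j => by
      rw [← mem_coreOf_two, ← mem_coreOf_two, h]
    have a := this (-(n r)).toNat
    have b := this (-(m r)).toNat
    omega
  omega

lemma coreOf_isCore (t' : ℕ) (ht : 0 < t') (n : Fin t' → ℤ) :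
    IsCoreSet (2 * t') (coreOf t' n) := by
  constructor
  · intro a ha
    obtain ⟨r, j, rfl | rfl⟩ := runner_cases t' ht a
    · rw [add_assoc, ← Nat.mul_succ, mem_coreOf_one] at ha
      rw [mem_coreOf_one]
      omega
    · rw [add_assoc, ← Nat.mul_succ, mem_coreOf_two] at ha
      rw [mem_coreOf_two]
      omega
  · have key : ∀ r : Fin t', (r : ℕ) ∈ coreOf t' n → (2 * t' - 1 - (r : ℕ)) ∈ coreOf t' n →
        False := by
      intro r h1 h2
      have h3 := mem_coreOf_one t' n r 0
      have h4 := mem_coreOf_two t' n r 0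
      rw [mul_zero, add_zero] at h3 h4
      have h5 := h3.1 h1
      have h6 := h4.1 h2
      omega
    intro a b hab ha hb
    by_cases h : a < t'
    · refine key ⟨a, h⟩ ha ?_
      simp only
      rw [show 2 * t' - 1 - a = b by omega]
      exact hb
    · refine key ⟨b, by omega⟩ hb ?_
      simp only
      rw [show 2 * t' - 1 - b = a by omega]
      exact ha

lemma run_card (A : Finset ℕ) (t c : ℕ) (ht : 0 < t) (hA : ∀ a, a + t ∈ A → a ∈ A) :
    ∃ p : ℕ, ∀ j, c + t * j ∈ A ↔ j < p := by
  refine ⟨((Finset.range (A.sup id + 1)).filter fun j => c + t * j ∈ A).card, fun j => ?_⟩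
  rw [← lower_card]
  · simp only [Finset.mem_filter, Finset.mem_range, iff_and_self]
    intro h
    have h3 : c + t * j ≤ A.sup id := Finset.le_sup (f := id) h
    have : j ≤ t * j := Nat.le_mul_of_pos_left j ht
    omega
  · intro i hi j hj
    simp only [Finset.mem_filter, Finset.mem_range] at hi ⊢
    refine ⟨by omega, ?_⟩
    obtain ⟨k, rfl⟩ := Nat.exists_eq_add_of_le hj
    have h := hi.2
    clear hi hj
    induction k with
    | zero => exact h
    | succ k ih =>
      apply ih
      apply hA
      convert h using 1
      ring

lemma coreOf_surj (t' : ℕ) (ht : 0 < t') (A : Finset ℕ) (hA : IsCoreSet (2 * t') A) :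
    ∃ n, coreOf t' n = A := by
  choose p hp using fun c => run_card A (2 * t') c (by omega) hA.1
  refine ⟨fun r => (p r : ℤ) - p (2 * t' - 1 - (r : ℕ)), ?_⟩
  have hpq : ∀ r : Fin t', p r = 0 ∨ p (2 * t' - 1 - (r : ℕ)) = 0 := by
    intro r
    by_contra! hcon
    have h1 := (hp r 0).2 (by omega)
    have h2 := (hp (2 * t' - 1 - (r : ℕ)) 0).2 (by omega)
    rw [mul_zero, add_zero] at h1 h2
    exact hA.2 _ _ (by omega) h1 h2
  ext a
  obtain ⟨r, j, rfl | rfl⟩ := runner_cases t' ht a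
  · rw [mem_coreOf_one, hp]
    have := hpq r
    omega
  · rw [mem_coreOf_two, hp]
    have := hpq r
    omega

/-- The quadratic exponent. -/
def quadExp (t α : ℕ) (n : ℤ) : ℕ := (t * n ^ 2 - (t - α) * n).toNat

lemma quadExp_cast (t α : ℕ) (h1 : 1 ≤ α) (h2 : α + 1 ≤ 2 * t) (n : ℤ) :
    n.natAbs ≤ quadExp t α n ∧ (quadExp t α n : ℤ) = t * n ^ 2 - (t - α) * n := by
  have h : (n.natAbs : ℤ) ≤ t * n ^ 2 - (t - α) * n := by
    rcases Int.natAbs_eq n with h | h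
    · generalize n.natAbs = m at h
      subst h
      have : (m : ℤ) ≤ m ^ 2 := by exact_mod_cast Nat.le_self_pow (by norm_num) m
      have ht : (0 : ℤ) ≤ t := by positivity
      have hm : (0 : ℤ) ≤ m := by positivity
      have h1' : (1 : ℤ) ≤ α := by exact_mod_cast h1
      nlinarith
    · generalize n.natAbs = m at h
      subst h
      have : (m : ℤ) ≤ m ^ 2 := by exact_mod_cast Nat.le_self_pow (by norm_num) m
      have ht : (0 : ℤ) ≤ t := by positivity
      have hm : (0 : ℤ) ≤ m := by positivity
      have h1' : (α : ℤ) + 1 ≤ 2 * t := by exact_mod_cast h2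
      nlinarith
  rw [quadExp]
  omega

lemma runSet_card (t' r : ℕ) (hr : r < t') (n : ℤ) : (runSet t' r n).card = n.natAbs := by
  have inj : ∀ c, Function.Injective fun j : ℕ => c + 2 * t' * j := by
    intro c i j h
    simp only [add_right_inj] at h
    exact Nat.eq_of_mul_eq_mul_left (by omega) h
  rw [runSet]
  rcases le_total 0 n with h | h
  · rw [show (-n).toNat = 0 by omega, Finset.range_zero, Finset.image_empty, Finset.union_empty,
      Finset.card_image_of_injective _ (inj _), Finset.card_range]
    omega
  · rw [show n.toNat = 0 by omega, Finset.range_zero, Finset.image_empty, Finset.empty_union,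
      Finset.card_image_of_injective _ (inj _), Finset.card_range]
    omega

lemma sum_run (t c m : ℕ) :
    ((∑ j ∈ Finset.range m, (2 * (c + t * j) + 1) : ℕ) : ℤ) = m * (2 * c + 1) + t * m * (m - 1) := by
  induction m with
  | zero => simp
  | succ m ih =>
    rw [Finset.sum_range_succ, Nat.cast_add, ih]
    push_cast
    ring

lemma runSet_sum (t' r : ℕ) (hr : r < t') (n : ℤ) :
    ∑ a ∈ runSet t' r n, (2 * a + 1) = quadExp (2 * t') (2 * r + 1) n := by
  have inj : ∀ c, Function.Injective fun j : ℕ => c + 2 * t' * j := by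
    intro c i j h
    simp only [add_right_inj] at h
    exact Nat.eq_of_mul_eq_mul_left (by omega) h
  have hq := (quadExp_cast (2 * t') (2 * r + 1) (by omega) (by omega) n).2
  zify
  rw [hq]
  rw [runSet]
  rcases le_total 0 n with h | h
  · rw [show (-n).toNat = 0 by omega, Finset.range_zero, Finset.image_empty, Finset.union_empty,
      Finset.sum_image (inj _).injOn]
    have := sum_run (2 * t') r n.toNat
    push_cast at this ⊢
    rw [this, show ((n.toNat : ℕ) : ℤ) = n by omega]
    ring
  · rw [show n.toNat = 0 by omega, Finset.range_zero, Finset.image_empty, Finset.empty_union,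
      Finset.sum_image (inj _).injOn]
    have := sum_run (2 * t') (2 * t' - 1 - r) (-n).toNat
    push_cast at this ⊢
    rw [this, show (((-n).toNat : ℕ) : ℤ) = -n by omega,
      show ((2 * t' - 1 - r : ℕ) : ℤ) = 2 * t' - 1 - r by omega]
    ring

lemma runSet_disj (t' : ℕ) (n : Fin t' → ℤ) :
    Set.PairwiseDisjoint (↑(Finset.univ : Finset (Fin t'))) fun r : Fin t' => runSet t' r (n r) := by
  intro r _ s _ hrs
  rw [Function.onFun, Finset.disjoint_left]
  intro a h1 h2
  rw [mem_runSet] at h1 h2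
  apply hrs
  apply Fin.ext
  rcases h1 with ⟨i, -, h1⟩ | ⟨i, -, h1⟩ <;> rcases h2 with ⟨j, -, h2⟩ | ⟨j, -, h2⟩ <;>
  · have := (residue_unique (by omega) (by omega) (h1.trans h2.symm)).1
    omega

lemma coreOf_card (t' : ℕ) (n : Fin t' → ℤ) : (coreOf t' n).card = ∑ r, (n r).natAbs := by
  rw [coreOf, Finset.card_biUnion (runSet_disj t' n)]
  exact Finset.sum_congr rfl fun r _ => runSet_card t' r r.2 _

lemma coreOf_sum (t' : ℕ) (n : Fin t' → ℤ) :
    ∑ a ∈ coreOf t' n, (2 * a + 1) = ∑ r : Fin t', quadExp (2 * t') (2 * r + 1) (n r) := by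
  rw [coreOf, Finset.sum_biUnion (runSet_disj t' n)]
  exact Finset.sum_congr rfl fun r _ => runSet_sum t' r r.2 _

/-- Self-conjugate cores are in bijection with integer vectors. -/
def coreEquiv (t' : ℕ) (ht : 0 < t') :
    (Fin t' → ℤ) ≃ {μ : YoungDiagram // μ.transpose = μ ∧
        ∀ c ∈ μ.cells, ¬ (2 * t') ∣ hookLen μ c} :=
  Equiv.ofBijective (fun n => ⟨ofArms (coreOf t' n), ofArms_transpose _, by
      rw [core_iff (ofArms_transpose _) _ (by omega), armSet_ofArms]
      exact coreOf_isCore t' ht n⟩) (by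
    constructor
    · intro n m h
      have h1 := congrArg armSet (congrArg Subtype.val h)
      simp only [armSet_ofArms] at h1
      exact coreOf_inj t' h1
    · rintro ⟨μ, h1, h2⟩
      rw [core_iff h1 _ (by omega)] at h2
      obtain ⟨n, hn⟩ := coreOf_surj t' ht _ h2
      refine ⟨n, Subtype.ext ?_⟩
      apply armSet_inj (ofArms_transpose _) h1
      rw [armSet_ofArms, hn])

lemma coreEquiv_term (t' : ℕ) (ht : 0 < t') (n : Fin t' → ℤ) :
    PowerSeries.C (R := ℤ) ((-1) ^ durfee (coreEquiv t' ht n).1) * X ^ (coreEquiv t' ht n).1.card =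
      ∏ r : Fin t', (PowerSeries.C (R := ℤ) ((-1) ^ (n r).natAbs) *
        X ^ quadExp (2 * t') (2 * r + 1) (n r)) := by
  have h : (coreEquiv t' ht n).1 = ofArms (coreOf t' n) := rfl
  rw [h, durfee_eq_s8, card_eq_sum (ofArms_transpose _), armSet_ofArms, coreOf_card, coreOf_sum,
    Finset.prod_mul_distrib, Finset.prod_pow_eq_pow_sum, ← map_prod, Finset.prod_pow_eq_pow_sum]

end PartB
section PartC

/-- `(Q;Q)_m` for `Q = X^(2t)`. -/
def qf (t m : ℕ) : ℤ⟦X⟧ := ∏ i ∈ Finset.range m, (1 - X ^ (2 * t * (i + 1)))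

/-- The inverse of `(Q;Q)_m`. -/
def iqf (t m : ℕ) : ℤ⟦X⟧ :=
  ∏ i ∈ Finset.range m, PowerSeries.invOfUnit (1 - X ^ (2 * t * (i + 1))) 1

lemma one_sub_mul_inv (n : ℕ) (hn : 0 < n) :
    (1 - X ^ n : ℤ⟦X⟧) * PowerSeries.invOfUnit (1 - X ^ n) 1 = 1 := by
  apply PowerSeries.mul_invOfUnit
  simp [hn.ne']

lemma qf_mul_iqf (t m : ℕ) (ht : 0 < t) : qf t m * iqf t m = 1 := by
  rw [qf, iqf, ← Finset.prod_mul_distrib]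
  exact Finset.prod_eq_one fun i _ => one_sub_mul_inv _ (by positivity)

lemma qf_succ (t m : ℕ) : qf t (m + 1) = qf t m * (1 - X ^ (2 * t * (m + 1))) :=
  Finset.prod_range_succ _ _

lemma iqf_eq (t m : ℕ) (ht : 0 < t) :
    iqf t m = iqf t (m + 1) * (1 - X ^ (2 * t * (m + 1))) := by
  rw [iqf, iqf, Finset.prod_range_succ, mul_assoc, mul_comm (invOfUnit _ _),
    one_sub_mul_inv _ (by positivity), mul_one]

/-- Gaussian binomials. -/
def gb (t N k : ℕ) : ℤ⟦X⟧ := if k ≤ N then qf t N * iqf t k * iqf t (N - k) else 0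

lemma gb_zero (t N : ℕ) (ht : 0 < t) : gb t N 0 = 1 := by
  have h0 : iqf t 0 = 1 := Finset.prod_range_zero _
  rw [gb, if_pos (Nat.zero_le _), Nat.sub_zero, h0, mul_one, qf_mul_iqf t N ht]

lemma gb_gt (t N : ℕ) : gb t N (N + 1) = 0 := by
  simp [gb]

lemma gb_pascal_one (t N k : ℕ) (ht : 0 < t) (hk : k ≤ N) :
    gb t (N + 1) (k + 1) = gb t N k + X ^ (2 * t * (k + 1)) * gb t N (k + 1) := by
  rcases hk.eq_or_lt with rfl | hk
  · rw [gb_gt, gb, gb, if_pos le_rfl, if_pos le_rfl, Nat.sub_self, Nat.sub_self, qf_succ,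
      iqf_eq t k ht]
    ring
  · obtain ⟨d, rfl⟩ := Nat.exists_eq_add_of_lt hk
    rw [gb, gb, gb, if_pos (by omega), if_pos (by omega), if_pos (by omega),
      show k + d + 1 + 1 - (k + 1) = d + 1 by omega, show k + d + 1 - k = d + 1 by omega,
      show k + d + 1 - (k + 1) = d by omega, qf_succ, iqf_eq t k ht, iqf_eq t d ht]
    ring

lemma gb_pascal_two (t N k : ℕ) (ht : 0 < t) (hk : k ≤ N) :
    gb t (N + 1) (k + 1) = X ^ (2 * t * (N - k)) * gb t N k + gb t N (k + 1) := by
  rcases hk.eq_or_lt with rfl | hk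
  · rw [gb_gt, gb, gb, if_pos le_rfl, if_pos le_rfl, Nat.sub_self, Nat.sub_self, qf_succ,
      iqf_eq t k ht]
    ring
  · obtain ⟨d, rfl⟩ := Nat.exists_eq_add_of_lt hk
    rw [gb, gb, gb, if_pos (by omega), if_pos (by omega), if_pos (by omega),
      show k + d + 1 + 1 - (k + 1) = d + 1 by omega, show k + d + 1 - k = d + 1 by omega,
      show k + d + 1 - (k + 1) = d by omega, qf_succ, iqf_eq t k ht, iqf_eq t d ht]
    ring

/-- Theta term. -/
def th (t α : ℕ) (n : ℤ) : ℤ⟦X⟧ := PowerSeries.C (R := ℤ) ((-1) ^ n.natAbs) * X ^ quadExp t α n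

lemma sign_succ (j : ℤ) : (-1 : ℤ) ^ (j + 1).natAbs = - (-1) ^ j.natAbs := by
  rcases le_or_gt 0 j with h | h
  · rw [show (j + 1).natAbs = j.natAbs + 1 by omega, pow_succ]; ring
  · rw [show j.natAbs = (j + 1).natAbs + 1 by omega, pow_succ]; ring

lemma th_up (t α : ℕ) (h1 : 1 ≤ α) (h2 : α + 1 ≤ 2 * t) (m d : ℕ) (j : ℤ) (hd : (d : ℤ) = m - j) :
    th t α (j + 1) * X ^ (2 * t * d) = - (th t α j * X ^ (α + 2 * t * m)) := by
  have e1 := (quadExp_cast t α h1 h2 j).2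
  have e2 := (quadExp_cast t α h1 h2 (j + 1)).2
  have : quadExp t α (j + 1) + 2 * t * d = quadExp t α j + (α + 2 * t * m) := by
    zify
    rw [e1, e2, hd]
    ring
  rw [th, th, mul_assoc (C _), mul_assoc (C _), ← pow_add, ← pow_add, this, sign_succ, map_neg, neg_mul]

lemma th_down (t α β : ℕ) (h1 : 1 ≤ α) (h2 : α + 1 ≤ 2 * t) (hβ : α + β = 2 * t)
    (n d : ℕ) (j : ℤ) (hd : (d : ℤ) = n + j + 1) :
    th t α j * X ^ (2 * t * d) = - (th t α (j + 1) * X ^ (β + 2 * t * n)) := by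
  have e1 := (quadExp_cast t α h1 h2 j).2
  have e2 := (quadExp_cast t α h1 h2 (j + 1)).2
  have : quadExp t α j + 2 * t * d = quadExp t α (j + 1) + (β + 2 * t * n) := by
    have hb : (β : ℤ) = 2 * t - α := by omega
    zify
    rw [e1, e2, hd, hb]
    ring
  rw [th, th, mul_assoc (C _), mul_assoc (C _), ← pow_add, ← pow_add, this, sign_succ, map_neg, neg_mul, neg_neg]

lemma finite_jtp (t α β : ℕ) (h1 : 1 ≤ α) (h2 : α + 1 ≤ 2 * t) (hβ : α + β = 2 * t) (m n : ℕ) :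
    (∏ i ∈ Finset.range m, (1 - X ^ (α + 2 * t * i) : ℤ⟦X⟧)) *
      ∏ i ∈ Finset.range n, (1 - X ^ (β + 2 * t * i)) =
    ∑ k ∈ Finset.range (m + n + 1), gb t (m + n) k * th t α ((k : ℤ) - n) := by
  have ht : 0 < t := by omega
  induction m with
  | zero =>
    rw [Finset.prod_range_zero, one_mul, zero_add]
    induction n with
    | zero => simp [gb, qf, iqf, th, quadExp]
    | succ n ih =>
      rw [Finset.prod_range_succ, ih, Finset.sum_range_succ' _ (n + 1)]
      have e1 : ∀ k ∈ Finset.range (n + 1),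
          gb t (n + 1) (k + 1) * th t α (((k + 1 : ℕ) : ℤ) - (n + 1 : ℕ)) =
          gb t n k * th t α ((k : ℤ) - n) +
            (X ^ (2 * t * (k + 1)) * gb t n (k + 1)) *
              th t α (((k + 1 : ℕ) : ℤ) - (n + 1 : ℕ)) := by
        intro k hk
        rw [Finset.mem_range] at hk
        rw [gb_pascal_one t n k ht (by omega), add_mul]
        congr 3
        push_cast; ring
      rw [Finset.sum_congr rfl e1, Finset.sum_add_distrib, add_assoc]
      have e2 : ∑ k ∈ Finset.range (n + 1), (X ^ (2 * t * (k + 1)) * gb t n (k + 1)) *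
              th t α (((k + 1 : ℕ) : ℤ) - (n + 1 : ℕ)) +
              gb t (n + 1) 0 * th t α (((0 : ℕ) : ℤ) - (n + 1 : ℕ)) =
            ∑ k ∈ Finset.range (n + 1), (X ^ (2 * t * k) * gb t n k) *
              th t α ((k : ℤ) - (n + 1 : ℕ)) := by
        have := Finset.sum_range_succ' (fun k => (X ^ (2 * t * k) * gb t n k) *
              th t α ((k : ℤ) - (n + 1 : ℕ))) (n + 1)
        rw [Finset.sum_range_succ, gb_gt, mul_zero, zero_mul, add_zero] at this
        rw [this, gb_zero _ _ ht, gb_zero _ _ ht]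
        simp
      rw [e2, mul_sub, mul_one, sub_eq_add_neg, Finset.sum_mul, ← Finset.sum_neg_distrib]
      congr 1
      apply Finset.sum_congr rfl
      intro k hk
      have := th_down t α β h1 h2 hβ n k ((k : ℤ) - (n + 1 : ℕ)) (by push_cast; ring)
      rw [show (k : ℤ) - (n + 1 : ℕ) + 1 = k - n by push_cast; ring] at this
      linear_combination - gb t n k * this
  | succ m ih =>
    rw [Finset.prod_range_succ, mul_right_comm, ih, show m + 1 + n = (m + n) + 1 by ring]
    generalize hN : m + n = N
    rw [Finset.sum_range_succ' _ (N + 1)]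
    have e1 : ∀ k ∈ Finset.range (N + 1),
        gb t (N + 1) (k + 1) * th t α (((k + 1 : ℕ) : ℤ) - n) =
        gb t N (k + 1) * th t α (((k + 1 : ℕ) : ℤ) - n) +
          (X ^ (2 * t * (N - k)) * gb t N k) * th t α (((k + 1 : ℕ) : ℤ) - n) := by
      intro k hk
      rw [Finset.mem_range] at hk
      rw [gb_pascal_two t N k ht (by omega), add_mul, add_comm]
    rw [Finset.sum_congr rfl e1, Finset.sum_add_distrib, add_right_comm]
    have e2 : ∑ k ∈ Finset.range (N + 1), gb t N (k + 1) * th t α (((k + 1 : ℕ) : ℤ) - n) +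
            gb t (N + 1) 0 * th t α (((0 : ℕ) : ℤ) - n) =
          ∑ k ∈ Finset.range (N + 1), gb t N k * th t α ((k : ℤ) - n) := by
      have := Finset.sum_range_succ' (fun k => gb t N k * th t α ((k : ℤ) - n)) (N + 1)
      rw [Finset.sum_range_succ, gb_gt, zero_mul, add_zero] at this
      rw [this, gb_zero _ _ ht, gb_zero _ _ ht]
    rw [e2, mul_sub, mul_one, sub_eq_add_neg, Finset.sum_mul, ← Finset.sum_neg_distrib]
    congr 1
    apply Finset.sum_congr rfl
    intro k hk
    rw [Finset.mem_range] at hk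
    have := th_up t α h1 h2 m (N - k) ((k : ℤ) - n) (by omega)
    rw [show (k : ℤ) - n + 1 = (k + 1 : ℕ) - n by push_cast; ring] at this
    linear_combination - gb t N k * this

lemma qf_stable (t D m : ℕ) (ht : 0 < t) (hm : D ≤ m) :
    (X : ℤ⟦X⟧) ^ D ∣ qf t m - qf t D := by
  induction m, hm using Nat.le_induction with
  | base => simp
  | succ m hm ih =>
    rw [qf_succ, show qf t m * (1 - X ^ (2 * t * (m + 1))) - qf t D =
      (qf t m - qf t D) - qf t m * X ^ (2 * t * (m + 1)) by ring]
    refine dvd_sub ih (Dvd.dvd.mul_left (pow_dvd_pow _ ?_) _)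
    nlinarith

lemma iqf_stable (t D m : ℕ) (ht : 0 < t) (hm : D ≤ m) :
    (X : ℤ⟦X⟧) ^ D ∣ iqf t m - iqf t D := by
  have h1 := qf_mul_iqf t m ht
  have h2 := qf_mul_iqf t D ht
  have : iqf t m - iqf t D = (qf t m - qf t D) * (- iqf t m * iqf t D) := by
    linear_combination iqf t D * h1 - iqf t m * h2
  rw [this]
  exact Dvd.dvd.mul_right (qf_stable t D m ht hm) _

lemma gb_stable (t D N k : ℕ) (ht : 0 < t) (h1 : D ≤ k) (h2 : D + k ≤ N) :
    (X : ℤ⟦X⟧) ^ D ∣ qf t D * gb t N k - 1 := by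
  have a1 := qf_stable t D N ht (by omega)
  have a2 := iqf_stable t D k ht h1
  have a3 := iqf_stable t D (N - k) ht (by omega)
  have a4 := qf_mul_iqf t D ht
  rw [gb, if_pos (by omega)]
  have : qf t D * (qf t N * iqf t k * iqf t (N - k)) - 1 =
      (qf t N - qf t D) * (qf t D * iqf t k * iqf t (N - k)) +
      (iqf t k - iqf t D) * (qf t D * qf t D * iqf t (N - k)) +
      (iqf t (N - k) - iqf t D) * (qf t D * qf t D * iqf t D) := by
    linear_combination (qf t D * iqf t D + 1) * a4
  rw [this]
  exact dvd_add (dvd_add (a1.mul_right _) (a2.mul_right _)) (a3.mul_right _)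

lemma jtp_mod (t α β : ℕ) (h1 : 1 ≤ α) (h2 : α + 1 ≤ 2 * t) (hβ : α + β = 2 * t) (D m : ℕ)
    (hm : 2 * D ≤ m) :
    (X : ℤ⟦X⟧) ^ D ∣ (∏ k ∈ Finset.range m, ((1 - X ^ (2 * t * (k + 1))) *
        (1 - X ^ (α + 2 * t * k)) * (1 - X ^ (β + 2 * t * k)))) -
      ∑ k ∈ Finset.range (2 * m + 1), th t α ((k : ℤ) - m) := by
  have ht : 0 < t := by omega
  have hf := finite_jtp t α β h1 h2 hβ m m
  rw [Finset.prod_mul_distrib, Finset.prod_mul_distrib, mul_assoc, hf, ← two_mul]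
  change _ ∣ qf t m * _ - _
  have : qf t m * ∑ k ∈ Finset.range (2 * m + 1), gb t (2 * m) k * th t α ((k : ℤ) - m) -
      ∑ k ∈ Finset.range (2 * m + 1), th t α ((k : ℤ) - m) =
      (qf t m - qf t D) * ∑ k ∈ Finset.range (2 * m + 1), gb t (2 * m) k * th t α ((k : ℤ) - m) +
      ∑ k ∈ Finset.range (2 * m + 1), (qf t D * gb t (2 * m) k - 1) * th t α ((k : ℤ) - m) := by
    simp only [sub_mul, Finset.sum_sub_distrib, one_mul, mul_assoc, ← Finset.mul_sum]
    ring
  rw [this]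
  refine dvd_add ((qf_stable t D m ht (by omega)).mul_right _) (Finset.dvd_sum fun k hk => ?_)
  rw [Finset.mem_range] at hk
  by_cases hc : D ≤ k ∧ D + k ≤ 2 * m
  · exact (gb_stable t D (2 * m) k ht hc.1 hc.2).mul_right _
  · refine Dvd.dvd.mul_left ?_ _
    rw [th]
    refine Dvd.dvd.mul_left (pow_dvd_pow _ ?_) _
    have := (quadExp_cast t α h1 h2 ((k : ℤ) - m)).1
    omega

end PartC
section PartD

open scoped PowerSeries.WithPiTopology
open Filter Topology

lemma summable_of_dvd {ι : Type*} (F : ι → ℤ⟦X⟧) (w : ι → ℕ) (hfin : ∀ d, {i | w i ≤ d}.Finite)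
    (h : ∀ i, X ^ (w i) ∣ F i) : Summable F := by
  rw [PowerSeries.WithPiTopology.summable_iff_summable_coeff]
  intro d
  apply summable_of_hasFiniteSupport
  refine (hfin d).subset ?_
  intro i hi
  by_contra hn
  apply hi
  have := h i
  rw [X_pow_dvd_iff] at this
  apply this
  simpa using hn

lemma multipliable_of_dvd (F : ℕ → ℤ⟦X⟧) (h : ∀ k, X ^ k ∣ F k - 1) : Multipliable F := by
  have : F = fun k => 1 + (F k - 1) := by
    funext k; ring
  rw [this]
  apply PowerSeries.WithPiTopology.multipliable_one_add_of_tendsto_order_atTop_nhds_top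
  rw [ENat.tendsto_nhds_top_iff_natCast_lt]
  intro n
  filter_upwards [eventually_gt_atTop n] with k hk
  refine lt_of_lt_of_le (Nat.cast_lt.2 hk) ?_
  apply PowerSeries.nat_le_order
  intro i hi
  exact X_pow_dvd_iff.1 (h k) i hi

lemma dvd_one_sub (k n : ℕ) (h : k ≤ n) : (X : ℤ⟦X⟧) ^ k ∣ (1 - X ^ n) - 1 := by
  rw [show (1 - X ^ n : ℤ⟦X⟧) - 1 = - X ^ n by ring, dvd_neg]
  exact pow_dvd_pow _ h

lemma dvd_mul_sub (k : ℕ) (a b : ℤ⟦X⟧) (ha : X ^ k ∣ a - 1) (hb : X ^ k ∣ b - 1) :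
    X ^ k ∣ a * b - 1 := by
  rw [show a * b - 1 = (a - 1) * b + (b - 1) by ring]
  exact dvd_add (ha.mul_right _) hb

lemma th_summable (t α : ℕ) (h1 : 1 ≤ α) (h2 : α + 1 ≤ 2 * t) : Summable (th t α) := by
  apply summable_of_dvd _ (fun n : ℤ => n.natAbs)
  · intro d
    apply (Set.finite_Icc (-(d : ℤ)) d).subset
    intro i hi
    simp only [Set.mem_ofPred_eq] at hi
    rw [Set.mem_Icc]
    omega
  · intro n
    exact Dvd.dvd.mul_left (pow_dvd_pow _ (quadExp_cast t α h1 h2 n).1) _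

lemma triple_multipliable (t α β : ℕ) (ht : 0 < t) :
    Multipliable fun k : ℕ => ((1 - X ^ (2 * t * (k + 1))) *
        (1 - X ^ (α + 2 * t * k)) * (1 - X ^ (β + 2 * t * k)) : ℤ⟦X⟧) := by
  apply multipliable_of_dvd
  intro k
  refine dvd_mul_sub _ _ _ (dvd_mul_sub _ _ _ ?_ ?_) ?_ <;> apply dvd_one_sub <;> nlinarith

lemma jtp (t α β : ℕ) (h1 : 1 ≤ α) (h2 : α + 1 ≤ 2 * t) (hβ : α + β = 2 * t) :
    ∑' n : ℤ, th t α n = ∏' k : ℕ, ((1 - X ^ (2 * t * (k + 1))) *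
        (1 - X ^ (α + 2 * t * k)) * (1 - X ^ (β + 2 * t * k)) : ℤ⟦X⟧) := by
  have l1 := (triple_multipliable t α β (by omega)).hasProd.tendsto_prod_nat
  have l2 := (th_summable t α h1 h2).hasSum.comp (Finset.tendsto_Icc_neg (R := ℤ))
  have l3 : Tendsto (fun m : ℕ => (∏ k ∈ Finset.range m, ((1 - X ^ (2 * t * (k + 1))) *
        (1 - X ^ (α + 2 * t * k)) * (1 - X ^ (β + 2 * t * k)) : ℤ⟦X⟧)) -
      ∑ n ∈ Finset.Icc (-(m : ℤ)) m, th t α n) atTop (𝓝 0) := by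
    rw [PowerSeries.WithPiTopology.tendsto_iff_coeff_tendsto]
    intro d
    apply tendsto_atTop_of_eventually_const (i₀ := 2 * (d + 1))
    intro m hm
    have e : ∑ n ∈ Finset.Icc (-(m : ℤ)) m, th t α n =
        ∑ k ∈ Finset.range (2 * m + 1), th t α ((k : ℤ) - m) := by
      symm
      apply Finset.sum_nbij (fun k : ℕ => (k : ℤ) - m)
      · intro k hk
        rw [Finset.mem_range] at hk
        rw [Finset.mem_Icc]
        omega
      · intro a _ b _ hab
        simp only at hab
        omega
      · intro z hz
        rw [Finset.mem_coe, Finset.mem_Icc] at hz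
        refine ⟨(z + m).toNat, ?_, ?_⟩
        · rw [Finset.mem_coe, Finset.mem_range]
          omega
        · simp only
          omega
      · intros; rfl
    rw [e]
    have := jtp_mod t α β h1 h2 hβ (d + 1) m hm
    rw [X_pow_dvd_iff] at this
    rw [this d (by omega), map_zero]
  have l4 := l1.sub l2
  have := tendsto_nhds_unique l3 l4
  exact (sub_eq_zero.1 this.symm).symm

lemma pi_summable (n : ℕ) (f : Fin n → ℤ → ℤ⟦X⟧) (hf : ∀ r z, X ^ z.natAbs ∣ f r z) :
    Summable fun z : Fin n → ℤ => ∏ r, f r (z r) := by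
  apply summable_of_dvd _ (fun z : Fin n → ℤ => ∑ r, (z r).natAbs)
  · intro d
    apply (Set.finite_Icc (fun _ : Fin n => -(d : ℤ)) (fun _ => (d : ℤ))).subset
    intro z hz
    simp only [Set.mem_ofPred_eq] at hz
    have : ∀ r, (z r).natAbs ≤ d := fun r =>
      (Finset.single_le_sum (f := fun r => (z r).natAbs) (fun _ _ => Nat.zero_le _)
        (Finset.mem_univ r)).trans hz
    rw [Set.mem_Icc]
    constructor <;> intro r <;> have := this r <;> simp only <;> omega
  · intro z
    rw [← Finset.prod_pow_eq_pow_sum]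
    exact Finset.prod_dvd_prod_of_dvd _ _ fun r _ => hf r _

lemma pi_hasSum (n : ℕ) (f : Fin n → ℤ → ℤ⟦X⟧) (hf : ∀ r z, X ^ z.natAbs ∣ f r z)
    (hs : ∀ r, Summable (f r)) :
    HasSum (fun z : Fin n → ℤ => ∏ r, f r (z r)) (∏ r, ∑' z, f r z) := by
  induction n with
  | zero =>
    simp only [Finset.univ_eq_empty, Finset.prod_empty]
    exact hasSum_unique _
  | succ n ih =>
    have ih' := ih (fun r => f r.succ) (fun r => hf r.succ) (fun r => hs r.succ)
    have e : (fun z : Fin (n + 1) → ℤ => ∏ r, f r (z r)) ∘ (Fin.consEquiv fun _ => ℤ) =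
        fun x : ℤ × (Fin n → ℤ) => f 0 x.1 * ∏ r : Fin n, f r.succ (x.2 r) := by
      funext x
      simp [Fin.prod_univ_succ, Fin.consEquiv]
    rw [← (Fin.consEquiv fun _ : Fin (n + 1) => ℤ).hasSum_iff, e, Fin.prod_univ_succ]
    apply (hs 0).hasSum.mul ih'
    rw [← e, (Fin.consEquiv fun _ : Fin (n + 1) => ℤ).summable_iff]
    exact pi_summable (n + 1) f hf

lemma inv_dvd (k n : ℕ) (hn : 0 < n) (h : k ≤ n) :
    (X : ℤ⟦X⟧) ^ k ∣ PowerSeries.invOfUnit (1 - X ^ n) 1 - 1 := by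
  have h1 := one_sub_mul_inv n hn
  rw [show PowerSeries.invOfUnit (1 - X ^ n : ℤ⟦X⟧) 1 - 1 =
    X ^ n * PowerSeries.invOfUnit (1 - X ^ n) 1 by linear_combination h1]
  exact (pow_dvd_pow _ h).mul_right _

lemma odd_prod : ∏' k : ℕ, (1 - X ^ (2 * k + 1) : ℤ⟦X⟧) =
    ∏' k : ℕ, ((1 - X ^ (k + 1)) * PowerSeries.invOfUnit (1 - X ^ (2 * (k + 1))) 1) := by
  have m1 : Multipliable fun k : ℕ => (1 - X ^ (2 * k + 1) : ℤ⟦X⟧) :=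
    multipliable_of_dvd _ fun k => dvd_one_sub _ _ (by omega)
  have m2 : Multipliable fun k : ℕ => (1 - X ^ (2 * k + 1 + 1) : ℤ⟦X⟧) :=
    multipliable_of_dvd _ fun k => dvd_one_sub _ _ (by omega)
  have m3 : Multipliable fun k : ℕ => (1 - X ^ (k + 1) : ℤ⟦X⟧) :=
    multipliable_of_dvd _ fun k => dvd_one_sub _ _ (by omega)
  have m4 : Multipliable fun k : ℕ => PowerSeries.invOfUnit (1 - X ^ (2 * (k + 1)) : ℤ⟦X⟧) 1 :=
    multipliable_of_dvd _ fun k => inv_dvd _ _ (by omega) (by omega)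
  rw [m3.tprod_mul m4, ← tprod_even_mul_odd (f := fun k => (1 - X ^ (k + 1) : ℤ⟦X⟧)) m1 m2,
    mul_assoc, ← m2.tprod_mul m4]
  have : ∀ k : ℕ, (1 - X ^ (2 * k + 1 + 1) : ℤ⟦X⟧) *
      PowerSeries.invOfUnit (1 - X ^ (2 * (k + 1))) 1 = 1 := fun k => by
    rw [show 2 * k + 1 + 1 = 2 * (k + 1) by ring]
    exact one_sub_mul_inv _ (by omega)
  simp only [this, tprod_one, mul_one]

lemma block_prod (s : ℕ) (hs : 0 < s) :
    ∏' k : ℕ, ∏ i ∈ Finset.range s, (1 - X ^ (2 * (s * k + i) + 1) : ℤ⟦X⟧) =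
    ∏' k : ℕ, (1 - X ^ (2 * k + 1) : ℤ⟦X⟧) := by
  have m1 : Multipliable fun k : ℕ => (1 - X ^ (2 * k + 1) : ℤ⟦X⟧) :=
    multipliable_of_dvd _ fun k => dvd_one_sub _ _ (by omega)
  have m2 : Multipliable fun k : ℕ =>
      ∏ i ∈ Finset.range s, (1 - X ^ (2 * (s * k + i) + 1) : ℤ⟦X⟧) := by
    apply multipliable_prod
    intro i _
    exact multipliable_of_dvd _ fun k => dvd_one_sub _ _ (by nlinarith)
  have l1 := m1.hasProd.tendsto_prod_nat.comp (tendsto_id.const_mul_atTop' hs)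
  refine tendsto_nhds_unique m2.hasProd.tendsto_prod_nat (l1.congr ?_)
  intro M
  simp only [Function.comp, id]
  induction M with
  | zero => simp
  | succ M ih => rw [Finset.prod_range_succ, ← ih, Nat.mul_succ, Finset.prod_range_add]

lemma block_split (t' k : ℕ) :
    ∏ i ∈ Finset.range (2 * t'), (1 - X ^ (2 * (2 * t' * k + i) + 1) : ℤ⟦X⟧) =
    ∏ r : Fin t', ((1 - X ^ ((2 * (r : ℕ) + 1) + 2 * (2 * t') * k)) *
      (1 - X ^ ((4 * t' - (2 * (r : ℕ) + 1)) + 2 * (2 * t') * k))) := by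
  rw [Finset.prod_mul_distrib,
    Fin.prod_univ_eq_prod_range (fun r => (1 - X ^ ((2 * r + 1) + 2 * (2 * t') * k) : ℤ⟦X⟧)) t',
    Fin.prod_univ_eq_prod_range
      (fun r => (1 - X ^ ((4 * t' - (2 * r + 1)) + 2 * (2 * t') * k) : ℤ⟦X⟧)) t',
    two_mul t', Finset.prod_range_add]
  congr 1
  · apply Finset.prod_congr rfl
    intro i _
    congr 2
    ring
  · rw [← Finset.prod_range_reflect]
    apply Finset.prod_congr rfl
    intro i hi
    rw [Finset.mem_range] at hi
    congr 2
    rw [show 4 * t' - (2 * i + 1) = 2 * (t' + (t' - 1 - i)) + 1 by omega]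
    ring

theorem main_aux (t' : ℕ) (ht' : 0 < t') :
    ∑' μ : {μ : YoungDiagram // μ.transpose = μ ∧
        ∀ c ∈ μ.cells, ¬ (2 * t') ∣ hookLen μ c},
      PowerSeries.C (R := ℤ) ((-1) ^ durfee μ.1) * X ^ μ.1.card
      =
    ∏' k : ℕ,
      ((1 - X ^ (k + 1)) * PowerSeries.invOfUnit (1 - X ^ (2 * (k + 1))) 1 *
        (1 - X ^ (2 * (k + 1) * (2 * t'))) ^ t') := by
  rw [← (coreEquiv t' ht').tsum_eq]
  simp only [coreEquiv_term]
  have hS : ∀ r : Fin t', Summable (th (2 * t') (2 * (r : ℕ) + 1)) := fun r =>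
    th_summable _ _ (by omega) (by omega)
  have h := pi_hasSum t' (fun r => th (2 * t') (2 * (r : ℕ) + 1)) (fun r z =>
    Dvd.dvd.mul_left (pow_dvd_pow _
      (quadExp_cast (2 * t') (2 * (r : ℕ) + 1) (by omega) (by omega) z).1) _) hS
  refine h.tsum_eq.trans ?_
  have hj : ∀ r : Fin t', _ := fun r => jtp (2 * t') (2 * (r : ℕ) + 1) (4 * t' - (2 * (r : ℕ) + 1))
    (by omega) (by omega) (by omega)
  simp only [hj]
  rw [← Multipliable.tprod_finsetProd (fun r _ => triple_multipliable _ _ _ (by omega))]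
  have mq : Multipliable fun k : ℕ => (1 - X ^ (2 * (k + 1) * (2 * t')) : ℤ⟦X⟧) ^ t' := by
    apply Multipliable.pow
    exact multipliable_of_dvd _ fun k => dvd_one_sub _ _ (by nlinarith)
  have mb : Multipliable fun k : ℕ =>
      ∏ i ∈ Finset.range (2 * t'), (1 - X ^ (2 * (2 * t' * k + i) + 1) : ℤ⟦X⟧) := by
    apply multipliable_prod
    intro i _
    exact multipliable_of_dvd _ fun k => dvd_one_sub _ _ (by nlinarith)
  have mo : Multipliable fun k : ℕ => ((1 - X ^ (k + 1) : ℤ⟦X⟧) *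
      PowerSeries.invOfUnit (1 - X ^ (2 * (k + 1))) 1) :=
    multipliable_of_dvd _ fun k => dvd_mul_sub _ _ _ (dvd_one_sub _ _ (by omega))
      (inv_dvd _ _ (by omega) (by omega))
  rw [mo.tprod_mul mq, ← odd_prod, ← block_prod (2 * t') (by omega), ← mb.tprod_mul mq]
  congr 1
  funext k
  rw [block_split]
  simp only [mul_assoc (1 - X ^ (2 * (2 * t') * (k + 1)) : ℤ⟦X⟧)]
  rw [Finset.prod_mul_distrib, Finset.prod_const, Finset.card_univ, Fintype.card_fin, mul_comm,
    show 2 * (2 * t') * (k + 1) = 2 * (k + 1) * (2 * t') by ring]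

end PartD

theorem signed_genfun_SC_cores_even (t' : ℕ) (ht' : 0 < t') :
    ∑' μ : {μ : YoungDiagram // μ.transpose = μ ∧
        ∀ c ∈ μ.cells, ¬ (2 * t') ∣ hookLen μ c},
      PowerSeries.C (R := ℤ) ((-1) ^ durfee μ.1) * X ^ μ.1.card
      =
    ∏' k : ℕ,
      ((1 - X ^ (k + 1)) * PowerSeries.invOfUnit (1 - X ^ (2 * (k + 1))) 1 *
        (1 - X ^ (2 * (k + 1) * (2 * t'))) ^ t') := by
  exact main_aux t' ht'
end
end

section
/- Let t = 2t'+1 be an odd positive integer. The signed generating function of self-conjugate t-cores satisfies: Σ_{λ ∈ SC_{(t)}} δ_λ x^{|λ|} = ∏_{k≥1} [(1-x^k)/(1-x^{2k})] · (1-x^{2kt})^{t'} · [(1-x^{2kt})/(1-x^{kt})]. -/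
/-!
Statement 9 (Lemma `fungensign`, odd case): for `t = 2t'+1` an odd positive
integer, the signed generating function of self-conjugate `t`-cores satisfies
Σ_{λ ∈ SC_{(t)}} δ_λ x^{|λ|}
  = ∏_{k≥1} [(1-x^k)/(1-x^{2k})] · (1-x^{2kt})^{t'} · [(1-x^{2kt})/(1-x^{kt})],
as a formal power series over ℤ.
-/

noncomputable section

open PowerSeries

namespace SCC
section Jacobi
open Finset

/-- The finite product `∏_{k=1}^{M} (1 - x^{ck})`. -/
def qp (c M : ℕ) : ℤ⟦X⟧ := ∏ k ∈ range M, (1 - X ^ (c * (k + 1)))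

/-- Gaussian binomial coefficients. -/
def gb (Q : ℤ⟦X⟧) : ℕ → ℕ → ℤ⟦X⟧
  | _, 0 => 1
  | 0, _ + 1 => 0
  | M + 1, k + 1 => gb Q M k + Q ^ (k + 1) * gb Q M (k + 1)

lemma gb_zero_right (Q : ℤ⟦X⟧) (M : ℕ) : gb Q M 0 = 1 := by cases M <;> simp [gb]

lemma gb_eq_zero (Q : ℤ⟦X⟧) (M : ℕ) : ∀ k, M < k → gb Q M k = 0 := by
  induction M with
  | zero => intro k hk; cases k with
    | zero => omega
    | succ k => simp [gb]
  | succ M ih => intro k hk; cases k with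
    | zero => omega
    | succ k => simp [gb, ih k (by omega), ih (k+1) (by omega)]

lemma gb_self (Q : ℤ⟦X⟧) (M : ℕ) : gb Q M M = 1 := by
  induction M with
  | zero => simp [gb]
  | succ M ih => simp [gb, ih, gb_eq_zero Q M (M+1) (by omega)]

lemma choose_two_succ (k : ℕ) : (k+1).choose 2 = k.choose 2 + k := by
  rw [Nat.choose_succ_succ' k 1]; simp; omega

lemma qbinom (Q u : ℤ⟦X⟧) (M : ℕ) : ∀ v : ℤ⟦X⟧,
    ∏ k ∈ range M, (u + Q ^ k * v) =
      ∑ k ∈ range (M + 1), Q ^ (k.choose 2) * gb Q M k * v ^ k * u ^ (M - k) := by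
  induction M with
  | zero => intro v; simp [gb]
  | succ M ih =>
    intro v
    rw [prod_range_succ']
    have h1 : ∏ k ∈ range M, (u + Q ^ (k+1) * v) = ∏ k ∈ range M, (u + Q ^ k * (Q * v)) := by
      apply prod_congr rfl; intros; ring
    rw [h1, ih, sum_range_succ' _ (M+1)]
    have h2 : ∀ k ∈ range (M+1), Q ^ ((k+1).choose 2) * gb Q (M+1) (k+1) * v ^ (k+1) * u ^ (M + 1 - (k+1))
      = (Q ^ (k.choose 2) * gb Q M k * (Q * v) ^ k * u ^ (M - k)) * v +
        Q ^ ((k+1).choose 2) * gb Q M (k+1) * (Q * v) ^ (k+1) * u ^ (M - k) := by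
      intro k _
      rw [choose_two_succ, Nat.add_sub_add_right, gb]
      ring
    rw [sum_congr rfl h2, sum_add_distrib, ← sum_mul]
    have h3 : (∑ k ∈ range (M + 1), Q ^ k.choose 2 * gb Q M k * (Q * v) ^ k * u ^ (M - k)) * u
       = ∑ k ∈ range M, Q ^ (k + 1).choose 2 * gb Q M (k + 1) * (Q * v) ^ (k + 1) * u ^ (M - k)
        + u ^ (M + 1) := by
      rw [sum_range_succ', add_mul, sum_mul]
      congr 1
      · apply sum_congr rfl
        intro k hk
        rw [mem_range] at hk
        rw [show M - k = M - (k+1) + 1 by omega, pow_succ u]; ring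
      · simp [gb_zero_right, pow_succ]
    rw [pow_zero, one_mul, mul_add, h3]
    rw [sum_range_succ (fun k => Q ^ (k + 1).choose 2 * gb Q M (k + 1) * (Q * v) ^ (k + 1) * u ^ (M - k)) M,
      gb_eq_zero Q M (M+1) (by omega), gb_zero_right]
    simp
    ring

lemma gb_formula (c : ℕ) (i j : ℕ) :
    gb (X ^ c) (i + j) i * qp c i * qp c j = qp c (i + j) := by
  induction hn : i + j generalizing i j with
  | zero =>
    obtain ⟨rfl, rfl⟩ : i = 0 ∧ j = 0 := by omega
    simp [gb, qp]
  | succ n ih =>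
    rcases i with _ | i
    · simp only [zero_add] at hn; subst hn; simp [gb, qp]
    rcases j with _ | j
    · simp only [add_zero] at hn; rw [← hn, gb_self]; simp [qp]
    have e1 := ih i (j+1) (by omega)
    have e2 := ih (i+1) j (by omega)
    obtain rfl : n = i + j + 1 := by omega
    rw [gb]
    have q1 : ∀ m, qp c (m+1) = qp c m * (1 - X ^ (c * (m+1))) := fun m => by
      simp [qp, prod_range_succ]
    rw [q1 (i+j+1)]
    have : (gb (X ^ c) (i + j + 1) i + (X ^ c) ^ (i + 1) * gb (X ^ c) (i + j + 1) (i + 1))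
       * qp c (i+1) * qp c (j+1) =
       (gb (X ^ c) (i + j + 1) i * qp c i * qp c (j+1)) * (1 - X ^ (c * (i+1)))
       + (X ^ c) ^ (i + 1) * (gb (X ^ c) (i + j + 1) (i + 1) * qp c (i+1) * qp c j) *
         (1 - X ^ (c * (j+1))) := by
      rw [q1 i, q1 j]; ring
    rw [this, e1, e2]; ring

/-- The theta exponent `t n (n-1) + a n`. -/
def ex (t a : ℕ) (n : ℤ) : ℕ := (t * (n * (n - 1)) + a * n).toNat

lemma ex_ge (t a b : ℕ) (ha : 1 ≤ a) (hb : 1 ≤ b) (h : a + b = 2 * t) (n : ℤ) :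
    |n| ≤ t * (n * (n - 1)) + a * n := by
  have h' : (a:ℤ) + b = 2 * t := by exact_mod_cast h
  have ha' : (1:ℤ) ≤ a := by exact_mod_cast ha
  have hb' : (1:ℤ) ≤ b := by exact_mod_cast hb
  rcases lt_trichotomy n 0 with hn | hn | hn
  · rw [abs_of_neg hn]
    obtain ⟨m, rfl⟩ : ∃ m : ℤ, n = -(m+1) := ⟨-n-1, by ring⟩
    have hm : 0 ≤ m := by omega
    have : (t:ℤ) * (-(m+1) * (-(m+1) - 1)) + a * -(m+1) = t * ((m+1) * m) + b * (m+1) := by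
      linear_combination (-m-1) * h'
    rw [this]
    have : 0 ≤ (t:ℤ) * ((m+1) * m) := by positivity
    nlinarith
  · subst hn; simp
  · rw [abs_of_pos hn]
    have : 0 ≤ (t:ℤ) * (n * (n-1)) := by
      apply mul_nonneg (by positivity); apply mul_nonneg <;> omega
    nlinarith

lemma ex_cast (t a b : ℕ) (ha : 1 ≤ a) (hb : 1 ≤ b) (h : a + b = 2 * t) (n : ℤ) :
    (ex t a n : ℤ) = t * (n * (n - 1)) + a * n :=
  Int.toNat_of_nonneg ((abs_nonneg n).trans (ex_ge t a b ha hb h n))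

lemma natAbs_le_ex (t a b : ℕ) (ha : 1 ≤ a) (hb : 1 ≤ b) (h : a + b = 2 * t) (n : ℤ) :
    n.natAbs ≤ ex t a n := by
  have := ex_ge t a b ha hb h n
  rw [← ex_cast t a b ha hb h, Int.abs_eq_natAbs] at this
  exact_mod_cast this

/-- The finite product in the triple product identity. -/
def PP (t a b N : ℕ) : ℤ⟦X⟧ :=
  ∏ k ∈ range N, ((1 - X ^ (2 * t * k + a)) * (1 - X ^ (2 * t * k + b)))

lemma choose_two_cast (k : ℕ) : (2 : ℤ) * (k.choose 2 : ℕ) = k * (k - 1) := by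
  induction k with
  | zero => simp
  | succ k ih => rw [choose_two_succ]; push_cast; linarith

lemma finite_jtp (t a b : ℕ) (ha : 1 ≤ a) (hb : 1 ≤ b) (h : a + b = 2 * t) (N : ℕ) :
    PP t a b N = ∑ k ∈ range (2 * N + 1),
      (-1) ^ (k + N) * X ^ (ex t a ((k:ℤ) - N)) * gb (X ^ (2 * t)) (2 * N) k := by
  have key := qbinom (X ^ (2*t)) (X ^ (2 * t * N)) (2 * N) (- X ^ a)
  have hprod : ∏ k ∈ range (2 * N), ((X:ℤ⟦X⟧) ^ (2 * t * N) + (X ^ (2*t)) ^ k * (- X ^ a)) =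
      (-1) ^ N * X ^ (2 * t * N * N + 2 * t * N.choose 2 + a * N) * PP t a b N := by
    rw [two_mul N, prod_range_add]
    have h1 : ∏ k ∈ range N, ((X:ℤ⟦X⟧) ^ (2 * t * N) + (X ^ (2*t)) ^ (N + k) * (- X ^ a)) =
       X ^ (2 * t * N * N) * ∏ k ∈ range N, (1 - X ^ (2 * t * k + a)) := by
      have h0 : (X:ℤ⟦X⟧) ^ (2 * t * N * N) = ∏ k ∈ range N, X ^ (2 * t * N) := by
        rw [prod_const, Finset.card_range, pow_mul]
      rw [h0, ← prod_mul_distrib]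
      apply prod_congr rfl; intro k _; ring
    have h2 : ∏ k ∈ range N, ((X:ℤ⟦X⟧) ^ (2 * t * N) + (X ^ (2*t)) ^ k * (- X ^ a)) =
       (-1) ^ N * X ^ (2 * t * N.choose 2 + a * N) * ∏ k ∈ range N, (1 - X ^ (2 * t * k + b)) := by
      have h3 : ∏ k ∈ range N, (1 - (X:ℤ⟦X⟧) ^ (2 * t * k + b))
         = ∏ k ∈ range N, (1 - (X:ℤ⟦X⟧) ^ (2 * t * (N - 1 - k) + b)) :=
        (prod_range_reflect (fun k => 1 - (X:ℤ⟦X⟧) ^ (2 * t * k + b)) N).symm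
      have h4 : ∀ M : ℕ, (-1) ^ M * (X:ℤ⟦X⟧) ^ (2 * t * M.choose 2 + a * M) =
          ∏ k ∈ range M, (-(X ^ (2 * t * k + a))) := by
        intro M
        induction M with
        | zero => simp
        | succ M ih => rw [prod_range_succ, ← ih, choose_two_succ]; ring
      rw [h3, h4, ← prod_mul_distrib]
      apply prod_congr rfl
      intro k hk
      rw [mem_range] at hk
      obtain ⟨m, rfl⟩ : ∃ m, N = k + 1 + m := ⟨N - (k+1), by omega⟩
      rw [show k + 1 + m - 1 - k = m by omega]
      rw [mul_sub, mul_one, neg_mul, ← pow_add, ← pow_mul,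
        show 2 * t * k + a + (2 * t * m + b) = 2 * t * (k + 1 + m) by rw [← h]; ring]
      ring
    rw [h1, h2, PP, prod_mul_distrib]
    ring
  rw [hprod] at key
  have hne : (-1) ^ N * (X:ℤ⟦X⟧) ^ (2 * t * N * N + 2 * t * N.choose 2 + a * N) ≠ 0 := by
    apply mul_ne_zero
    · exact pow_ne_zero _ (by simp)
    · exact pow_ne_zero _ X_ne_zero
  apply mul_left_cancel₀ hne
  rw [key, mul_sum]
  apply sum_congr rfl
  intro k hk
  rw [mem_range] at hk
  have he : 2 * t * N * N + 2 * t * N.choose 2 + a * N + ex t a ((k:ℤ) - N) =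
     2 * t * k.choose 2 + a * k + 2 * t * N * (2 * N - k) := by
    zify [show k ≤ 2 * N by omega]
    rw [ex_cast t a b ha hb h]
    have e1 := choose_two_cast N
    have e2 := choose_two_cast k
    linear_combination t * e1 - t * e2
  have hs : ((-1:ℤ⟦X⟧)) ^ N * (-1) ^ (k + N) = (-1) ^ k := by
    rw [← pow_add, show N + (k + N) = k + 2 * N by ring, pow_add, pow_mul]; simp
  calc (X ^ (2 * t)) ^ k.choose 2 * gb (X ^ (2 * t)) (2 * N) k * (-X ^ a) ^ k * (X ^ (2 * t * N)) ^ (2 * N - k)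
     = (-1) ^ k * X ^ (2 * t * k.choose 2 + a * k + 2 * t * N * (2 * N - k)) * gb (X ^ (2 * t)) (2 * N) k := by
        rw [neg_pow (X ^ a)]; ring
    _ = _ := by rw [← he, ← hs]; ring

lemma qp_const (c M : ℕ) (hc : 1 ≤ c) : IsUnit (qp c M) := by
  rw [PowerSeries.isUnit_iff_constantCoeff, qp, map_prod]
  rw [prod_eq_one]
  · exact isUnit_one
  · intro k _
    have : c * (k+1) ≠ 0 := by positivity
    simp [this]

lemma qp_congr (c m M : ℕ) (h : m ≤ M) : (X:ℤ⟦X⟧) ^ (c * (m + 1)) ∣ qp c M - qp c m := by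
  induction M, h using Nat.le_induction with
  | base => simp
  | succ M hM ih =>
    have : qp c (M+1) - qp c m = (qp c M - qp c m) - qp c M * X ^ (c * (M+1)) := by
      rw [qp, prod_range_succ, ← qp]; ring
    rw [this]
    exact dvd_sub ih (Dvd.dvd.mul_left (pow_dvd_pow _ (by gcongr)) _)

lemma gb_congr (c N k m : ℕ) (hc : 1 ≤ c) (hk : k ≤ 2 * N) (hm : m ≤ N) (hm1 : m ≤ k) (hm2 : m ≤ 2 * N - k) :
    (X:ℤ⟦X⟧) ^ (c * (m + 1)) ∣ qp c N * gb (X ^ c) (2 * N) k - 1 := by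
  rw [← Ideal.mem_span_singleton, ← Ideal.Quotient.eq]
  set π := Ideal.Quotient.mk (Ideal.span {(X:ℤ⟦X⟧) ^ (c * (m + 1))}) with hπ
  have hq : ∀ M, m ≤ M → π (qp c M) = π (qp c m) := by
    intro M hM
    rw [hπ, Ideal.Quotient.eq, Ideal.mem_span_singleton]
    exact qp_congr c m M hM
  have hu : IsUnit (π (qp c m)) := (qp_const c m hc).map π
  have hf := congrArg π (gb_formula c k (2 * N - k))
  rw [show k + (2 * N - k) = 2 * N by omega] at hf
  rw [map_mul, map_mul, hq _ hm1, hq _ hm2, hq (2*N) (by omega)] at hf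
  rw [map_mul, hq _ hm, map_one]
  apply hu.mul_left_cancel
  linear_combination hf

lemma jtp_congr (t a b : ℕ) (ha : 1 ≤ a) (hb : 1 ≤ b) (h : a + b = 2 * t) (N : ℕ) :
    (X:ℤ⟦X⟧) ^ (N + 1) ∣ qp (2 * t) N * PP t a b N - ∑ k ∈ range (2 * N + 1),
      (-1) ^ (k + N) * X ^ (ex t a ((k:ℤ) - N)) := by
  rw [finite_jtp t a b ha hb h, mul_sum, ← sum_sub_distrib]
  apply dvd_sum
  intro k hk
  rw [mem_range] at hk
  have : qp (2 * t) N * ((-1) ^ (k + N) * X ^ ex t a (↑k - ↑N) * gb (X ^ (2 * t)) (2 * N) k) -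
      (-1) ^ (k + N) * X ^ ex t a (↑k - ↑N) =
      (-1) ^ (k+N) * (X ^ ex t a (↑k - ↑N) * (qp (2 * t) N * gb (X ^ (2 * t)) (2 * N) k - 1)) := by
    ring
  rw [this]
  apply Dvd.dvd.mul_left
  set m := N - ((k:ℤ) - N).natAbs with hm
  have h1 := gb_congr (2 * t) N k m (by omega) (by omega) (by omega) (by omega) (by omega)
  have h2 := natAbs_le_ex t a b ha hb h ((k:ℤ) - N)
  refine dvd_trans ?_ (mul_dvd_mul_left _ h1)
  rw [← pow_add]
  apply pow_dvd_pow
  have : m + 1 ≤ 2 * t * (m+1) := Nat.le_mul_of_pos_left _ (by omega)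
  omega

end Jacobi
section Products
open Finset
open scoped PowerSeries.WithPiTopology

lemma mult_of_dvd (f : ℕ → ℤ⟦X⟧) (h : ∀ k, X ^ k ∣ f k - 1) : Multipliable f := by
  have h1 := PowerSeries.WithPiTopology.multipliable_one_add_of_tendsto_order_atTop_nhds_top
    (R := ℤ) (f := fun k => f k - 1) (by
      refine ENat.tendsto_nhds_top_iff_natCast_lt.mpr
        (fun n ↦ Filter.eventually_atTop.mpr ⟨n+1, ?_⟩)
      intro m hm
      have := PowerSeries.nat_le_order _ m (PowerSeries.X_pow_dvd_iff.1 (h m))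
      refine lt_of_lt_of_le ?_ this
      exact_mod_cast hm)
  simpa using h1

lemma dvd_mul_sub_one {d f g : ℤ⟦X⟧} (hf : d ∣ f - 1) (hg : d ∣ g - 1) : d ∣ f * g - 1 := by
  have : f * g - 1 = (f - 1) * g + (g - 1) := by ring
  rw [this]
  exact dvd_add (Dvd.dvd.mul_right hf _) hg

lemma dvd_one_sub {k m : ℕ} (h : k ≤ m) : (X:ℤ⟦X⟧) ^ k ∣ (1 - X ^ m) - 1 := by
  have : (1 - (X:ℤ⟦X⟧) ^ m) - 1 = - X ^ m := by ring
  rw [this]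
  exact (dvd_neg).2 (pow_dvd_pow _ h)

lemma mul_inv_one_sub (m : ℕ) (hm : m ≠ 0) :
    (1 - (X:ℤ⟦X⟧) ^ m) * PowerSeries.invOfUnit (1 - X ^ m) 1 = 1 := by
  apply PowerSeries.mul_invOfUnit
  simp [hm]

lemma dvd_inv_one_sub {k m : ℕ} (h : k ≤ m) (hm : m ≠ 0) :
    (X:ℤ⟦X⟧) ^ k ∣ PowerSeries.invOfUnit (1 - X ^ m) 1 - 1 := by
  have h1 := mul_inv_one_sub m hm
  have : PowerSeries.invOfUnit (1 - (X:ℤ⟦X⟧) ^ m) 1 - 1 =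
    X ^ m * PowerSeries.invOfUnit (1 - (X:ℤ⟦X⟧) ^ m) 1 := by linear_combination h1
  rw [this]
  exact Dvd.dvd.mul_right (pow_dvd_pow _ h) _

lemma dvd_prod_sub_one {ι : Type*} {d : ℤ⟦X⟧} (s : Finset ι) (f : ι → ℤ⟦X⟧)
    (h : ∀ i ∈ s, d ∣ f i - 1) : d ∣ ∏ i ∈ s, f i - 1 := by
  classical
  induction s using Finset.induction_on with
  | empty => simp
  | insert a s ha ih =>
    rw [prod_insert ha]
    exact dvd_mul_sub_one (h a (by simp)) (ih fun i hi => h i (by simp [hi]))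

/-- The `k`-th factor of the triple product. -/
def TT (t a b k : ℕ) : ℤ⟦X⟧ :=
  (1 - X ^ (2 * t * (k + 1))) * ((1 - X ^ (2 * t * k + a)) * (1 - X ^ (2 * t * k + b)))

lemma le_two_t (t k a : ℕ) (ht : 1 ≤ t) : k ≤ 2 * t * k + a := by nlinarith

lemma TT_mult (t a b : ℕ) (ht : 1 ≤ t) : Multipliable (TT t a b) := by
  apply mult_of_dvd
  intro k
  refine dvd_mul_sub_one (dvd_one_sub ?_) (dvd_mul_sub_one (dvd_one_sub ?_) (dvd_one_sub ?_))
  · nlinarith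
  · exact le_two_t _ _ _ ht
  · exact le_two_t _ _ _ ht

/-- The theta term. -/
def th (t a : ℕ) (n : ℤ) : ℤ⟦X⟧ := PowerSeries.C ((-1) ^ n.natAbs) * X ^ ex t a n

lemma sum_reindex (t a N : ℕ) : ∑ k ∈ range (2 * N + 1),
      (-1) ^ (k + N) * (X:ℤ⟦X⟧) ^ (ex t a ((k:ℤ) - N)) = ∑ n ∈ Icc (-(N:ℤ)) N, th t a n := by
  refine sum_bij (fun k _ => (k:ℤ) - N) ?_ ?_ ?_ ?_
  · intro k hk; rw [mem_range] at hk; rw [mem_Icc]; omega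
  · intro k _ l _ h; simpa using h
  · intro n hn; rw [mem_Icc] at hn
    exact ⟨(n + N).toNat, by rw [mem_range]; omega, by omega⟩
  · intro k _
    rw [th]
    congr 1
    rw [map_pow]
    simp only [map_neg, map_one]
    apply neg_one_pow_congr
    grind

lemma jtp (t a b : ℕ) (ha : 1 ≤ a) (hb : 1 ≤ b) (h : a + b = 2 * t) :
    HasSum (th t a) (∏' k, TT t a b k) := by
  rw [PowerSeries.WithPiTopology.hasSum_iff_hasSum_coeff]
  intro d
  have hz : ∀ n ∉ Icc (-(d:ℤ)) d, coeff d (th t a n) = 0 := by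
    intro n hn
    rw [mem_Icc] at hn
    have := natAbs_le_ex t a b ha hb h n
    rw [th, PowerSeries.coeff_C_mul, PowerSeries.coeff_X_pow, if_neg (by omega), mul_zero]
  have h1 := hasSum_sum_of_ne_finset_zero (L := .unconditional _) hz
  have h2 : Filter.Tendsto (fun N => coeff d (∏ k ∈ range N, TT t a b k)) Filter.atTop
      (nhds (coeff d (∏' k, TT t a b k))) :=
    ((PowerSeries.WithPiTopology.continuous_coeff ℤ d).tendsto _).comp
      (TT_mult t a b (by omega)).hasProd.tendsto_prod_nat
  have h3 : Filter.Tendsto (fun N => coeff d (∏ k ∈ range N, TT t a b k)) Filter.atTop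
      (nhds (∑ n ∈ Icc (-(d:ℤ)) d, coeff d (th t a n))) := by
    apply tendsto_const_nhds.congr'
    filter_upwards [Filter.eventually_ge_atTop d] with N hN
    have e1 : ∏ k ∈ range N, TT t a b k = qp (2 * t) N * PP t a b N := by
      rw [qp, PP, ← prod_mul_distrib]; rfl
    have e2 := jtp_congr t a b ha hb h N
    rw [sum_reindex, PowerSeries.X_pow_dvd_iff] at e2
    have e3 := e2 d (by omega)
    rw [map_sub, sub_eq_zero, map_sum] at e3
    rw [e1, e3]
    apply sum_subset
    · apply Icc_subset_Icc <;> omega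
    · intro n _ hn; exact hz n hn
  rw [tendsto_nhds_unique h2 h3]
  exact h1

lemma tprod_blocks (t : ℕ) (ht : 1 ≤ t) (f : ℕ → ℤ⟦X⟧) (hf : Multipliable f)
    (hg : Multipliable fun k => ∏ r ∈ range t, f (t * k + r)) :
    ∏' j, f j = ∏' k, ∏ r ∈ range t, f (t * k + r) := by
  have h1 := hf.hasProd.tendsto_prod_nat.comp (Filter.tendsto_id.const_mul_atTop' (r := t) (by omega))
  have h2 := hg.hasProd.tendsto_prod_nat
  refine tendsto_nhds_unique h1 (h2.congr ?_)
  intro N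
  induction N with
  | zero => simp
  | succ N ih =>
    rw [prod_range_succ, ih]
    simp only [Function.comp, id]
    rw [Nat.mul_succ, prod_range_add]

lemma block_split (t' k : ℕ) : ∏ r ∈ range (2 * t' + 1), (1 - (X:ℤ⟦X⟧) ^ (2 * ((2 * t' + 1) * k + r) + 1)) =
    (∏ p ∈ range t', ((1 - (X:ℤ⟦X⟧) ^ (2 * (2 * t' + 1) * k + (2 * p + 1))) *
      (1 - X ^ (2 * (2 * t' + 1) * k + (4 * t' + 1 - 2 * p))))) *
    (1 - X ^ ((2 * k + 1) * (2 * t' + 1))) := by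
  rw [show 2 * t' + 1 = t' + (t' + 1) by ring, prod_range_add, prod_range_succ', prod_mul_distrib,
    mul_assoc]
  congr 1
  · apply prod_congr rfl; intro p _; congr 2; ring
  congr 1
  · rw [← prod_range_reflect]
    apply prod_congr rfl; intro p hp
    rw [mem_range] at hp
    obtain ⟨m, rfl⟩ : ∃ m, t' = p + 1 + m := ⟨t' - (p+1), by omega⟩
    congr 2
    rw [show p + 1 + m - 1 - p = m by omega,
      show 4 * (p + 1 + m) + 1 - 2 * p = 2 * p + 4 * m + 5 by omega]
    ring
  · congr 2; ring

lemma main_product (t' : ℕ) :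
    ∏ p ∈ range t', ∏' k, TT (2 * t' + 1) (2 * p + 1) (4 * t' + 1 - 2 * p) k =
    ∏' k : ℕ,
      ((1 - (X:ℤ⟦X⟧) ^ (k + 1)) * PowerSeries.invOfUnit (1 - X ^ (2 * (k + 1))) 1 *
        (1 - X ^ (2 * (k + 1) * (2 * t' + 1))) ^ t' *
        ((1 - X ^ (2 * (k + 1) * (2 * t' + 1))) *
          PowerSeries.invOfUnit (1 - X ^ ((k + 1) * (2 * t' + 1))) 1)) := by
  set t := 2 * t' + 1 with ht
  have ht1 : 1 ≤ t := by omega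
  have mA : Multipliable fun k => (1 - (X:ℤ⟦X⟧) ^ (k + 1)) :=
    mult_of_dvd _ fun k => dvd_one_sub (by omega)
  have mB : Multipliable fun k => (1 - (X:ℤ⟦X⟧) ^ (2 * (k + 1))) :=
    mult_of_dvd _ fun k => dvd_one_sub (by omega)
  have mBi : Multipliable fun k => PowerSeries.invOfUnit (1 - (X:ℤ⟦X⟧) ^ (2 * (k + 1))) 1 :=
    mult_of_dvd _ fun k => dvd_inv_one_sub (by omega) (by omega)
  have mAt : Multipliable fun k => (1 - (X:ℤ⟦X⟧) ^ ((k + 1) * t)) :=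
    mult_of_dvd _ fun k => dvd_one_sub (by nlinarith)
  have mAti : Multipliable fun k => PowerSeries.invOfUnit (1 - (X:ℤ⟦X⟧) ^ ((k + 1) * t)) 1 :=
    mult_of_dvd _ fun k => dvd_inv_one_sub (by nlinarith) (by positivity)
  have mBt : Multipliable fun k => (1 - (X:ℤ⟦X⟧) ^ (2 * (k + 1) * t)) :=
    mult_of_dvd _ fun k => dvd_one_sub (by nlinarith)
  have mO : Multipliable fun k => (1 - (X:ℤ⟦X⟧) ^ (2 * k + 1)) :=
    mult_of_dvd _ fun k => dvd_one_sub (by omega)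
  have mOt : Multipliable fun k => (1 - (X:ℤ⟦X⟧) ^ ((2 * k + 1) * t)) :=
    mult_of_dvd _ fun k => dvd_one_sub (by nlinarith)
  have mW : Multipliable fun k => ∏ p ∈ range t', ((1 - (X:ℤ⟦X⟧) ^ (2 * t * k + (2 * p + 1))) *
      (1 - X ^ (2 * t * k + (4 * t' + 1 - 2 * p)))) :=
    mult_of_dvd _ fun k => dvd_prod_sub_one _ _ fun p _ =>
      dvd_mul_sub_one (dvd_one_sub (le_two_t _ _ _ ht1)) (dvd_one_sub (le_two_t _ _ _ ht1))
  have mBtp : Multipliable fun k => (1 - (X:ℤ⟦X⟧) ^ (2 * (k + 1) * t)) ^ t' := by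
    simpa using multipliable_prod (s := range t') (fun i _ => mBt)
  have pBtp : ∏' k, (1 - (X:ℤ⟦X⟧) ^ (2 * (k + 1) * t)) ^ t' =
      (∏' k, (1 - (X:ℤ⟦X⟧) ^ (2 * (k + 1) * t))) ^ t' := by
    simpa using Multipliable.tprod_finsetProd (s := range t') (fun i _ => mBt)
  have pB : (∏' k, (1 - (X:ℤ⟦X⟧) ^ (2 * (k + 1)))) *
      ∏' k, PowerSeries.invOfUnit (1 - (X:ℤ⟦X⟧) ^ (2 * (k + 1))) 1 = 1 := by
    rw [← mB.tprod_mul mBi]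
    have : ∀ k : ℕ, 2 * (k + 1) ≠ 0 := fun k => by positivity
    simp only [mul_inv_one_sub _ (this _), tprod_one]
  have pAt : (∏' k, (1 - (X:ℤ⟦X⟧) ^ ((k + 1) * t))) *
      ∏' k, PowerSeries.invOfUnit (1 - (X:ℤ⟦X⟧) ^ ((k + 1) * t)) 1 = 1 := by
    rw [← mAt.tprod_mul mAti]
    have : ∀ k : ℕ, (k + 1) * t ≠ 0 := fun k => by positivity
    simp only [mul_inv_one_sub _ (this _), tprod_one]
  have pA : (∏' k, (1 - (X:ℤ⟦X⟧) ^ (2 * k + 1))) * (∏' k, (1 - (X:ℤ⟦X⟧) ^ (2 * (k + 1)))) =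
      ∏' k, (1 - (X:ℤ⟦X⟧) ^ (k + 1)) :=
    tprod_even_mul_odd (f := fun k => (1 - (X:ℤ⟦X⟧) ^ (k + 1))) mO mB
  have pAt2 : (∏' k, (1 - (X:ℤ⟦X⟧) ^ ((2 * k + 1) * t))) *
      (∏' k, (1 - (X:ℤ⟦X⟧) ^ (2 * (k + 1) * t))) = ∏' k, (1 - (X:ℤ⟦X⟧) ^ ((k + 1) * t)) :=
    tprod_even_mul_odd (f := fun k => (1 - (X:ℤ⟦X⟧) ^ ((k + 1) * t))) mOt mBt
  have pO : ∏' k, (1 - (X:ℤ⟦X⟧) ^ (2 * k + 1)) =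
     (∏' k, ∏ p ∈ range t', ((1 - (X:ℤ⟦X⟧) ^ (2 * t * k + (2 * p + 1))) *
      (1 - X ^ (2 * t * k + (4 * t' + 1 - 2 * p))))) * ∏' k, (1 - (X:ℤ⟦X⟧) ^ ((2 * k + 1) * t)) := by
    rw [← mW.tprod_mul mOt, tprod_blocks t ht1 _ mO]
    · exact tprod_congr fun k => block_split t' k
    · exact (mW.mul mOt).congr fun k => (block_split t' k).symm
  rw [← Multipliable.tprod_finsetProd (fun i _ => TT_mult t _ _ ht1)]
  have hL : ∀ k, ∏ p ∈ range t', TT t (2 * p + 1) (4 * t' + 1 - 2 * p) k =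
     (1 - (X:ℤ⟦X⟧) ^ (2 * (k + 1) * t)) ^ t' *
      ∏ p ∈ range t', ((1 - (X:ℤ⟦X⟧) ^ (2 * t * k + (2 * p + 1))) *
      (1 - X ^ (2 * t * k + (4 * t' + 1 - 2 * p)))) := by
    intro k
    simp only [TT, prod_mul_distrib, prod_const, card_range]
    rw [show 2 * t * (k+1) = 2 * (k + 1) * t by ring]
  rw [tprod_congr hL, mBtp.tprod_mul mW, pBtp,
    ((mA.mul mBi).mul mBtp).tprod_mul (mBt.mul mAti), (mA.mul mBi).tprod_mul mBtp, mA.tprod_mul mBi,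
    mBt.tprod_mul mAti, pBtp, ← pA, pO]
  rw [← pAt2] at pAt
  linear_combination (-(∏' k, ∏ p ∈ range t', ((1 - (X:ℤ⟦X⟧) ^ (2 * t * k + (2 * p + 1))) *
      (1 - X ^ (2 * t * k + (4 * t' + 1 - 2 * p))))) * (∏' k, (1 - (X:ℤ⟦X⟧) ^ (2 * (k + 1) * t))) ^ t') * (pAt + pB * ((∏' k, (1 - (X:ℤ⟦X⟧) ^ ((2 * k + 1) * t))) *
      (∏' k, (1 - (X:ℤ⟦X⟧) ^ (2 * (k + 1) * t))) * ∏' k, PowerSeries.invOfUnit (1 - (X:ℤ⟦X⟧) ^ ((k + 1) * t)) 1))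

end Products
section Diagrams
open Finset

lemma sc_mem {μ : YoungDiagram} (h : μ.transpose = μ) (i j : ℕ) : (i, j) ∈ μ ↔ (j, i) ∈ μ := by
  conv_lhs => rw [← h, YoungDiagram.mem_transpose]
  rfl

lemma sc_col {μ : YoungDiagram} (h : μ.transpose = μ) (j : ℕ) : μ.colLen j = μ.rowLen j := by
  conv_lhs => rw [← h, YoungDiagram.colLen_transpose]

lemma sc_lt {μ : YoungDiagram} (h : μ.transpose = μ) (i j : ℕ) :
    j < μ.rowLen i ↔ i < μ.rowLen j := by
  rw [← YoungDiagram.mem_iff_lt_rowLen, ← YoungDiagram.mem_iff_lt_rowLen, sc_mem h]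

/-- indices of rows meeting the `d`-th diagonal -/
def dg (μ : YoungDiagram) (d : ℕ) : Finset ℕ := (range (μ.rowLen 0)).filter fun i => i + d < μ.rowLen i

lemma mem_dg (μ : YoungDiagram) (d i : ℕ) : i ∈ dg μ d ↔ i + d < μ.rowLen i := by
  rw [dg, mem_filter, mem_range]
  have := μ.rowLen_anti 0 i (by omega)
  omega

/-- Frobenius arm coordinates -/
def dset (μ : YoungDiagram) : Finset ℕ := (dg μ 0).image fun i => μ.rowLen i - i - 1

lemma mem_dset (μ : YoungDiagram) (r : ℕ) : r ∈ dset μ ↔ ∃ i, μ.rowLen i = i + r + 1 := by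
  simp only [dset, mem_image, mem_dg]
  constructor
  · rintro ⟨i, h1, h2⟩; exact ⟨i, by omega⟩
  · rintro ⟨i, h⟩; exact ⟨i, by omega, by omega⟩

lemma arm_inj (μ : YoungDiagram) (d : ℕ) : Set.InjOn (fun i => μ.rowLen i - i - 1) (dg μ d : Set ℕ) := by
  intro i hi j hj hij
  rw [mem_coe, mem_dg] at hi hj
  simp only at hij
  rcases lt_trichotomy i j with h | h | h
  · have := μ.rowLen_anti i j (by omega); omega
  · exact h
  · have := μ.rowLen_anti j i (by omega); omega

lemma dset_filter (μ : YoungDiagram) (d : ℕ) :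
    (dset μ).filter (fun r => d ≤ r) = (dg μ d).image fun i => μ.rowLen i - i - 1 := by
  ext r
  simp only [mem_filter, mem_dset, mem_image, mem_dg]
  constructor
  · rintro ⟨⟨i, h1⟩, h2⟩; exact ⟨i, by omega, by omega⟩
  · rintro ⟨i, h1, h2⟩; exact ⟨⟨i, by omega⟩, by omega⟩

lemma dg_down (μ : YoungDiagram) (d i j : ℕ) (h : i ≤ j) (hj : j ∈ dg μ d) : i ∈ dg μ d := by
  rw [mem_dg] at *
  have := μ.rowLen_anti i j h
  omega

lemma down_mem_iff (s : Finset ℕ) (hs : ∀ i j, i ≤ j → j ∈ s → i ∈ s) (i : ℕ) : i ∈ s ↔ i < s.card := by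
  constructor
  · intro h
    have : range (i+1) ⊆ s := fun j hj => hs j i (by rw [mem_range] at hj; omega) h
    simpa using card_le_card this
  · intro h
    by_contra hi
    have : s ⊆ range i := fun j hj => by
      rw [mem_range]; by_contra hc; exact hi (hs i j (by omega) hj)
    have := card_le_card this
    rw [card_range] at this; omega

lemma mem_iff_count (μ : YoungDiagram) (i d : ℕ) :
    (i, i + d) ∈ μ ↔ i < ((dset μ).filter (fun r => d ≤ r)).card := by
  rw [dset_filter, card_image_of_injOn (arm_inj μ d), ← down_mem_iff _ (dg_down μ d), mem_dg,
    YoungDiagram.mem_iff_lt_rowLen]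

lemma dset_inj {μ ν : YoungDiagram} (hμ : μ.transpose = μ) (hν : ν.transpose = ν)
    (h : dset μ = dset ν) : μ = ν := by
  have key : ∀ i j, i ≤ j → ((i, j) ∈ μ ↔ (i, j) ∈ ν) := by
    intro i j hij
    obtain ⟨d, rfl⟩ := Nat.exists_eq_add_of_le hij
    rw [mem_iff_count, mem_iff_count, h]
  ext ⟨i, j⟩
  rw [YoungDiagram.mem_cells, YoungDiagram.mem_cells]
  rcases le_total i j with hij | hij
  · exact key i j hij
  · rw [sc_mem hμ, sc_mem hν]; exact key j i hij

lemma durfee_eq (μ : YoungDiagram) : durfee μ = (dset μ).card := by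
  rw [dset, card_image_of_injOn (arm_inj μ 0), durfee]
  refine card_bij (fun c _ => c.1) ?_ ?_ ?_
  · rintro ⟨i, j⟩ hc
    simp only [mem_filter, YoungDiagram.mem_cells] at hc
    obtain ⟨h1, rfl⟩ := hc
    rw [mem_dg, ← YoungDiagram.mem_iff_lt_rowLen]; exact h1
  · rintro ⟨i, j⟩ hc ⟨i', j'⟩ hc' h
    simp only [mem_filter] at hc hc' h
    rw [Prod.mk.injEq]; omega
  · intro i hi
    rw [mem_dg, ← YoungDiagram.mem_iff_lt_rowLen] at hi
    exact ⟨(i, i), by simpa using hi, rfl⟩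

lemma card_eq {μ : YoungDiagram} (hμ : μ.transpose = μ) : μ.card = ∑ r ∈ dset μ, (2 * r + 1) := by
  rw [dset, sum_image (arm_inj μ 0), YoungDiagram.card,
    card_eq_sum_card_fiberwise (f := fun c => min c.1 c.2) (t := dg μ 0)]
  · apply sum_congr rfl
    intro i hi
    rw [mem_dg] at hi
    have : μ.cells.filter (fun c => min c.1 c.2 = i) =
       (Ico i (μ.rowLen i)).image (fun j => (i, j)) ∪ (Ico (i+1) (μ.rowLen i)).image (fun j => (j, i)) := by
      ext ⟨a, b⟩
      simp only [mem_filter, YoungDiagram.mem_cells, mem_union, mem_image, mem_Ico, Prod.mk.injEq]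
      constructor
      · rintro ⟨h1, h2⟩
        rcases le_total a b with h | h
        · left
          obtain rfl : a = i := by omega
          rw [YoungDiagram.mem_iff_lt_rowLen] at h1
          exact ⟨b, by omega, rfl, rfl⟩
        · obtain rfl : b = i := by omega
          rw [sc_mem hμ, YoungDiagram.mem_iff_lt_rowLen] at h1
          rcases h.eq_or_lt with h | h
          · left; exact ⟨b, by omega, by omega, rfl⟩
          · right; exact ⟨a, by omega, rfl, rfl⟩
      · rintro (⟨j, h1, rfl, rfl⟩ | ⟨j, h1, rfl, rfl⟩)
        · rw [YoungDiagram.mem_iff_lt_rowLen]; omega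
        · rw [sc_mem hμ, YoungDiagram.mem_iff_lt_rowLen]; omega
    rw [this, card_union_of_disjoint, card_image_of_injective, card_image_of_injective, Nat.card_Ico,
      Nat.card_Ico]
    · omega
    · intro a b h; simpa using h
    · intro a b h; simpa using h
    · rw [disjoint_left]
      rintro ⟨a, b⟩ h1 h2
      simp only [mem_image, mem_Ico, Prod.mk.injEq] at h1 h2
      omega
  · rintro ⟨i, j⟩ h
    rw [mem_coe, YoungDiagram.mem_cells] at h
    rw [mem_coe, mem_dg, add_zero, ← YoungDiagram.mem_iff_lt_rowLen]
    exact μ.up_left_mem (min_le_left i j) (min_le_right i j) h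

/-- number of elements of `S` at least `d` -/
def cnt (S : Finset ℕ) (d : ℕ) : ℕ := (S.filter (fun r => d ≤ r)).card

lemma cnt_anti (S : Finset ℕ) {d e : ℕ} (h : d ≤ e) : cnt S e ≤ cnt S d := by
  apply card_le_card
  intro r; simp only [mem_filter]; rintro ⟨h1, h2⟩; exact ⟨h1, h.trans h2⟩

lemma cnt_succ (S : Finset ℕ) (d : ℕ) : cnt S d = cnt S (d + 1) + if d ∈ S then 1 else 0 := by
  by_cases h : d ∈ S
  · rw [if_pos h]
    have : S.filter (fun r => d ≤ r) = insert d (S.filter (fun r => d + 1 ≤ r)) := by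
      ext r; simp only [mem_filter, mem_insert]
      constructor
      · rintro ⟨h1, h2⟩
        rcases h2.eq_or_lt with h2 | h2
        · exact Or.inl h2.symm
        · exact Or.inr ⟨h1, h2⟩
      · rintro (rfl | ⟨h1, h2⟩)
        · exact ⟨h, le_rfl⟩
        · exact ⟨h1, by omega⟩
    rw [cnt, this, card_insert_of_notMem (by simp), cnt]
  · rw [if_neg h, add_zero, cnt, cnt]
    congr 1
    ext r; simp only [mem_filter]
    constructor
    · rintro ⟨h1, h2⟩
      refine ⟨h1, ?_⟩
      rcases h2.eq_or_lt with h2 | h2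
      · subst h2; exact absurd h1 h
      · exact h2
    · rintro ⟨h1, h2⟩; exact ⟨h1, by omega⟩

lemma cnt_add (S : Finset ℕ) (d e : ℕ) : cnt S d ≤ cnt S (d + e) + e := by
  induction e with
  | zero => simp
  | succ e ih =>
    have := cnt_succ S (d + e)
    rw [show d + (e + 1) = d + e + 1 by ring]
    split_ifs at this <;> omega

/-- cell predicate of the diagram with Frobenius coordinates `S` -/
def cellP (S : Finset ℕ) (c : ℕ × ℕ) : Prop := min c.1 c.2 < cnt S (max c.1 c.2 - min c.1 c.2)

lemma cellP_bound (S : Finset ℕ) (c : ℕ × ℕ) (h : cellP S c) :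
    c.1 < S.card + S.sup id + 1 ∧ c.2 < S.card + S.sup id + 1 := by
  rw [cellP] at h
  have h1 : cnt S (max c.1 c.2 - min c.1 c.2) ≤ S.card := card_filter_le _ _
  have h2 : max c.1 c.2 - min c.1 c.2 ≤ S.sup id := by
    have : 0 < cnt S (max c.1 c.2 - min c.1 c.2) := by omega
    obtain ⟨r, hr⟩ := card_pos.1 this
    rw [mem_filter] at hr
    exact hr.2.trans (le_sup (f := id) hr.1)
  omega

lemma cellP_lower (S : Finset ℕ) (a b c d : ℕ) (h1 : a ≤ c) (h2 : b ≤ d) (h : cellP S (c, d)) :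
    cellP S (a, b) := by
  simp only [cellP] at *
  have e1 : max a b - min a b ≤ (max c d - min c d) + (min c d - min a b) := by omega
  have e2 := cnt_add S (max c d - min c d) (min c d - min a b)
  have e3 := cnt_anti S e1
  omega

instance (S : Finset ℕ) : DecidablePred (cellP S) := fun c => by unfold cellP; infer_instance

/-- diagram with Frobenius coordinates `S` -/
def dia (S : Finset ℕ) : YoungDiagram where
  cells := (range (S.card + S.sup id + 1) ×ˢ range (S.card + S.sup id + 1)).filter (cellP S)
  isLowerSet := by
    rintro ⟨c, d⟩ ⟨a, b⟩ hle h
    rw [mem_coe, mem_filter] at *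
    have := cellP_lower S a b c d hle.1 hle.2 h.2
    refine ⟨?_, this⟩
    have := cellP_bound S _ this
    rw [mem_product, mem_range, mem_range]; exact this

lemma mem_dia (S : Finset ℕ) (c : ℕ × ℕ) : c ∈ dia S ↔ cellP S c := by
  rw [← YoungDiagram.mem_cells, dia, mem_filter, mem_product, mem_range, mem_range]
  exact ⟨fun h => h.2, fun h => ⟨cellP_bound S c h, h⟩⟩

lemma dia_sc (S : Finset ℕ) : (dia S).transpose = dia S := by
  ext ⟨i, j⟩
  rw [YoungDiagram.mem_cells, YoungDiagram.mem_cells, YoungDiagram.mem_transpose, mem_dia, mem_dia]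
  simp only [cellP, Prod.swap, min_comm, max_comm]

lemma dset_dia (S : Finset ℕ) : dset (dia S) = S := by
  ext r
  rw [mem_dset]
  have key : ∀ i, (dia S).rowLen i = i + r + 1 ↔ i < cnt S r ∧ ¬ i < cnt S (r + 1) := by
    intro i
    have h1 : (i, i + r) ∈ dia S ↔ i < cnt S r := by
      rw [mem_dia, cellP]; simp
    have h2 : (i, i + (r + 1)) ∈ dia S ↔ i < cnt S (r + 1) := by
      rw [mem_dia, cellP]; simp
    rw [← h1, ← h2, YoungDiagram.mem_iff_lt_rowLen, YoungDiagram.mem_iff_lt_rowLen]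
    omega
  simp only [key]
  have := cnt_succ S r
  constructor
  · rintro ⟨i, h1, h2⟩
    by_contra h
    rw [if_neg h] at this; omega
  · intro h
    rw [if_pos h] at this
    exact ⟨cnt S (r+1), by omega, by omega⟩

/-- the core condition on Frobenius coordinates -/
def CC (t' : ℕ) (S : Finset ℕ) : Prop :=
  ∀ r ∈ S, (2 * t' + 1 ≤ r → r - (2 * t' + 1) ∈ S) ∧ (r < 2 * t' + 1 → 2 * t' - r ∉ S)

lemma dichotomy {μ : YoungDiagram} (h : μ.transpose = μ) (c : ℕ) :
    (∃ i, μ.rowLen i = i + c + 1) ∨ ∃ i, μ.rowLen i + c = i := by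
  have hex : ∃ i, μ.rowLen i ≤ i + c :=
    ⟨μ.rowLen 0, (μ.rowLen_anti 0 _ (by omega)).trans (by omega)⟩
  classical
  set i := Nat.find hex with hi
  have h1 : μ.rowLen i ≤ i + c := Nat.find_spec hex
  have h2 : ∀ j < i, ¬ μ.rowLen j ≤ j + c := fun j hj => Nat.find_min hex hj
  have h3 := sc_lt h i (i + c)
  rcases Nat.eq_zero_or_pos i with h0 | h0
  · right; exact ⟨i + c, by omega⟩
  · have h4 := h2 (i - 1) (by omega)
    have h5 := sc_lt h (i - 1) (i + c)
    by_cases h6 : μ.rowLen (i - 1) = i + c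
    · left; exact ⟨i - 1, by omega⟩
    · right; exact ⟨i + c, by omega⟩

lemma CC_sum {t' : ℕ} {S : Finset ℕ} (hS : CC t' S) (k : ℕ) : ∀ r ∈ S, ∀ r' ∈ S,
    r + r' + 1 = (2 * t' + 1) * k → False := by
  induction k with
  | zero => intro r _ r' _ h; omega
  | succ k ih =>
    intro r hr r' hr' h
    by_cases h1 : 2 * t' + 1 ≤ r
    · exact ih _ ((hS r hr).1 h1) r' hr' (by rw [Nat.mul_succ] at h; omega)
    by_cases h2 : 2 * t' + 1 ≤ r'
    · exact ih r hr _ ((hS r' hr').1 h2) (by rw [Nat.mul_succ] at h; omega)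
    have hk : k = 0 := by
      rcases k with _ | k
      · rfl
      · exfalso
        rw [Nat.mul_succ, Nat.mul_succ] at h; omega
    subst hk
    have := (hS r hr).2 (by omega)
    rw [show 2 * t' - r = r' by omega] at this
    exact this hr'

lemma CC_iter {t' : ℕ} {S : Finset ℕ} (hS : CC t' S) (k : ℕ) : ∀ c, c + (2 * t' + 1) * k ∈ S → c ∈ S := by
  induction k with
  | zero => intro c h; simpa using h
  | succ k ih =>
    intro c h
    apply ih
    have := (hS _ h).1 (by rw [Nat.mul_succ]; omega)
    rw [Nat.mul_succ, ← add_assoc, Nat.add_sub_cancel] at this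
    exact this

lemma core_iff {μ : YoungDiagram} (h : μ.transpose = μ) (t' : ℕ) :
    (∀ c ∈ μ.cells, ¬ (2 * t' + 1) ∣ hookLen μ c) ↔ CC t' (dset μ) := by
  constructor
  · intro hc
    have aux : ∀ i j, μ.rowLen i + μ.rowLen j = i + j + 1 + (2 * t' + 1) → False := by
      intro i j hij
      have h1 := sc_lt h i j
      have hm : (i, j) ∈ μ.cells := by
        rw [YoungDiagram.mem_cells, YoungDiagram.mem_iff_lt_rowLen]; omega
      apply hc _ hm
      rw [hookLen, sc_col h]
      simp only
      rw [show μ.rowLen i + μ.rowLen j - i - j - 1 = 2 * t' + 1 by omega]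
    intro r hr
    rw [mem_dset] at hr
    obtain ⟨i, hi⟩ := hr
    constructor
    · intro hrt
      rw [mem_dset]
      rcases dichotomy h (r - (2 * t' + 1)) with h1 | ⟨j, h1⟩
      · exact h1
      · exfalso; exact aux i j (by omega)
    · intro hrt h1
      rw [mem_dset] at h1
      obtain ⟨j, hj⟩ := h1
      exact aux i j (by omega)
  · intro hC
    have aux : ∀ i j k, i < μ.rowLen i → μ.rowLen i + μ.rowLen j = i + j + 1 + (2 * t' + 1) * k →
        1 ≤ k → False := by
      intro i j k hi hs hk
      have hr : μ.rowLen i - i - 1 ∈ dset μ := by rw [mem_dset]; exact ⟨i, by omega⟩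
      by_cases hj : j < μ.rowLen j
      · have hr' : μ.rowLen j - j - 1 ∈ dset μ := by rw [mem_dset]; exact ⟨j, by omega⟩
        exact CC_sum hC k _ hr _ hr' (by omega)
      · have h1 : j - μ.rowLen j ∈ dset μ := by
          apply CC_iter hC k
          convert hr using 1
          omega
        rw [mem_dset] at h1
        obtain ⟨l, hl⟩ := h1
        have := sc_lt h l j
        omega
    rintro ⟨i, j⟩ hm ⟨k, hk⟩
    rw [YoungDiagram.mem_cells, YoungDiagram.mem_iff_lt_rowLen] at hm
    have hm2 := (sc_lt h i j).1 hm
    rw [hookLen, sc_col h] at hk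
    simp only at hk
    have hk1 : 1 ≤ k := by
      rcases k with _ | k
      · simp at hk; omega
      · omega
    by_cases hi : i < μ.rowLen i
    · exact aux i j k hi (by omega) hk1
    · exact aux j i k (by omega) (by omega) hk1

end Diagrams
section Vectors
open Finset

/-- extension of a vector by zero -/
def ext0 {t' : ℕ} (v : Fin t' → ℤ) (p : ℕ) : ℤ := if h : p < t' then v ⟨p, h⟩ else 0

/-- runner heights -/
def LL {t' : ℕ} (v : Fin t' → ℤ) (ρ : ℕ) : ℕ :=
  (if ρ < t' then ext0 v ρ else - ext0 v (2 * t' - ρ)).toNat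

/-- coordinates from the vector -/
def Sv {t' : ℕ} (v : Fin t' → ℤ) : Finset ℕ :=
  (range (2 * t' + 1)).biUnion fun ρ => (range (LL v ρ)).image fun k => ρ + (2 * t' + 1) * k

lemma uniq_div {t ρ k ρ' k' : ℕ} (h : ρ < t) (h' : ρ' < t) (e : ρ + t * k = ρ' + t * k') :
    ρ = ρ' ∧ k = k' := by
  have h1 := congrArg (· % t) e
  simp only [Nat.add_mul_mod_self_left, Nat.mod_eq_of_lt h, Nat.mod_eq_of_lt h'] at h1
  subst h1
  refine ⟨rfl, ?_⟩
  have : t * k = t * k' := by omega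
  exact Nat.eq_of_mul_eq_mul_left (by omega) this

lemma mem_Sv {t' : ℕ} (v : Fin t' → ℤ) (ρ k : ℕ) (hρ : ρ < 2 * t' + 1) :
    ρ + (2 * t' + 1) * k ∈ Sv v ↔ k < LL v ρ := by
  simp only [Sv, mem_biUnion, mem_image, mem_range]
  constructor
  · rintro ⟨ρ', h1, k', h2, h3⟩
    obtain ⟨rfl, rfl⟩ := uniq_div h1 hρ h3
    exact h2
  · intro h; exact ⟨ρ, hρ, k, h, rfl⟩

lemma decomp (t r : ℕ) (ht : 0 < t) : ∃ ρ k, ρ < t ∧ r = ρ + t * k :=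
  ⟨r % t, r / t, Nat.mod_lt _ ht, (Nat.mod_add_div r t).symm⟩

lemma LL_lt {t' : ℕ} (v : Fin t' → ℤ) (p : ℕ) (h : p < t') : LL v p = (v ⟨p, h⟩).toNat := by
  simp [LL, ext0, h]

lemma LL_mid {t' : ℕ} (v : Fin t' → ℤ) : LL v t' = 0 := by
  have : 2 * t' - t' = t' := by omega
  simp [LL, ext0, this]

lemma LL_gt {t' : ℕ} (v : Fin t' → ℤ) (p : ℕ) (h : p < t') :
    LL v (2 * t' - p) = (- v ⟨p, h⟩).toNat := by
  have h1 : ¬ (2 * t' - p < t') := by omega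
  have h2 : 2 * t' - (2 * t' - p) = p := by omega
  simp [LL, ext0, h1, h2, h]

lemma CC_Sv {t' : ℕ} (v : Fin t' → ℤ) : CC t' (Sv v) := by
  intro r hr
  obtain ⟨ρ, k, hρ, rfl⟩ := decomp (2 * t' + 1) r (by omega)
  rw [mem_Sv v ρ k hρ] at hr
  rcases k with _ | k
  · refine ⟨fun h => by omega, fun _ h => ?_⟩
    rw [mul_zero, add_zero] at h
    have h2 := (mem_Sv v (2 * t' - ρ) 0 (by omega)).1 (by simpa using h)
    rcases lt_trichotomy ρ t' with h3 | h3 | h3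
    · rw [LL_lt v ρ h3] at hr
      rw [LL_gt v ρ h3] at h2
      omega
    · rw [h3, LL_mid] at hr; omega
    · obtain ⟨p, hp, rfl⟩ : ∃ p, p < t' ∧ ρ = 2 * t' - p := ⟨2 * t' - ρ, by omega, by omega⟩
      rw [show 2 * t' - (2 * t' - p) = p by omega, LL_lt v p hp] at h2
      rw [LL_gt v p hp] at hr
      omega
  · refine ⟨fun _ => ?_, fun h => by rw [Nat.mul_succ] at h; omega⟩
    rw [Nat.mul_succ, ← add_assoc, Nat.add_sub_cancel, mem_Sv v ρ k hρ]
    omega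

lemma Sv_inj {t' : ℕ} {v w : Fin t' → ℤ} (h : Sv v = Sv w) : v = w := by
  have key : ∀ ρ < 2 * t' + 1, LL v ρ = LL w ρ := by
    intro ρ hρ
    apply le_antisymm
    · by_contra hc
      have := (mem_Sv v ρ (LL w ρ) hρ).2 (by omega)
      rw [h, mem_Sv w ρ _ hρ] at this
      omega
    · by_contra hc
      have := (mem_Sv w ρ (LL v ρ) hρ).2 (by omega)
      rw [← h, mem_Sv v ρ _ hρ] at this
      omega
  funext ⟨p, hp⟩
  have h1 := key p (by omega)
  have h2 := key (2 * t' - p) (by omega)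
  rw [LL_lt v p hp, LL_lt w p hp] at h1
  rw [LL_gt v p hp, LL_gt w p hp] at h2
  omega

lemma Sv_surj {t' : ℕ} {S : Finset ℕ} (hS : CC t' S) : ∃ v : Fin t' → ℤ, Sv v = S := by
  set K : ℕ → Finset ℕ := fun ρ => (S.filter (fun r => r % (2 * t' + 1) = ρ)).image
    (fun r => r / (2 * t' + 1)) with hK
  have mK : ∀ ρ < 2 * t' + 1, ∀ k, k ∈ K ρ ↔ ρ + (2 * t' + 1) * k ∈ S := by
    intro ρ hρ k
    simp only [hK, mem_image, mem_filter]
    constructor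
    · rintro ⟨r, ⟨h1, h2⟩, h3⟩
      rw [← h2, ← h3, Nat.mod_add_div]; exact h1
    · intro h
      refine ⟨_, ⟨h, ?_⟩, ?_⟩
      · rw [Nat.add_mul_mod_self_left, Nat.mod_eq_of_lt hρ]
      · rw [Nat.add_mul_div_left _ _ (by omega), Nat.div_eq_of_lt hρ, zero_add]
  have mK2 : ∀ ρ < 2 * t' + 1, ∀ k, ρ + (2 * t' + 1) * k ∈ S ↔ k < (K ρ).card := by
    intro ρ hρ k
    rw [← mK ρ hρ, down_mem_iff]
    intro i j hij hj
    rw [mK ρ hρ] at *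
    obtain ⟨d, rfl⟩ := Nat.exists_eq_add_of_le hij
    apply CC_iter hS d
    rwa [add_assoc, ← mul_add]
  have hz : ∀ ρ < 2 * t' + 1, ¬ (0 < (K ρ).card ∧ 0 < (K (2 * t' - ρ)).card) := by
    rintro ρ hρ ⟨h1, h2⟩
    rw [← mK2 _ hρ] at h1
    rw [← mK2 _ (by omega)] at h2
    rw [mul_zero, add_zero] at h1 h2
    exact (hS ρ h1).2 hρ h2
  refine ⟨fun p => (K p).card - (K (2 * t' - p)).card, ?_⟩
  ext r
  obtain ⟨ρ, k, hρ, rfl⟩ := decomp (2 * t' + 1) r (by omega)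
  rw [mem_Sv _ _ _ hρ, mK2 _ hρ]
  have hzz := hz ρ hρ
  rcases lt_trichotomy ρ t' with h3 | h3 | h3
  · rw [LL_lt _ ρ h3]
    simp only
    omega
  · rw [h3, LL_mid]
    rw [h3, show 2 * t' - t' = t' by omega] at hzz
    omega
  · obtain ⟨p, hp, rfl⟩ : ∃ p, p < t' ∧ ρ = 2 * t' - p := ⟨2 * t' - ρ, by omega, by omega⟩
    rw [LL_gt _ p hp]
    rw [show 2 * t' - (2 * t' - p) = p by omega] at hzz
    simp only
    omega

lemma sum_Sv {t' : ℕ} (v : Fin t' → ℤ) (g : ℕ → ℕ) : ∑ r ∈ Sv v, g r =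
    ∑ p : Fin t', (∑ k ∈ range (v p).toNat, g (p + (2 * t' + 1) * k) +
      ∑ k ∈ range (- v p).toNat, g (2 * t' - p + (2 * t' + 1) * k)) := by
  have h1 : ∑ r ∈ Sv v, g r =
      ∑ ρ ∈ range (2 * t' + 1), ∑ k ∈ range (LL v ρ), g (ρ + (2 * t' + 1) * k) := by
    rw [Sv, sum_biUnion]
    · apply sum_congr rfl
      intro ρ hρ
      rw [mem_range] at hρ
      rw [sum_image]
      intro a _ b _ hab
      exact (uniq_div hρ hρ hab).2
    · intro a ha b hb hab
      rw [Function.onFun, disjoint_left]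
      intro r h1 h2
      rw [mem_image] at h1 h2
      obtain ⟨k, _, rfl⟩ := h1
      obtain ⟨l, _, h⟩ := h2
      rw [mem_coe, mem_range] at ha hb
      exact hab (uniq_div hb ha h).1.symm
  set G : ℕ → ℕ := fun ρ => ∑ k ∈ range (LL v ρ), g (ρ + (2 * t' + 1) * k) with hG
  have h2 : ∑ ρ ∈ range (2 * t' + 1), G ρ = ∑ p ∈ range t', (G p + G (2 * t' - p)) := by
    rw [show 2 * t' + 1 = t' + (t' + 1) by ring, sum_range_add, sum_range_succ', sum_add_distrib]
    have : G (t' + 0) = 0 := by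
      simp only [hG, add_zero, LL_mid, range_zero, sum_empty]
    rw [this, add_zero]
    congr 1
    rw [← sum_range_reflect]
    apply sum_congr rfl
    intro p hp
    rw [mem_range] at hp
    congr 1; omega
  rw [h1, h2, ← Fin.sum_univ_eq_sum_range (fun p => G p + G (2 * t' - p))]
  apply sum_congr rfl
  rintro ⟨p, hp⟩ _
  simp only [hG, LL_lt v p hp, LL_gt v p hp]

lemma arith_sum (t c m : ℕ) : ((∑ k ∈ range m, (2 * (c + t * k) + 1) : ℕ) : ℤ) =
    (2 * c + 1) * m + t * (m * (m - 1)) := by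
  induction m with
  | zero => simp
  | succ m ih => rw [sum_range_succ, Nat.cast_add, ih]; push_cast; ring

lemma size_Sv {t' : ℕ} (v : Fin t' → ℤ) : ∑ r ∈ Sv v, (2 * r + 1) =
    ∑ p : Fin t', ex (2 * t' + 1) (2 * p + 1) (v p) := by
  rw [sum_Sv v (fun r => 2 * r + 1)]
  apply sum_congr rfl
  rintro ⟨p, hp⟩ _
  simp only
  zify
  rw [ex_cast _ _ (4 * t' + 1 - 2 * p) (by omega) (by omega) (by omega)]
  have a1 := arith_sum (2 * t' + 1) p (v ⟨p, hp⟩).toNat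
  have a2 := arith_sum (2 * t' + 1) (2 * t' - p) (- v ⟨p, hp⟩).toNat
  push_cast [show p ≤ 2 * t' by omega] at a1 a2 ⊢
  rw [a1, a2]
  rcases le_total 0 (v ⟨p, hp⟩) with h | h
  · rw [show ((v ⟨p, hp⟩).toNat : ℤ) = v ⟨p, hp⟩ by omega,
      show ((- v ⟨p, hp⟩).toNat : ℤ) = 0 by omega]
    ring
  · rw [show ((v ⟨p, hp⟩).toNat : ℤ) = 0 by omega,
      show ((- v ⟨p, hp⟩).toNat : ℤ) = - v ⟨p, hp⟩ by omega]
    ring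

lemma card_Sv {t' : ℕ} (v : Fin t' → ℤ) : (Sv v).card = ∑ p : Fin t', (v p).natAbs := by
  rw [card_eq_sum_ones, sum_Sv v (fun _ => 1)]
  apply sum_congr rfl
  intro p _
  simp only [sum_const, card_range, smul_eq_mul, mul_one]
  omega

/-- The bijection between integer vectors and self-conjugate cores. -/
def coreMap (t' : ℕ) (v : Fin t' → ℤ) : {μ : YoungDiagram // μ.transpose = μ ∧
        ∀ c ∈ μ.cells, ¬ (2 * t' + 1) ∣ hookLen μ c} :=
  ⟨dia (Sv v), dia_sc _, (core_iff (dia_sc _) t').2 (by rw [dset_dia]; exact CC_Sv v)⟩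

lemma coreMap_bij (t' : ℕ) : Function.Bijective (coreMap t') := by
  constructor
  · intro v w h
    have h1 : dia (Sv v) = dia (Sv w) := congrArg Subtype.val h
    apply Sv_inj
    rw [← dset_dia (Sv v), h1, dset_dia]
  · rintro ⟨μ, h1, h2⟩
    obtain ⟨v, hv⟩ := Sv_surj ((core_iff h1 t').1 h2)
    refine ⟨v, Subtype.ext ?_⟩
    change dia (Sv v) = μ
    exact dset_inj (dia_sc _) h1 (by rw [dset_dia, hv])

end Vectors

section Assembly
open Finset
open scoped PowerSeries.WithPiTopology

lemma summable_of_dvd {n : ℕ} (f : (Fin n → ℤ) → ℤ⟦X⟧)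
    (h : ∀ v p, X ^ (v p).natAbs ∣ f v) : Summable f := by
  rw [PowerSeries.WithPiTopology.summable_iff_summable_coeff]
  intro d
  apply summable_of_hasFiniteSupport
  have hfin : (Set.pi Set.univ (fun _ : Fin n => Set.Icc (-(d:ℤ)) d)).Finite :=
    Set.Finite.pi fun _ => Set.finite_Icc _ _
  apply hfin.subset
  intro v hv p _
  rw [Function.mem_support] at hv
  have hle : (v p).natAbs ≤ d := by
    by_contra hc
    exact hv (PowerSeries.X_pow_dvd_iff.1 (h v p) d (not_le.1 hc))
  change v p ∈ Set.Icc (-(d:ℤ)) d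
  rw [Set.mem_Icc]
  constructor <;> omega

lemma hasSum_mul_aux {ι κ : Type} (f : ι → ℤ⟦X⟧) (g : κ → ℤ⟦X⟧) {a b : ℤ⟦X⟧}
    (hf : HasSum f a) (hg : HasSum g b) (h : Summable (fun x : ι × κ => f x.1 * g x.2)) :
    HasSum (fun x : ι × κ => f x.1 * g x.2) (a * b) :=
  HasSum.mul hf hg h

lemma fubini (n : ℕ) : ∀ (f : Fin n → ℤ → ℤ⟦X⟧) (F : Fin n → ℤ⟦X⟧),
    (∀ p, HasSum (f p) (F p)) → (∀ p z, X ^ z.natAbs ∣ f p z) →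
    HasSum (fun v : Fin n → ℤ => ∏ p, f p (v p)) (∏ p, F p) := by
  induction n with
  | zero =>
    intro f F _ _
    simpa using hasSum_unique (fun v : Fin 0 → ℤ => (1 : ℤ⟦X⟧))
  | succ n ih =>
    intro f F hf hd
    have hs : Summable (fun v : Fin (n+1) → ℤ => ∏ p, f p (v p)) :=
      summable_of_dvd _ fun v p => (hd p (v p)).trans (dvd_prod_of_mem _ (mem_univ p))
    have ih' : HasSum (fun w : Fin n → ℤ => ∏ p : Fin n, f p.succ (w p)) (∏ p : Fin n, F p.succ) :=
      ih (fun p => f p.succ) (fun p => F p.succ) (fun p => hf _) (fun p z => hd _ z)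
    let e : ℤ × (Fin n → ℤ) ≃ (Fin (n+1) → ℤ) := Fin.consEquiv (fun _ => ℤ)
    have he : (fun v : Fin (n+1) → ℤ => ∏ p, f p (v p)) ∘ e =
        fun x : ℤ × (Fin n → ℤ) => f 0 x.1 * ∏ p : Fin n, f p.succ (x.2 p) := by
      funext x
      simp [e, Fin.prod_univ_succ, Fin.consEquiv]
    have hs' : Summable (fun x : ℤ × (Fin n → ℤ) => f 0 x.1 * ∏ p : Fin n, f p.succ (x.2 p)) := by
      rw [← he]
      exact e.summable_iff.2 hs
    clear_value e
    generalize hP : (fun w : Fin n → ℤ => ∏ p : Fin n, f p.succ (w p)) = P at ih'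
    have hP' : ∀ w : Fin n → ℤ, ∏ p : Fin n, f p.succ (w p) = P w := fun w => congrFun hP w
    simp only [hP'] at hs' he
    have hm := hasSum_mul_aux (f 0) P (hf 0) ih' hs'
    rw [← e.hasSum_iff, he, Fin.prod_univ_succ]
    exact hm

lemma final (t' : ℕ) :
    ∑' μ : {μ : YoungDiagram // μ.transpose = μ ∧
        ∀ c ∈ μ.cells, ¬ (2 * t' + 1) ∣ hookLen μ c},
      PowerSeries.C (R := ℤ) ((-1) ^ durfee μ.1) * X ^ μ.1.card
      =
    ∏' k : ℕ,
      ((1 - X ^ (k + 1)) * PowerSeries.invOfUnit (1 - X ^ (2 * (k + 1))) 1 *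
        (1 - X ^ (2 * (k + 1) * (2 * t' + 1))) ^ t' *
        ((1 - X ^ (2 * (k + 1) * (2 * t' + 1))) *
          PowerSeries.invOfUnit (1 - X ^ ((k + 1) * (2 * t' + 1))) 1)) := by
  rw [← main_product, ← (Equiv.ofBijective _ (coreMap_bij t')).tsum_eq,
    ← Fin.prod_univ_eq_prod_range
      (fun p => ∏' k, TT (2 * t' + 1) (2 * p + 1) (4 * t' + 1 - 2 * p) k)]
  have h := fubini t' (fun p => th (2 * t' + 1) (2 * p + 1))
    (fun p => ∏' k, TT (2 * t' + 1) (2 * p + 1) (4 * t' + 1 - 2 * p) k)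
    (fun p => jtp _ _ _ (by omega) (by omega) (by omega)) (fun p z => by
      rw [th]
      exact Dvd.dvd.mul_left (pow_dvd_pow _
        (natAbs_le_ex _ _ (4 * t' + 1 - 2 * p) (by omega) (by omega) (by omega) z)) _)
  rw [← h.tsum_eq]
  apply tsum_congr
  intro v
  change PowerSeries.C ((-1) ^ durfee (dia (Sv v))) * X ^ (dia (Sv v)).card = _
  rw [durfee_eq, card_eq (dia_sc _), dset_dia, card_Sv, size_Sv]
  simp only [th, prod_mul_distrib, prod_pow_eq_pow_sum, ← map_prod]

end Assembly
end SCC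

theorem signed_genfun_SC_cores_odd (t' : ℕ) :
    ∑' μ : {μ : YoungDiagram // μ.transpose = μ ∧
        ∀ c ∈ μ.cells, ¬ (2 * t' + 1) ∣ hookLen μ c},
      PowerSeries.C (R := ℤ) ((-1) ^ durfee μ.1) * X ^ μ.1.card
      =
    ∏' k : ℕ,
      ((1 - X ^ (k + 1)) * PowerSeries.invOfUnit (1 - X ^ (2 * (k + 1))) 1 *
        (1 - X ^ (2 * (k + 1) * (2 * t' + 1))) ^ t' *
        ((1 - X ^ (2 * (k + 1) * (2 * t' + 1))) *
          PowerSeries.invOfUnit (1 - X ^ ((k + 1) * (2 * t' + 1))) 1)) := by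
  exact SCC.final t'
end
end
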